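/- Let n ≥ 1 and let H be a closed connected subgroup of Sp(1,n) acting ℍ-irreducibly on ℍ^{n+1}. Then there exists P ∈ Sp(1,n) such that P H P⁻¹ equals one of the following groups: (i) SO⁰(1,n), SO⁰(1,n)·(U(1)·𝟙), or SO⁰(1,n)·(Sp(1)·𝟙), these three occurring only if n ≥ 2; (ii) SU(1,n) or U(1,n); (iii) Sp(1,n); (iv) if n = 1, the group U⁰ := {A ∈ Sp(1,1) : AΦ = ΦA}. -/

import Mathlib

/- Statement 0: classification of closed connected ℍ-irreducible subgroups of Sp(1,n). -/

open Quaternion Matrix Pointwise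

noncomputable section

/-- The quaternions over ℝ. -/
abbrev Quat := Quaternion ℝ

/-- The imaginary unit `i` of the quaternions. -/
def qi : Quat := ⟨0, 1, 0, 0⟩

/-- The matrix η = diag(-1,1,…,1). -/
def eta (n : ℕ) : Matrix (Fin (n + 1)) (Fin (n + 1)) Quat :=
  Matrix.diagonal fun i => if i = 0 then -1 else 1

/-- The real matrix η = diag(-1,1,…,1). -/
def etaR (n : ℕ) : Matrix (Fin (n + 1)) (Fin (n + 1)) ℝ :=
  Matrix.diagonal fun i => if i = 0 then -1 else 1

/-- Sp(1,n) as a set of quaternionic matrices. -/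
def Sp (n : ℕ) : Set (Matrix (Fin (n + 1)) (Fin (n + 1)) Quat) :=
  {A | Aᴴ * eta n * A = eta n}

/-- A set of quaternionic matrices acts ℍ-irreducibly on ℍ^{n+1}: the only invariant
right ℍ-submodules are `⊥` and `⊤`. -/
def ActsHIrreducibly (n : ℕ) (S : Set (Matrix (Fin (n + 1)) (Fin (n + 1)) Quat)) : Prop :=
  ∀ W : Submodule Quatᵐᵒᵖ (Fin (n + 1) → Quat),
    (∀ A ∈ S, ∀ v ∈ W, A.mulVec v ∈ W) → W = ⊥ ∨ W = ⊤

/-- SO⁰(1,n): the identity component of the real pseudo-orthogonal group O(1,n),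
regarded inside Sp(1,n) via the inclusion ℝ ⊂ ℍ. -/
def SOo (n : ℕ) : Set (Matrix (Fin (n + 1)) (Fin (n + 1)) Quat) :=
  (fun g : Matrix (Fin (n + 1)) (Fin (n + 1)) ℝ => g.map (algebraMap ℝ Quat)) ''
    connectedComponentIn {g : Matrix (Fin (n + 1)) (Fin (n + 1)) ℝ | gᵀ * etaR n * g = etaR n} 1

/-- U(1)·𝟙: unit-norm scalars in span_ℝ{1,i} times the identity. -/
def U1One (n : ℕ) : Set (Matrix (Fin (n + 1)) (Fin (n + 1)) Quat) :=
  {M | ∃ l : Quat, l.imJ = 0 ∧ l.imK = 0 ∧ ‖l‖ = 1 ∧ M = l • (1 : Matrix (Fin (n + 1)) (Fin (n + 1)) Quat)}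

/-- Sp(1)·𝟙: unit quaternions times the identity. -/
def Sp1One (n : ℕ) : Set (Matrix (Fin (n + 1)) (Fin (n + 1)) Quat) :=
  {M | ∃ q : Quat, ‖q‖ = 1 ∧ M = q • (1 : Matrix (Fin (n + 1)) (Fin (n + 1)) Quat)}

/-- U(1,n): elements of Sp(1,n) with entries in ℂ = span_ℝ{1,i}. -/
def Ugrp (n : ℕ) : Set (Matrix (Fin (n + 1)) (Fin (n + 1)) Quat) :=
  {A ∈ Sp n | ∀ i j, (A i j).imJ = 0 ∧ (A i j).imK = 0}

/-- The identification of span_ℝ{1,i} ⊂ ℍ with ℂ. -/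
def quatToC (q : Quat) : ℂ := ⟨q.re, q.imI⟩

/-- SU(1,n): elements of U(1,n) of complex determinant one. -/
def SUgrp (n : ℕ) : Set (Matrix (Fin (n + 1)) (Fin (n + 1)) Quat) :=
  {A ∈ Ugrp n | (A.map quatToC).det = 1}

/-- The matrix Φ = [[0,-1],[1,0]] (padded by zeros in sizes larger than 2). -/
def Phi (n : ℕ) : Matrix (Fin (n + 1)) (Fin (n + 1)) Quat := fun i j =>
  if (i : ℕ) = 0 ∧ (j : ℕ) = 1 then -1 else if (i : ℕ) = 1 ∧ (j : ℕ) = 0 then 1 else 0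

/-- The group U⁰ = {A ∈ Sp(1,1) : AΦ = ΦA}. -/
def U0grp (n : ℕ) : Set (Matrix (Fin (n + 1)) (Fin (n + 1)) Quat) :=
  {A ∈ Sp n | A * Phi n = Phi n * A}

noncomputable section
set_option linter.unusedSectionVars false

section ClosedSubgroup
open NormedSpace Filter Topology

variable {𝔸 : Type*} [NormedRing 𝔸] [NormedAlgebra ℝ 𝔸] [CompleteSpace 𝔸]

theorem cs_exp_continuous : Continuous (exp : 𝔸 → 𝔸) := by
  let := NormedAlgebra.restrictScalars ℚ ℝ 𝔸
  exact exp_continuous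

theorem cs_exp_add {x y : 𝔸} (h : Commute x y) : exp (x + y) = exp x * exp y := by
  let := NormedAlgebra.restrictScalars ℚ ℝ 𝔸
  exact exp_add_of_commute h

theorem cs_exp_neg_mul (x : 𝔸) : exp (-x) * exp x = 1 := by
  rw [← cs_exp_add ((Commute.refl x).neg_left)]; simp

theorem cs_exp_mul_neg (x : 𝔸) : exp x * exp (-x) = 1 := by
  rw [← cs_exp_add ((Commute.refl x).neg_right)]; simp

theorem cs_exp_nsmul (k : ℕ) (x : 𝔸) : exp ((k : ℝ) • x) = exp x ^ k := by
  let := NormedAlgebra.restrictScalars ℚ ℝ 𝔸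
  rw [← NormedSpace.exp_nsmul, Nat.cast_smul_eq_nsmul]

/-- A closed subgroup (of the unit group) of a Banach algebra, as a closed set. -/
structure IsClSub (H : Set 𝔸) : Prop where
  one : (1 : 𝔸) ∈ H
  mul : ∀ A ∈ H, ∀ B ∈ H, A * B ∈ H
  inv : ∀ A ∈ H, ∃ B ∈ H, A * B = 1 ∧ B * A = 1
  closed : IsClosed H

theorem IsClSub.pow {H : Set 𝔸} (hH : IsClSub H) {A : 𝔸} (hA : A ∈ H) (k : ℕ) : A ^ k ∈ H := by
  induction k with
  | zero => simpa using hH.one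
  | succ k ih => rw [pow_succ]; exact hH.mul _ ih _ hA

theorem IsClSub.exp_neg {H : Set 𝔸} (hH : IsClSub H) {X : 𝔸} (hX : exp X ∈ H) :
    exp (-X) ∈ H := by
  obtain ⟨B, hB, h1, h2⟩ := hH.inv _ hX
  have : exp (-X) = B := by
    calc exp (-X) = exp (-X) * (exp X * B) := by rw [h1, mul_one]
      _ = B := by rw [← mul_assoc, cs_exp_neg_mul, one_mul]
  rwa [this]

theorem IsClSub.exp_int {H : Set 𝔸} (hH : IsClSub H) {X : 𝔸} (hX : exp X ∈ H) (k : ℤ) :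
    exp ((k : ℝ) • X) ∈ H := by
  obtain ⟨m, rfl | rfl⟩ := k.eq_nat_or_neg
  · have := hH.pow hX m
    rw [← cs_exp_nsmul] at this
    simpa using this
  · have := hH.pow hX m
    rw [← cs_exp_nsmul] at this
    have := hH.exp_neg this
    simpa using this

/-- The Lie algebra of a subgroup, as a set. -/
def lieSet (H : Set 𝔸) : Set 𝔸 := {X | ∀ t : ℝ, exp (t • X) ∈ H}

theorem cs_limit {H : Set 𝔸} (hH : IsClSub H) {X : ℕ → 𝔸} {c : ℕ → ℝ} {Y : 𝔸}
    (hX : Tendsto X atTop (𝓝 0)) (hc : Tendsto (fun k => c k • X k) atTop (𝓝 Y))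
    (hE : ∀ᶠ k in atTop, exp (X k) ∈ H) : Y ∈ lieSet H := by
  intro t
  have h1 : Tendsto (fun k => (⌊t * c k⌋ : ℝ) • X k) atTop (𝓝 (t • Y)) := by
    have h2 : Tendsto (fun k => t • (c k • X k) - Int.fract (t * c k) • X k) atTop
        (𝓝 (t • Y - 0)) := by
      refine (hc.const_smul t).sub ?_
      refine squeeze_zero_norm (a := fun k => ‖X k‖) ?_ (by simpa using hX.norm)
      intro k
      rw [norm_smul, Real.norm_eq_abs, abs_of_nonneg (Int.fract_nonneg _)]
      exact mul_le_of_le_one_left (norm_nonneg _) (Int.fract_lt_one _).le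
    rw [sub_zero] at h2
    refine h2.congr fun k => ?_
    rw [smul_smul, ← sub_smul, Int.fract, sub_sub_cancel]
  refine hH.closed.mem_of_tendsto ((cs_exp_continuous.tendsto _).comp h1) ?_
  filter_upwards [hE] with k hk
  exact hH.exp_int hk _

theorem cs_strict : HasStrictFDerivAt (exp : 𝔸 → 𝔸)
    ((ContinuousLinearEquiv.refl ℝ 𝔸 : 𝔸 ≃L[ℝ] 𝔸) : 𝔸 →L[ℝ] 𝔸) 0 :=
  hasStrictFDerivAt_exp_zero

theorem lieSet_smul {H : Set 𝔸} {X : 𝔸} (hX : X ∈ lieSet H) (c : ℝ) : c • X ∈ lieSet H := by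
  intro t
  rw [smul_smul]; exact hX _

theorem lieSet_add {H : Set 𝔸} (hH : IsClSub H) {X Y : 𝔸} (hX : X ∈ lieSet H)
    (hY : Y ∈ lieSet H) : X + Y ∈ lieSet H := by
  set lg := HasStrictFDerivAt.localInverse (exp : 𝔸 → 𝔸) _ 0 cs_strict with hlg
  have hd : HasDerivAt (fun t : ℝ => exp (t • X) * exp (t • Y)) (X + Y) 0 := by
    have := (hasDerivAt_exp_smul_const (𝕂 := ℝ) X 0).mul (hasDerivAt_exp_smul_const (𝕂 := ℝ) Y 0)
    refine this.congr_deriv ?_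
    simp
  have hd2 : HasDerivAt (fun t : ℝ => lg (exp (t • X) * exp (t • Y))) (X + Y) 0 := by
    have h3 := (cs_strict (𝔸 := 𝔸)).to_localInverse.hasFDerivAt
    have h4 : HasFDerivAt lg ((ContinuousLinearEquiv.refl ℝ 𝔸).symm : 𝔸 →L[ℝ] 𝔸)
        (exp ((0:ℝ) • X) * exp ((0:ℝ) • Y)) := by
      simpa using h3
    have := h4.comp_hasDerivAt (0 : ℝ) hd
    exact this
  have hlg0 : lg 1 = 0 := by
    have := (cs_strict (𝔸 := 𝔸)).eventually_left_inverse.self_of_nhds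
    simpa using this
  have hk : Tendsto (fun k : ℕ => ((k : ℝ) + 1)⁻¹) atTop (𝓝 0) := by
    simpa using tendsto_one_div_add_atTop_nhds_zero_nat (𝕜 := ℝ)
  refine cs_limit hH (X := fun k : ℕ => lg (exp (((k : ℝ) + 1)⁻¹ • X) * exp (((k : ℝ) + 1)⁻¹ • Y)))
    (c := fun k => (k : ℝ) + 1) ?_ ?_ ?_
  · have := hd2.continuousAt.tendsto.comp hk
    simpa [hlg0, Function.comp_def] using this
  · have h5 := hd2.tendsto_slope
    have hk2 : Tendsto (fun k : ℕ => ((k : ℝ) + 1)⁻¹) atTop (𝓝[≠] 0) := by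
      refine tendsto_nhdsWithin_iff.2 ⟨hk, ?_⟩
      filter_upwards with k
      have : ((k : ℝ) + 1) ≠ 0 := by positivity
      simpa using this
    have := h5.comp hk2
    refine this.congr fun k => ?_
    simp [slope, hlg0]
  · have h6 : ContinuousAt (fun t : ℝ => exp (t • X) * exp (t • Y)) 0 := hd.continuousAt
    have h7 := (cs_strict (𝔸 := 𝔸)).eventually_right_inverse
    have h8 : Tendsto (fun k : ℕ => exp (((k : ℝ) + 1)⁻¹ • X) * exp (((k : ℝ) + 1)⁻¹ • Y)) atTop
        (𝓝 (exp (0:𝔸))) := by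
      have := h6.tendsto.comp hk
      simpa [Function.comp_def] using this
    filter_upwards [h8.eventually h7] with k hk
    rw [hk]
    exact hH.mul _ (hX _) _ (hY _)

/-- The Lie algebra as a real subspace. -/
def lieSub {H : Set 𝔸} (hH : IsClSub H) : Submodule ℝ 𝔸 where
  carrier := lieSet H
  add_mem' := lieSet_add hH
  zero_mem' := by intro t; simpa using hH.one
  smul_mem' c _ hX := lieSet_smul hX c

theorem lieSet_conj {H : Set 𝔸} (hH : IsClSub H) {X A A' : 𝔸} (hX : X ∈ lieSet H)
    (hA : A ∈ H) (hA' : A' ∈ H) (h1 : A * A' = 1) (h2 : A' * A = 1) :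
    A * X * A' ∈ lieSet H := by
  intro t
  let := NormedAlgebra.restrictScalars ℚ ℝ 𝔸
  have := exp_units_conj (⟨A, A', h1, h2⟩ : 𝔸ˣ) (t • X)
  simp only [Units.inv_mk] at this
  have e : t • (A * X * A') = A * (t • X) * A' := by simp
  rw [e, this]
  exact hH.mul _ (hH.mul _ hA _ (hX t)) _ hA'

variable [FiniteDimensional ℝ 𝔸]

theorem lieSet_bracket {H : Set 𝔸} (hH : IsClSub H) {X Y : 𝔸} (hX : X ∈ lieSet H)
    (hY : Y ∈ lieSet H) : X * Y - Y * X ∈ lieSet H := by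
  have hd : HasDerivAt (fun t : ℝ => exp (t • X) * Y * exp (t • (-X))) (X * Y - Y * X) 0 := by
    have := ((hasDerivAt_exp_smul_const (𝕂 := ℝ) X 0).mul_const Y).mul
      (hasDerivAt_exp_smul_const (𝕂 := ℝ) (-X) 0)
    refine this.congr_deriv ?_
    simp [sub_eq_add_neg]
  have hcl : IsClosed ((lieSub hH : Submodule ℝ 𝔸) : Set 𝔸) := Submodule.closed_of_finiteDimensional _
  have hmem : ∀ t : ℝ, exp (t • X) * Y * exp (t • (-X)) ∈ lieSub hH := by
    intro t
    refine lieSet_conj hH hY (hX t) ?_ ?_ ?_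
    · have := hX (-t); simpa using this
    · have := cs_exp_mul_neg (t • X); simpa using this
    · have := cs_exp_neg_mul (t • X); simpa using this
  have h5 := hd.tendsto_slope
  refine hcl.mem_of_tendsto h5 ?_
  filter_upwards with t
  simp only [slope, vsub_eq_sub]
  exact Submodule.smul_mem _ _ (Submodule.sub_mem _ (hmem t) (hmem 0))

theorem cs_nhds {H : Set 𝔸} (hH : IsClSub H) :
    ∀ᶠ g in 𝓝 (1 : 𝔸), g ∈ H → ∃ X ∈ lieSet H, exp X = g := by
  by_contra hcon
  set L := lieSub hH
  obtain ⟨Q, hQ⟩ := Submodule.exists_isCompl L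
  -- the map (X, Y) ↦ exp X * exp Y
  let f : L × Q → 𝔸 := fun p => exp (p.1 : 𝔸) * exp (p.2 : 𝔸)
  let f' : (L × Q) →L[ℝ] 𝔸 := L.subtypeL.comp (ContinuousLinearMap.fst ℝ L Q) +
    Q.subtypeL.comp (ContinuousLinearMap.snd ℝ L Q)
  have hf : HasStrictFDerivAt f f' 0 := by
    have e0 : HasStrictFDerivAt (exp : 𝔸 → 𝔸) (1 : 𝔸 →L[ℝ] 𝔸) 0 := hasStrictFDerivAt_exp_zero
    have h1 : HasStrictFDerivAt (fun p : L × Q => exp (p.1 : 𝔸))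
        (L.subtypeL.comp (ContinuousLinearMap.fst ℝ L Q)) 0 := by
      have := HasStrictFDerivAt.comp (0 : L × Q) (f := fun p : L × Q => (p.1 : 𝔸)) (g := exp)
        (by simpa using e0)
        ((L.subtypeL.comp (ContinuousLinearMap.fst ℝ L Q)).hasStrictFDerivAt)
      exact this
    have h2 : HasStrictFDerivAt (fun p : L × Q => exp (p.2 : 𝔸))
        (Q.subtypeL.comp (ContinuousLinearMap.snd ℝ L Q)) 0 := by
      have := HasStrictFDerivAt.comp (0 : L × Q) (f := fun p : L × Q => (p.2 : 𝔸)) (g := exp)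
        (by simpa using e0)
        ((Q.subtypeL.comp (ContinuousLinearMap.snd ℝ L Q)).hasStrictFDerivAt)
      exact this
    have := h1.mul' h2
    refine this.congr_fderiv ?_
    ext p
    · simp [f']
    · simp [f']
  have hsurj : (f' : (L × Q) →ₗ[ℝ] 𝔸).range = ⊤ := by
    rw [eq_top_iff]
    intro v _
    have : v ∈ L ⊔ Q := by rw [hQ.sup_eq_top]; trivial
    obtain ⟨a, ha, b, hb, rfl⟩ := Submodule.mem_sup.1 this
    exact ⟨(⟨a, ha⟩, ⟨b, hb⟩), by simp [f']⟩
  have hmap := hf.map_nhds_eq_of_surj hsurj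
  have hf0 : f 0 = 1 := by simp [f]
  rw [hf0] at hmap
  -- get a sequence of bad points
  have hfr : ∃ᶠ p in 𝓝 (0 : L × Q), f p ∈ H ∧ ¬ ∃ X ∈ lieSet H, exp X = f p := by
    intro hc
    apply hcon
    rw [← hmap, Filter.eventually_map]
    filter_upwards [hc] with p hp hpH
    by_contra h3
    exact hp ⟨hpH, h3⟩
  obtain ⟨u, hu0, hu⟩ := Filter.exists_seq_forall_of_frequently hfr
  have hY : ∀ k, exp ((u k).2 : 𝔸) ∈ H := by
    intro k
    have h1 : exp ((u k).2 : 𝔸) = exp (-((u k).1 : 𝔸)) * f (u k) := by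
      simp only [f]; rw [← mul_assoc, cs_exp_neg_mul, one_mul]
    rw [h1]
    refine hH.mul _ ?_ _ (hu k).1
    have : -((u k).1 : 𝔸) ∈ lieSet H := (L.neg_mem (u k).1.2)
    simpa using this 1
  have hY0 : ∀ k, (u k).2 ≠ 0 := by
    intro k h0
    apply (hu k).2
    exact ⟨(u k).1, (u k).1.2, by simp [f, h0]⟩
  have hYt : Tendsto (fun k => ((u k).2 : 𝔸)) atTop (𝓝 0) := by
    have h1 : Continuous (fun p : L × Q => (p.2 : 𝔸)) := by fun_prop
    have := (h1.tendsto 0).comp hu0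
    simpa [Function.comp_def] using this
  have hcomp : IsCompact (Metric.sphere (0 : Q) 1) := isCompact_sphere _ _
  have hmem : ∀ k, ‖(u k).2‖⁻¹ • (u k).2 ∈ Metric.sphere (0 : Q) 1 := by
    intro k
    have : ‖(u k).2‖ ≠ 0 := by simpa using hY0 k
    rw [mem_sphere_zero_iff_norm, norm_smul, norm_inv, norm_norm, inv_mul_cancel₀ this]
  obtain ⟨y, hy, φ, hφ, hlim⟩ := hcomp.tendsto_subseq hmem
  have hyL : (y : 𝔸) ∈ lieSet H := by
    refine cs_limit hH (X := fun k => ((u (φ k)).2 : 𝔸)) (c := fun k => ‖(u (φ k)).2‖⁻¹)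
      (hYt.comp hφ.tendsto_atTop) ?_ (Eventually.of_forall fun k => hY _)
    have h1 : Continuous (fun p : Q => (p : 𝔸)) := by fun_prop
    have := (h1.tendsto y).comp hlim
    exact this
  have hy0 : (y : 𝔸) = 0 := by
    have : (y : 𝔸) ∈ L ⊓ Q := ⟨hyL, y.2⟩
    rw [hQ.inf_eq_bot] at this
    simpa using this
  have : y = 0 := Subtype.ext (by simpa using hy0)
  rw [this] at hy
  simp at hy

/-- A connected set `C` containing `1`, whose points near `1` are exponentials of elements in
the Lie algebra of `H` (in the sense of left translates), is contained in `H`. -/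
theorem cs_connected_subset {H C : Set 𝔸} (hH : IsClSub H) (hC : IsPreconnected C)
    (h1 : (1 : 𝔸) ∈ C) (S : Set 𝔸) (hS : IsClSub S) (hCS : C ⊆ S)
    (hSe : ∀ᶠ g in 𝓝 (1 : 𝔸), g ∈ S → g ∈ H) : C ⊆ H := by
  -- H ∩ S is relatively open and closed in S
  have hopen : ∀ g ∈ C, g ∈ H → ∀ᶠ g' in 𝓝 g, g' ∈ S → g' ∈ H := by
    intro g hgC hgH
    obtain ⟨k, hkS, hk1, hk2⟩ := hS.inv g (hCS hgC)
    have hcont : Tendsto (fun g' => k * g') (𝓝 g) (𝓝 1) := by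
      have : Continuous (fun g' : 𝔸 => k * g') := by fun_prop
      have := this.tendsto g
      rwa [hk2] at this
    filter_upwards [hcont.eventually hSe] with g' hg' hg'S
    have := hH.mul _ hgH _ (hg' (hS.mul _ hkS _ hg'S))
    rwa [← mul_assoc, hk1, one_mul] at this
  set U : Set 𝔸 := interior {g | g ∈ S → g ∈ H}
  have hU : IsOpen U := isOpen_interior
  have hV : IsOpen Hᶜ := hH.closed.isOpen_compl
  intro g hg
  by_contra hgH
  have hsub : C ⊆ U ∪ Hᶜ := by
    intro g hg
    by_cases h : g ∈ H
    · left
      exact mem_interior_iff_mem_nhds.2 (hopen g hg h)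
    · right; exact h
  have := hC U Hᶜ hU hV hsub ⟨1, h1, mem_interior_iff_mem_nhds.2 (hopen 1 h1 hH.one)⟩ ⟨g, hg, hgH⟩
  obtain ⟨g', hg'C, hg'U, hg'H⟩ := this
  exact hg'H (interior_subset hg'U (hCS hg'C))

/-- A connected closed group is generated by exponentials of its Lie algebra. -/
theorem cs_generated {H : Set 𝔸} (hH : IsClSub H) (hC : IsPreconnected H) :
    H ⊆ (Submonoid.closure (exp '' lieSet H) : Submonoid 𝔸) := by
  set T := Submonoid.closure (exp '' lieSet H) with hT
  have hTinv : ∀ g ∈ T, ∃ k ∈ T, g * k = 1 ∧ k * g = 1 := by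
    intro g hg
    induction hg using Submonoid.closure_induction with
    | mem x hx =>
      obtain ⟨X, hX, rfl⟩ := hx
      exact ⟨exp (-X), Submonoid.subset_closure ⟨-X, (lieSub hH).neg_mem hX, rfl⟩,
        cs_exp_mul_neg X, cs_exp_neg_mul X⟩
    | one => exact ⟨1, T.one_mem, by simp, by simp⟩
    | mul x y _ _ hx hy =>
      obtain ⟨a, ha, ha1, ha2⟩ := hx
      obtain ⟨b, hb, hb1, hb2⟩ := hy
      refine ⟨b * a, T.mul_mem hb ha, ?_, ?_⟩
      · rw [mul_assoc, ← mul_assoc y, hb1, one_mul, ha1]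
      · rw [mul_assoc, ← mul_assoc a, ha2, one_mul, hb2]
  have hTH : (T : Set 𝔸) ⊆ H := by
    intro g hg
    induction hg using Submonoid.closure_induction with
    | mem x hx =>
      obtain ⟨X, hX, rfl⟩ := hx
      simpa using hX 1
    | one => exact hH.one
    | mul x y _ _ hx hy => exact hH.mul _ hx _ hy
  have hnear : ∀ᶠ g in 𝓝 (1 : 𝔸), g ∈ H → g ∈ T := by
    filter_upwards [cs_nhds hH] with g hg hgH
    obtain ⟨X, hX, rfl⟩ := hg hgH
    exact Submonoid.subset_closure ⟨X, hX, rfl⟩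
  -- each point g of H has a neighbourhood g·U of points equivalent modulo T
  have hloc : ∀ g ∈ H, ∀ᶠ g' in 𝓝 g, g' ∈ H → (g ∈ T ↔ g' ∈ T) := by
    intro g hg
    obtain ⟨k, hk, hk1, hk2⟩ := hH.inv g hg
    have hcont : Tendsto (fun g' => k * g') (𝓝 g) (𝓝 1) := by
      have : Continuous (fun g' : 𝔸 => k * g') := by fun_prop
      have := this.tendsto g
      rwa [hk2] at this
    filter_upwards [hcont.eventually hnear] with g' hg' hg'H
    have h1 := hg' (hH.mul _ hk _ hg'H)
    constructor
    · intro h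
      have := T.mul_mem h h1
      rwa [← mul_assoc, hk1, one_mul] at this
    · intro h
      obtain ⟨l, hl, hl1, hl2⟩ := hTinv _ h1
      have := T.mul_mem h hl
      have e : g' * l = g := by
        calc g' * l = (g * k) * g' * l := by rw [hk1, one_mul]
          _ = g * (k * g' * l) := by noncomm_ring
          _ = g := by rw [hl1, mul_one]
      rwa [e] at this
  intro g hg
  by_contra hgT
  set U : Set 𝔸 := interior {g | g ∈ H → g ∈ T}
  set V : Set 𝔸 := interior {g | g ∈ H → g ∉ T}
  have hsub : H ⊆ U ∪ V := by
    intro g hg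
    by_cases h : g ∈ T
    · left
      refine mem_interior_iff_mem_nhds.2 ?_
      filter_upwards [hloc g hg] with g' hg' hg'H
      exact (hg' hg'H).1 h
    · right
      refine mem_interior_iff_mem_nhds.2 ?_
      filter_upwards [hloc g hg] with g' hg' hg'H
      exact fun h' => h ((hg' hg'H).2 h')
  have hU1 : (1 : 𝔸) ∈ U := by
    refine mem_interior_iff_mem_nhds.2 hnear
  have hVg : g ∈ V := by
    rcases hsub hg with h | h
    · exact absurd (interior_subset h hg) hgT
    · exact h
  obtain ⟨g', h1, h2, h3⟩ := hC U V isOpen_interior isOpen_interior hsub ⟨1, hH.one, hU1⟩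
    ⟨g, hg, hVg⟩
  exact interior_subset h3 h1 (interior_subset h2 h1)

end ClosedSubgroup
end

noncomputable section

/-- Square quaternionic matrices of size `n+1`. -/
abbrev QM (n : ℕ) := Matrix (Fin (n + 1)) (Fin (n + 1)) Quat

section Wrap
open NormedSpace Filter Topology
open scoped Matrix.Norms.Operator

/-- The matrix exponential, for the operator norm topology. -/
def mexp {n : ℕ} (X : QM n) : QM n := @NormedSpace.exp (QM n) _ (UniformSpace.toTopologicalSpace) _ X

/-- closed subgroups of quaternionic matrices. -/
def MClSub {n : ℕ} (H : Set (QM n)) : Prop := IsClSub H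

theorem MClSub.mk' {n : ℕ} {H : Set (QM n)} (h1 : 1 ∈ H) (h2 : ∀ A ∈ H, ∀ B ∈ H, A * B ∈ H)
    (h3 : ∀ A ∈ H, ∃ B ∈ H, A * B = 1 ∧ B * A = 1) (h4 : IsClosed H) : MClSub H :=
  ⟨h1, h2, h3, h4⟩

/-- The Lie algebra of a closed subgroup. -/
def mlie {n : ℕ} {H : Set (QM n)} (hH : MClSub H) : Submodule ℝ (QM n) := lieSub hH

variable {n : ℕ}

theorem MClSub.one {H : Set (QM n)} (hH : MClSub H) : (1 : QM n) ∈ H := IsClSub.one hH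
theorem MClSub.mul {H : Set (QM n)} (hH : MClSub H) : ∀ A ∈ H, ∀ B ∈ H, A * B ∈ H := IsClSub.mul hH
theorem MClSub.inv {H : Set (QM n)} (hH : MClSub H) : ∀ A ∈ H, ∃ B ∈ H, A * B = 1 ∧ B * A = 1 :=
  IsClSub.inv hH
theorem MClSub.closed {H : Set (QM n)} (hH : MClSub H) : IsClosed H := IsClSub.closed hH

theorem mem_mlie {H : Set (QM n)} (hH : MClSub H) {X : QM n} :
    X ∈ mlie hH ↔ ∀ t : ℝ, mexp (t • X) ∈ H := Iff.rfl

theorem mlie_bracket {H : Set (QM n)} (hH : MClSub H) {X Y : QM n} (hX : X ∈ mlie hH)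
    (hY : Y ∈ mlie hH) : X * Y - Y * X ∈ mlie hH := lieSet_bracket hH hX hY

theorem mlie_conj {H : Set (QM n)} (hH : MClSub H) {X A A' : QM n} (hX : X ∈ mlie hH)
    (hA : A ∈ H) (hA' : A' ∈ H) (h1 : A * A' = 1) (h2 : A' * A = 1) :
    A * X * A' ∈ mlie hH := lieSet_conj hH hX hA hA' h1 h2

theorem mlie_closed {H : Set (QM n)} (hH : MClSub H) : IsClosed (mlie hH : Set (QM n)) :=
  Submodule.closed_of_finiteDimensional _

theorem mgenerated {H : Set (QM n)} (hH : MClSub H) (hC : IsPreconnected H) :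
    H ⊆ (Submonoid.closure (mexp '' (mlie hH)) : Submonoid (QM n)) := cs_generated hH hC

theorem mconnected_subset {H C : Set (QM n)} (hH : MClSub H) (hC : IsPreconnected C)
    (h1 : (1 : QM n) ∈ C) {S : Set (QM n)} (hS : MClSub S) (hCS : C ⊆ S)
    (hSe : ∀ X ∈ mlie hS, X ∈ mlie hH) : C ⊆ H := by
  refine cs_connected_subset hH hC h1 S hS hCS ?_
  filter_upwards [cs_nhds hS] with g hg hgS
  obtain ⟨X, hX, rfl⟩ := hg hgS
  have := hSe X hX 1
  simpa using this

theorem mexp_zero : mexp (0 : QM n) = 1 := NormedSpace.exp_zero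
theorem mexp_add {X Y : QM n} (h : Commute X Y) : mexp (X + Y) = mexp X * mexp Y := cs_exp_add h
theorem mexp_mul_neg (X : QM n) : mexp X * mexp (-X) = 1 := cs_exp_mul_neg X
theorem mexp_neg_mul (X : QM n) : mexp (-X) * mexp X = 1 := cs_exp_neg_mul X
theorem mexp_continuous : Continuous (mexp : QM n → QM n) := cs_exp_continuous

theorem mexp_conj {A A' X : QM n} (h1 : A * A' = 1) (h2 : A' * A = 1) :
    mexp (A * X * A') = A * mexp X * A' := by
  let := NormedAlgebra.restrictScalars ℚ ℝ (QM n)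
  exact exp_units_conj (⟨A, A', h1, h2⟩ : (QM n)ˣ) X

theorem mexp_mem (S : Subalgebra ℝ (QM n)) {X : QM n} (hX : X ∈ S) : mexp X ∈ S := by
  let := NormedAlgebra.restrictScalars ℚ ℝ (QM n)
  have : IsClosed (S : Set (QM n)) := Submodule.closed_of_finiteDimensional (Subalgebra.toSubmodule S)
  have h2 := NormedSpace.exp_mem (s := S.restrictScalars ℚ) (x := X) this hX
  exact h2

theorem mexp_map {A : Type*} [NormedRing A] [NormedAlgebra ℝ A] [CompleteSpace A]
    [FiniteDimensional ℝ A] (f : A →ₐ[ℝ] QM n) (x : A) : mexp (f x) = f (NormedSpace.exp x) := by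
  let := NormedAlgebra.restrictScalars ℚ ℝ (QM n)
  let := NormedAlgebra.restrictScalars ℚ ℝ A
  have : Continuous f := LinearMap.continuous_of_finiteDimensional f.toLinearMap
  have := NormedSpace.map_exp f this x
  exact this.symm

theorem mexp_conjTranspose (X : QM n) : mexp Xᴴ = (mexp X)ᴴ := Matrix.exp_conjTranspose X

theorem mexp_sq_zero {X : QM n} (h : X * X = 0) : mexp X = 1 + X := by
  let := NormedAlgebra.restrictScalars ℚ ℝ (QM n)
  have h1 : (NormedSpace.exp X : QM n) = ∑' k : ℕ, ((k.factorial : ℝ)⁻¹) • X ^ k := by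
    rw [NormedSpace.exp_eq_tsum ℝ]
  have h2 : mexp X = ∑' k : ℕ, ((k.factorial : ℝ)⁻¹) • X ^ k := h1
  rw [h2, tsum_eq_sum (s := {0, 1})]
  · simp
  · intro k hk
    obtain ⟨j, rfl⟩ : ∃ j, k = j + 2 := ⟨k - 2, by
      have : k ≠ 0 ∧ k ≠ 1 := by simpa using hk
      omega⟩
    rw [pow_add, pow_two, h]; simp

theorem mexp_hasDerivAt (X : QM n) : HasDerivAt (fun t : ℝ => mexp (t • X)) X 0 := by
  have := hasDerivAt_exp_smul_const (𝕂 := ℝ) X 0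
  simp at this
  exact this

theorem mexp_preserves {X M : QM n} (h : ∀ t : ℝ, (mexp (t • X))ᴴ * M * mexp (t • X) = M) :
    Xᴴ * M + M * X = 0 := by
  have h1 : HasDerivAt (fun t : ℝ => mexp (t • Xᴴ) * M * mexp (t • X)) (Xᴴ * M + M * X) 0 := by
    have := ((mexp_hasDerivAt Xᴴ).mul_const M).mul (mexp_hasDerivAt X)
    refine this.congr_deriv ?_
    simp [mexp_zero]
  have h2 : (fun t : ℝ => mexp (t • Xᴴ) * M * mexp (t • X)) = fun _ => M := by
    funext t
    have e : mexp (t • Xᴴ) = (mexp (t • X))ᴴ := by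
      rw [← mexp_conjTranspose]
      congr 1
      ext i j <;> simp [Matrix.conjTranspose_apply]
    rw [e, h t]
  rw [h2] at h1
  exact h1.unique (hasDerivAt_const _ _)

theorem mexp_path (X : QM n) : Continuous (fun t : ℝ => mexp (t • X)) :=
  mexp_continuous.comp (by fun_prop)

end Wrap
end

noncomputable section

/-- Quaternionic column vectors of length `n+1`. -/
abbrev QV (n : ℕ) := Fin (n + 1) → Quat

/-- The signs of the form. -/
def sg {n : ℕ} (i : Fin (n + 1)) : ℝ := if i = 0 then -1 else 1

theorem sg_sq {n : ℕ} (i : Fin (n + 1)) : sg i * sg i = 1 := by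
  unfold sg; split_ifs <;> norm_num

theorem eta_eq (n : ℕ) : eta n = Matrix.diagonal fun i => ((sg i : ℝ) : Quat) := by
  unfold eta sg; congr 1; funext i; split_ifs <;> simp

/-- right scaling -/
def rs {n : ℕ} (v : QV n) (q : Quat) : QV n := fun i => v i * q

/-- The quaternionic hermitian form of signature `(n,1)`. -/
def qB {n : ℕ} (v w : QV n) : Quat := ∑ i, sg i • (star (v i) * w i)

/-- The matrix `a b* η - b a* η`. -/
def qR {n : ℕ} (a b : QV n) : QM n := fun i j => sg j • (a i * star (b j) - b i * star (a j))

section rsl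
variable {n : ℕ} (v w : QV n) (p q : Quat) (t : ℝ)
theorem rs_apply (i) : rs v q i = v i * q := rfl
theorem rs_op : rs v q = MulOpposite.op q • v := rfl
@[simp] theorem rs_one : rs v 1 = v := by ext1; simp [rs]
@[simp] theorem rs_zero : rs v 0 = 0 := by ext1; simp [rs]
@[simp] theorem zero_rs : rs (0 : QV n) q = 0 := by ext1; simp [rs]
@[simp] theorem rs_rs : rs (rs v p) q = rs v (p * q) := by ext1; simp [rs, mul_assoc]
theorem rs_add : rs v (p + q) = rs v p + rs v q := by ext1; simp [rs, mul_add]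
theorem rs_sub : rs v (p - q) = rs v p - rs v q := by ext1; simp [rs, mul_sub]
theorem rs_neg : rs v (-q) = - rs v q := by ext1; simp [rs]
theorem add_rs : rs (v + w) q = rs v q + rs w q := by ext1; simp [rs, add_mul]
theorem sub_rs : rs (v - w) q = rs v q - rs w q := by ext1; simp [rs, sub_mul]
theorem neg_rs : rs (-v) q = - rs v q := by ext1; simp [rs]
theorem smul_rs : rs (t • v) q = t • rs v q := by ext1; simp [rs]
theorem rs_smul : rs v (t • q) = t • rs v q := by ext1; simp [rs]
theorem rs_coe : rs v (t : Quat) = t • v := by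
  ext1 i; simp [rs, Quaternion.mul_coe_eq_smul]
theorem sum_rs {ι : Type*} (s : Finset ι) (f : ι → QV n) : rs (∑ i ∈ s, f i) q = ∑ i ∈ s, rs (f i) q := by
  ext1 i; simp [rs, Finset.sum_mul]

theorem qB_add_left (u : QV n) : qB (v + w) u = qB v u + qB w u := by
  simp [qB, add_mul, Finset.sum_add_distrib]
theorem qB_add_right (u : QV n) : qB u (v + w) = qB u v + qB u w := by
  simp [qB, mul_add, Finset.sum_add_distrib]
@[simp] theorem qB_zero_left : qB 0 v = 0 := by simp [qB]
@[simp] theorem qB_zero_right : qB v 0 = 0 := by simp [qB]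
theorem qB_neg_left : qB (-v) w = - qB v w := by simp [qB]
theorem qB_neg_right : qB v (-w) = - qB v w := by simp [qB]
theorem qB_sub_left (u : QV n) : qB (v - w) u = qB v u - qB w u := by
  rw [sub_eq_add_neg, qB_add_left, qB_neg_left, sub_eq_add_neg]
theorem qB_sub_right (u : QV n) : qB u (v - w) = qB u v - qB u w := by
  rw [sub_eq_add_neg, qB_add_right, qB_neg_right, sub_eq_add_neg]
theorem qB_smul_left : qB (t • v) w = t • qB v w := by
  simp only [qB, Pi.smul_apply, Quaternion.star_smul, smul_mul_assoc, Finset.smul_sum]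
  exact Finset.sum_congr rfl fun i _ => smul_comm _ _ _
theorem qB_smul_right : qB v (t • w) = t • qB v w := by
  simp only [qB, Pi.smul_apply, mul_smul_comm, Finset.smul_sum]
  exact Finset.sum_congr rfl fun i _ => smul_comm _ _ _
theorem qB_rs_left : qB (rs v q) w = star q * qB v w := by
  simp [qB, rs, Finset.mul_sum, mul_assoc]
theorem qB_rs_right : qB v (rs w q) = qB v w * q := by
  simp [qB, rs, Finset.sum_mul, mul_assoc]
theorem qB_star : star (qB v w) = qB w v := by
  simp [qB, Quaternion.star_smul]
theorem qB_sum_right {ι : Type*} (s : Finset ι) (f : ι → QV n) :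
    qB v (∑ i ∈ s, f i) = ∑ i ∈ s, qB v (f i) := by
  induction s using Finset.cons_induction with
  | empty => simp
  | cons a s ha ih => rw [Finset.sum_cons, Finset.sum_cons, qB_add_right, ih]
theorem qB_sum_left {ι : Type*} (s : Finset ι) (f : ι → QV n) :
    qB (∑ i ∈ s, f i) v = ∑ i ∈ s, qB (f i) v := by
  induction s using Finset.cons_induction with
  | empty => simp
  | cons a s ha ih => rw [Finset.sum_cons, Finset.sum_cons, qB_add_left, ih]

theorem qB_self_real : qB v v = ((qB v v).re : Quat) := by
  have := qB_star v v
  exact (Quaternion.star_eq_self.1 this)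

theorem mulVec_rs (X : QM n) : X *ᵥ (rs v q) = rs (X *ᵥ v) q := by
  ext1 i; simp only [Matrix.mulVec, dotProduct, rs, Finset.sum_mul, mul_assoc]

theorem QM_ext {X Y : QM n} (h : ∀ v, X *ᵥ v = Y *ᵥ v) : X = Y := by
  exact Matrix.ext_of_mulVec_single (fun i => h _)

theorem smul_mulVec' (X : QM n) : (t • X) *ᵥ v = t • (X *ᵥ v) := Matrix.smul_mulVec _ _ _
theorem mulVec_smul' (X : QM n) : X *ᵥ (t • v) = t • (X *ᵥ v) := Matrix.mulVec_smul _ _ _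
end rsl

section Bmore
variable {n : ℕ}

theorem qB_eq (v w : QV n) : qB v w = star v ⬝ᵥ (eta n *ᵥ w) := by
  rw [eta_eq]
  simp only [qB, dotProduct, Matrix.mulVec_diagonal, Pi.star_apply, Quaternion.coe_mul_eq_smul, mul_smul_comm]

theorem qB_mat (X Y : QM n) (v w : QV n) :
    star v ⬝ᵥ ((Xᴴ * eta n * Y) *ᵥ w) = qB (X *ᵥ v) (Y *ᵥ w) := by
  rw [qB_eq, Matrix.star_mulVec, ← Matrix.mulVec_mulVec, ← Matrix.mulVec_mulVec,
    Matrix.dotProduct_mulVec]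

theorem form_ext {M N : QM n} (h : ∀ v w : QV n, star v ⬝ᵥ (M *ᵥ w) = star v ⬝ᵥ (N *ᵥ w)) : M = N := by
  ext1 i j
  have := h (Pi.single i 1) (Pi.single j 1)
  have e : star (Pi.single i 1 : QV n) = Pi.single i 1 := by
    rw [← Pi.single_star]; simp
  simpa [e] using this

theorem mem_Sp_iff {A : QM n} : A ∈ Sp n ↔ ∀ v w, qB (A *ᵥ v) (A *ᵥ w) = qB v w := by
  constructor
  · intro h v w
    have h' : Aᴴ * eta n * A = eta n := h
    rw [← qB_mat, h', qB_eq]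
  · intro h
    show Aᴴ * eta n * A = eta n
    refine form_ext fun v w => ?_
    rw [qB_mat, h, qB_eq]

/-- Infinitesimal isometries. -/
def IsSk (X : QM n) : Prop := ∀ v w, qB (X *ᵥ v) w = - qB v (X *ᵥ w)

theorem isSk_iff {X : QM n} : IsSk X ↔ Xᴴ * eta n + eta n * X = 0 := by
  have e1 : ∀ v w, star v ⬝ᵥ ((Xᴴ * eta n + eta n * X) *ᵥ w) = qB (X *ᵥ v) w + qB v (X *ᵥ w) := by
    intro v w
    rw [Matrix.add_mulVec, dotProduct_add]
    have h1 := qB_mat X 1 v w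
    have h2 := qB_mat 1 X v w
    simp at h1 h2
    rw [h1, h2]
  constructor
  · intro h
    refine form_ext fun v w => ?_
    rw [e1, h]; simp
  · intro h v w
    have := e1 v w
    rw [h] at this
    simp at this
    exact eq_neg_of_add_eq_zero_left this.symm

theorem eta_sq : eta n * eta n = 1 := by
  rw [eta_eq, Matrix.diagonal_mul_diagonal, ← Matrix.diagonal_one]
  congr 1; funext i
  rw [← Quaternion.coe_mul, sg_sq]; simp

theorem eta_conj : (eta n)ᴴ = eta n := by
  rw [eta_eq, Matrix.diagonal_conjTranspose]
  congr 1; funext i; simp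

theorem Sp_inv_left {A : QM n} (h : A ∈ Sp n) : (eta n * Aᴴ * eta n) * A = 1 := by
  have h' : Aᴴ * eta n * A = eta n := h
  calc (eta n * Aᴴ * eta n) * A = eta n * (Aᴴ * eta n * A) := by noncomm_ring
    _ = 1 := by rw [h', eta_sq]

theorem Sp_inv_right {A : QM n} (h : A ∈ Sp n) : A * (eta n * Aᴴ * eta n) = 1 :=
  mul_eq_one_comm.1 (Sp_inv_left h)

theorem Sp_one : (1 : QM n) ∈ Sp n := by rw [mem_Sp_iff]; simp
theorem Sp_mul {A C : QM n} (hA : A ∈ Sp n) (hC : C ∈ Sp n) : A * C ∈ Sp n := by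
  rw [mem_Sp_iff] at *
  intro v w
  rw [← Matrix.mulVec_mulVec, ← Matrix.mulVec_mulVec, hA, hC]
theorem Sp_of_inv {A C : QM n} (hA : A ∈ Sp n) (h : A * C = 1) : C ∈ Sp n := by
  rw [mem_Sp_iff] at *
  intro v w
  rw [← hA, Matrix.mulVec_mulVec, Matrix.mulVec_mulVec, h]; simp
theorem Sp_inv_adj {A C : QM n} (hA : A ∈ Sp n) (h : A * C = 1) (v w : QV n) :
    qB (A *ᵥ v) w = qB v (C *ᵥ w) := by
  have := (mem_Sp_iff.1 hA) v (C *ᵥ w)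
  rw [Matrix.mulVec_mulVec, h] at this
  simpa using this

theorem Sp_closed : IsClosed (Sp n) := by
  have : Continuous (fun A : QM n => Aᴴ * eta n * A) := by fun_prop
  exact isClosed_eq this continuous_const

theorem qB_single (v : QV n) (i) : qB (Pi.single i 1) v = sg i • v i := by
  rw [qB, Finset.sum_eq_single i]
  · simp
  · intro j _ hj; simp [Pi.single_eq_of_ne hj]
  · simp

theorem qB_nondeg {v : QV n} (h : ∀ w, qB w v = 0) : v = 0 := by
  ext1 i
  have := h (Pi.single i 1)
  rw [qB_single] at this
  have h2 : sg i ≠ 0 := by unfold sg; split_ifs <;> norm_num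
  simpa [h2] using this

theorem qR_mulVec (a b v : QV n) : qR a b *ᵥ v = rs a (qB b v) - rs b (qB a v) := by
  ext1 i
  simp only [qR, Matrix.mulVec, dotProduct, rs, qB, Pi.sub_apply, Finset.mul_sum]
  rw [← Finset.sum_sub_distrib]
  refine Finset.sum_congr rfl fun j _ => ?_
  simp only [smul_mul_assoc, mul_smul_comm, ← smul_sub, sub_mul, mul_assoc]

theorem qR_sk (a b : QV n) : IsSk (qR a b) := by
  intro v w
  simp only [qR_mulVec, qB_sub_left, qB_sub_right, qB_rs_left, qB_rs_right, qB_star]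
  noncomm_ring

theorem qR_bracket {X : QM n} (hX : IsSk X) (a b : QV n) :
    X * qR a b - qR a b * X = qR (X *ᵥ a) b + qR a (X *ᵥ b) := by
  refine QM_ext fun v => ?_
  simp only [Matrix.sub_mulVec, Matrix.add_mulVec, ← Matrix.mulVec_mulVec, qR_mulVec,
    Matrix.mulVec_sub, mulVec_rs, hX _ v, rs_neg]
  abel

theorem qR_conj {A C : QM n} (hA : A ∈ Sp n) (h : A * C = 1) (a b : QV n) :
    A * qR a b * C = qR (A *ᵥ a) (A *ᵥ b) := by
  refine QM_ext fun v => ?_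
  simp only [← Matrix.mulVec_mulVec, qR_mulVec,
    Matrix.mulVec_sub, mulVec_rs, Sp_inv_adj hA h]

theorem qR_rs_left (a b : QV n) (q : Quat) : qR (rs a q) b = qR a (rs b (star q)) := by
  refine QM_ext fun v => ?_
  simp only [qR_mulVec, qB_rs_left, rs_rs, star_star]
theorem qR_swap (a b : QV n) : qR b a = - qR a b := by
  refine QM_ext fun v => ?_
  simp only [qR_mulVec, Matrix.neg_mulVec]; abel
theorem qR_add_left (a b c : QV n) : qR (a + b) c = qR a c + qR b c := by
  refine QM_ext fun v => ?_
  simp only [qR_mulVec, Matrix.add_mulVec, add_rs, qB_add_left, rs_add]; abel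
theorem qR_smul_left (t : ℝ) (a b : QV n) : qR (t • a) b = t • qR a b := by
  refine QM_ext fun v => ?_
  simp only [qR_mulVec, smul_mulVec', smul_rs, qB_smul_left, rs_smul, smul_sub]
theorem qR_add_right (a b c : QV n) : qR c (a + b) = qR c a + qR c b := by
  rw [qR_swap, qR_add_left, qR_swap a c, qR_swap b c]; abel
theorem qR_smul_right (t : ℝ) (a b : QV n) : qR b (t • a) = t • qR b a := by
  rw [qR_swap, qR_smul_left, qR_swap a b, smul_neg]
theorem qR_neg_left (a b : QV n) : qR (-a) b = - qR a b := by
  have := qR_smul_left (-1) a b; simpa using this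
theorem qR_neg_right (a b : QV n) : qR a (-b) = - qR a b := by
  have := qR_smul_right (-1) b a; simpa using this
theorem qR_sub_left (a b c : QV n) : qR (a - b) c = qR a c - qR b c := by
  rw [sub_eq_add_neg, qR_add_left, qR_neg_left, sub_eq_add_neg]
theorem qR_sub_right (a b c : QV n) : qR c (a - b) = qR c a - qR c b := by
  rw [sub_eq_add_neg, qR_add_right, qR_neg_right, sub_eq_add_neg]
@[simp] theorem qR_zero_left (a : QV n) : qR 0 a = 0 := by
  have := qR_smul_left 0 a a; simpa using this
@[simp] theorem qR_zero_right (a : QV n) : qR a 0 = 0 := by rw [qR_swap]; simp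
@[simp] theorem qR_self (a : QV n) : qR a a = 0 := by
  refine QM_ext fun v => ?_
  simp [qR_mulVec]

theorem quat_re_sum {ι : Type*} (s : Finset ι) (f : ι → Quat) :
    (∑ i ∈ s, f i).re = ∑ i ∈ s, (f i).re :=
  map_sum (AddMonoidHom.mk' (fun q : Quat => q.re) (fun a b => by simp)) f s

/-- squared norm -/
theorem qB_self_expand (v : QV n) : (qB v v).re = ∑ i, sg i * ‖v i‖ ^ 2 := by
  have : ∀ i, (star (v i) * v i) = ((‖v i‖ ^ 2 : ℝ) : Quat) := by
    intro i
    rw [Quaternion.star_mul_self, Quaternion.normSq_eq_norm_mul_self, pow_two]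
  simp only [qB, this]
  rw [quat_re_sum]
  exact Finset.sum_congr rfl fun i _ => by rw [Quaternion.re_smul, Quaternion.re_coe, smul_eq_mul]

/-- key signature lemma -/
theorem sig_key {v w : QV n} (hv : v ≠ 0) (hvv : (qB v v).re ≤ 0) (hvw : qB v w = 0)
    (hww : (qB w w).re ≤ 0) : ∃ q, w = rs v q := by
  have hv0 : v 0 ≠ 0 := by
    intro h0
    apply hv
    rw [qB_self_expand, Fin.sum_univ_succ] at hvv
    simp [h0, sg] at hvv
    have h1 : ∀ i ∈ Finset.univ, 0 ≤ ‖v (Fin.succ i)‖ ^ 2 := fun i _ => by positivity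
    have h2 := (Finset.sum_eq_zero_iff_of_nonneg h1).1 (le_antisymm hvv (Finset.sum_nonneg h1))
    ext1 i
    refine Fin.cases h0 (fun i => ?_) i
    simpa using h2 i (Finset.mem_univ _)
  refine ⟨(v 0)⁻¹ * w 0, ?_⟩
  set q := (v 0)⁻¹ * w 0
  set u := w - rs v q with hu
  have hu0 : u 0 = 0 := by
    simp [hu, rs, q, ← mul_assoc, mul_inv_cancel₀ hv0]
  have hwv : qB w v = 0 := by rw [← qB_star, hvw]; simp
  have huu : (qB u u).re ≤ 0 := by
    rw [hu]
    simp only [qB_sub_left, qB_sub_right, qB_rs_left, qB_rs_right, hvw, hwv]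
    have : star q * qB v v * q = ((qB v v).re * ‖q‖^2 : ℝ) := by
      rw [qB_self_real v, mul_assoc, Quaternion.coe_mul_eq_smul, mul_smul_comm, Quaternion.star_mul_self, Quaternion.normSq_eq_norm_mul_self]
      simp [← Quaternion.coe_mul_eq_smul, pow_two]
    have e : qB w w - 0 * q - (star q * 0 - star q * qB v v * q) = qB w w + star q * qB v v * q := by
      simp
    have e2 : qB w w - star q * 0 - (0 - star q * qB v v) * q = qB w w + star q * qB v v * q := by
      simp
    first
      | rw [e, this, Quaternion.re_add, Quaternion.re_coe]
      | rw [e2, this, Quaternion.re_add, Quaternion.re_coe]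
    have : (qB v v).re * ‖q‖^2 ≤ 0 := mul_nonpos_of_nonpos_of_nonneg hvv (by positivity)
    linarith
  rw [qB_self_expand, Fin.sum_univ_succ] at huu
  simp [hu0, sg] at huu
  have h1 : ∀ i ∈ Finset.univ, 0 ≤ ‖u (Fin.succ i)‖ ^ 2 := fun i _ => by positivity
  have h2 := (Finset.sum_eq_zero_iff_of_nonneg h1).1 (le_antisymm huu (Finset.sum_nonneg h1))
  have : u = 0 := by
    ext1 i
    refine Fin.cases hu0 (fun i => ?_) i
    simpa using h2 i (Finset.mem_univ _)
  rw [hu] at this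
  exact sub_eq_zero.1 this

end Bmore
end

noncomputable section

section Setup
variable {n : ℕ}

theorem mlie_sk {H : Set (QM n)} (hH : MClSub H) (hs : H ⊆ Sp n) {X : QM n} (hX : X ∈ mlie hH) :
    IsSk X := by
  rw [isSk_iff]
  exact mexp_preserves fun t => hs ((mem_mlie hH).1 hX t)

/-- the stabilizer algebra of a submodule -/
def stabAlg (W : Submodule Quatᵐᵒᵖ (QV n)) : Subalgebra ℝ (QM n) where
  carrier := {X | ∀ v ∈ W, X *ᵥ v ∈ W}
  mul_mem' := by
    intro X Y hX hY v hv
    rw [← Matrix.mulVec_mulVec]; exact hX _ (hY _ hv)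
  one_mem' := by intro v hv; simpa using hv
  add_mem' := by
    intro X Y hX hY v hv
    rw [Matrix.add_mulVec]; exact W.add_mem (hX _ hv) (hY _ hv)
  zero_mem' := by intro v hv; simp
  algebraMap_mem' := by
    intro r v hv
    have : (algebraMap ℝ (QM n)) r *ᵥ v = rs v (r : Quat) := by
      rw [Algebra.algebraMap_eq_smul_one, smul_mulVec', Matrix.one_mulVec, rs_coe]
    rw [this, rs_op]
    exact W.smul_mem _ hv

theorem mlie_irr {H : Set (QM n)} (hH : MClSub H) (hC : IsPreconnected H)
    (hirr : ActsHIrreducibly n H) : ActsHIrreducibly n (mlie hH : Set (QM n)) := by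
  intro W hW
  refine hirr W fun A hA => ?_
  have h1 := mgenerated hH hC hA
  have h2 : Submonoid.closure (mexp '' (mlie hH : Set (QM n))) ≤ (stabAlg W).toSubmonoid := by
    rw [Submonoid.closure_le]
    rintro _ ⟨X, hX, rfl⟩
    exact mexp_mem (stabAlg W) (hW X hX)
  exact h2 h1

end Setup

section Complexify
variable {n : ℕ}

def qc1 (q : Quat) : ℂ := ⟨q.re, q.imI⟩
def qc2 (q : Quat) : ℂ := ⟨q.imJ, -q.imK⟩
def qof (a b : ℂ) : Quat := ⟨a.re, a.im, b.re, -b.im⟩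

theorem qc1_mul (p q : Quat) : qc1 (p * q) = qc1 p * qc1 q - star (qc2 p) * qc2 q := by
  apply Complex.ext <;> simp [qc1, qc2] <;> ring
theorem qc2_mul (p q : Quat) : qc2 (p * q) = qc2 p * qc1 q + star (qc1 p) * qc2 q := by
  apply Complex.ext <;> simp [qc1, qc2] <;> ring
theorem qc1_sum {ι : Type*} (s : Finset ι) (f : ι → Quat) : qc1 (∑ i ∈ s, f i) = ∑ i ∈ s, qc1 (f i) :=
  map_sum (AddMonoidHom.mk' qc1 (fun a b => by apply Complex.ext <;> simp [qc1])) f s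
theorem qc2_sum {ι : Type*} (s : Finset ι) (f : ι → Quat) : qc2 (∑ i ∈ s, f i) = ∑ i ∈ s, qc2 (f i) :=
  map_sum (AddMonoidHom.mk' qc2 (fun a b => by apply Complex.ext <;> simp [qc2]; ring)) f s
@[simp] theorem qc1_of (a b : ℂ) : qc1 (qof a b) = a := by apply Complex.ext <;> simp [qc1, qof]
@[simp] theorem qc2_of (a b : ℂ) : qc2 (qof a b) = b := by apply Complex.ext <;> simp [qc2, qof]
theorem qc_ext {p q : Quat} (h1 : qc1 p = qc1 q) (h2 : qc2 p = qc2 q) : p = q := by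
  simp only [qc1, qc2, Complex.mk.injEq] at h1 h2
  ext
  · exact h1.1
  · exact h1.2
  · exact h2.1
  · simpa using h2.2

def cplx (A : QM n) : Matrix (Fin (n + 1) ⊕ Fin (n + 1)) (Fin (n + 1) ⊕ Fin (n + 1)) ℂ :=
  Matrix.fromBlocks (A.map qc1) (-(A.map (fun q => star (qc2 q)))) (A.map qc2) (A.map (fun q => star (qc1 q)))

theorem cplx_trace (A : QM n) : (cplx A).trace = ((2 * (A.trace).re : ℝ) : ℂ) := by
  simp only [cplx, Matrix.trace, Matrix.diag, Fintype.sum_sum_type, Matrix.fromBlocks_apply₁₁,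
    Matrix.fromBlocks_apply₂₂, Matrix.map_apply]
  rw [← Finset.sum_add_distrib, quat_re_sum, Finset.mul_sum, Complex.ofReal_sum]
  refine Finset.sum_congr rfl fun i _ => ?_
  apply Complex.ext <;> simp [qc1]; ring

theorem exists_big_eigen {A : QM n} (h : (n + 1 : ℝ) < |(A.trace).re|) :
    ∃ v : QV n, v ≠ 0 ∧ ∃ μ : Quat, 1 < ‖μ‖ ∧ A *ᵥ v = rs v μ := by
  have hroot : ∃ μ ∈ (cplx A).charpoly.roots, 1 < ‖μ‖ := by
    by_contra hcon
    push Not at hcon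
    have h1 := Matrix.trace_eq_sum_roots_charpoly (cplx A)
    have h2 : ‖(cplx A).charpoly.roots.sum‖ ≤ ((cplx A).charpoly.roots.map (fun x => ‖x‖)).sum :=
      norm_multiset_sum_le _
    have h3 : ((cplx A).charpoly.roots.map (fun x => ‖x‖)).sum ≤
        Multiset.card ((cplx A).charpoly.roots.map (fun x => ‖x‖)) • (1 : ℝ) := by
      apply Multiset.sum_le_card_nsmul
      intro x hx
      obtain ⟨y, hy, rfl⟩ := Multiset.mem_map.1 hx
      exact hcon y hy
    have h4 : Multiset.card (cplx A).charpoly.roots ≤ 2 * (n + 1) := by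
      refine (Polynomial.card_roots' _).trans ?_
      rw [Matrix.charpoly_natDegree_eq_dim]
      simp; omega
    rw [← h1, cplx_trace, Complex.norm_real] at h2
    simp only [Multiset.card_map, nsmul_eq_mul, mul_one, Real.norm_eq_abs, abs_mul] at h2 h3
    have h5 : ((Multiset.card (cplx A).charpoly.roots : ℕ) : ℝ) ≤ 2 * (n + 1) := by exact_mod_cast h4
    rw [abs_two] at h2
    linarith
  obtain ⟨μ, hμ, hμ1⟩ := hroot
  have h1 : (cplx A).charpoly.eval μ = 0 := (Polynomial.mem_roots'.1 hμ).2
  rw [Matrix.eval_charpoly] at h1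
  obtain ⟨x, hx0, hx⟩ := Matrix.exists_mulVec_eq_zero_iff.2 h1
  have hx2 : cplx A *ᵥ x = μ • x := by
    rw [Matrix.sub_mulVec, sub_eq_zero] at hx
    rw [← hx]; simp
  refine ⟨fun i => qof (x (Sum.inl i)) (x (Sum.inr i)), ?_, qof μ 0, ?_, ?_⟩
  · intro h0
    apply hx0
    funext i
    rcases i with i | i
    · have := congrArg qc1 (congrFun h0 i)
      simp only [qc1_of] at this
      rw [this]; apply Complex.ext <;> simp [qc1]
    · have := congrArg qc2 (congrFun h0 i)
      simp only [qc2_of] at this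
      rw [this]; apply Complex.ext <;> simp [qc2]
  · have : ‖qof μ 0‖ = ‖μ‖ := by
      rw [← sq_eq_sq₀ (norm_nonneg _) (norm_nonneg _), ← Complex.normSq_eq_norm_sq, pow_two,
        ← Quaternion.normSq_eq_norm_mul_self, Quaternion.normSq_def']
      simp [qof, Complex.normSq_apply]; ring
    rwa [this]
  · funext i
    have hi := congrFun hx2 (Sum.inl i)
    have hj := congrFun hx2 (Sum.inr i)
    simp only [cplx, Matrix.fromBlocks, Matrix.mulVec, dotProduct, Fintype.sum_sum_type,
      Matrix.of_apply, Sum.elim_inl, Sum.elim_inr, Matrix.map_apply, Pi.smul_apply, smul_eq_mul,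
      Matrix.neg_apply] at hi hj
    apply qc_ext
    · simp only [Matrix.mulVec, dotProduct, rs, qc1_sum, qc1_mul, qc1_of, qc2_of]
      rw [Finset.sum_sub_distrib]
      simp only [neg_mul, Finset.sum_neg_distrib] at hi
      rw [sub_eq_add_neg, hi]; simp [mul_comm]
    · simp only [Matrix.mulVec, dotProduct, rs, qc2_sum, qc2_mul, qc1_of, qc2_of]
      rw [Finset.sum_add_distrib, hj]; simp [mul_comm]

end Complexify
end

noncomputable section

section Bounded
variable {n : ℕ}

theorem mem_line {v w : QV n} : w ∈ Submodule.span Quatᵐᵒᵖ {v} ↔ ∃ q, w = rs v q := by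
  rw [Submodule.mem_span_singleton]
  constructor
  · rintro ⟨a, rfl⟩; exact ⟨a.unop, rfl⟩
  · rintro ⟨q, rfl⟩; exact ⟨MulOpposite.op q, rfl⟩

theorem line_ne_top (hn : 1 ≤ n) (v : QV n) : Submodule.span Quatᵐᵒᵖ {v} ≠ ⊤ := by
  intro h
  obtain ⟨m, rfl⟩ : ∃ m, n = m + 1 := ⟨n - 1, by omega⟩
  have h1 : (Pi.single 0 1 : QV (m+1)) ∈ Submodule.span Quatᵐᵒᵖ {v} := by rw [h]; trivial
  have h2 : (Pi.single 1 1 : QV (m+1)) ∈ Submodule.span Quatᵐᵒᵖ {v} := by rw [h]; trivial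
  obtain ⟨p, hp⟩ := mem_line.1 h1
  obtain ⟨q, hq⟩ := mem_line.1 h2
  have a := congrFun hp 0
  have b := congrFun hq 0
  have c := congrFun hq 1
  simp [rs] at a b c
  rcases b with b | b
  · rw [b] at a; simp at a
  · rw [b] at c; simp at c

theorem line_false (hn : 1 ≤ n) {S : Set (QM n)} (hirr : ActsHIrreducibly n S) {v : QV n} (hv : v ≠ 0)
    (h : ∀ g ∈ S, ∃ q, g *ᵥ v = rs v q) : False := by
  have := hirr (Submodule.span Quatᵐᵒᵖ {v}) (by
    intro A hA w hw
    obtain ⟨q, rfl⟩ := mem_line.1 hw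
    obtain ⟨p, hp⟩ := h A hA
    rw [mulVec_rs, hp, rs_rs]
    exact mem_line.2 ⟨_, rfl⟩)
  rcases this with h1 | h1
  · have : v ∈ Submodule.span Quatᵐᵒᵖ {v} := Submodule.mem_span_singleton_self v
    rw [h1] at this
    exact hv (by simpa using this)
  · exact line_ne_top hn v h1

theorem phase (b : Quat) : ∃ p : Quat, ‖p‖ = 1 ∧ b * p = -((‖b‖ : ℝ) : Quat) := by
  by_cases hb : b = 0
  · exact ⟨1, by simp, by simp [hb]⟩
  · have hb' : ‖b‖ ≠ 0 := by simpa using hb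
    refine ⟨-(b⁻¹ * (‖b‖ : ℝ)), ?_, ?_⟩
    · rw [norm_neg, norm_mul, norm_inv, Quaternion.norm_coe, norm_norm, inv_mul_cancel₀ hb']
    · rw [mul_neg, ← mul_assoc, mul_inv_cancel₀ hb, one_mul]

theorem qB_continuous {X : Type*} [TopologicalSpace X] {f g : X → QV n} (hf : Continuous f)
    (hg : Continuous g) : Continuous (fun x => qB (f x) (g x)) := by
  unfold qB; fun_prop

theorem coord_bound {v : QV n} (hv : (qB v v).re ≤ 0) (i) : ‖v i‖ ≤ ‖v 0‖ := by
  rw [qB_self_expand, Fin.sum_univ_succ] at hv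
  simp [sg] at hv
  refine Fin.cases le_rfl (fun i => ?_) i
  have h1 : ‖v i.succ‖ ^ 2 ≤ ∑ j : Fin n, ‖v j.succ‖ ^ 2 :=
    Finset.single_le_sum (f := fun j : Fin n => ‖v j.succ‖ ^ 2) (fun j _ => by positivity) (Finset.mem_univ i)
  have : ‖v i.succ‖ ^ 2 ≤ ‖v 0‖ ^ 2 := by linarith
  exact (sq_le_sq₀ (norm_nonneg _) (norm_nonneg _)).1 this

theorem qB_rs_self (v : QV n) (q : Quat) : qB (rs v q) (rs v q) = ((‖q‖^2 * (qB v v).re : ℝ) : Quat) := by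
  rw [qB_rs_left, qB_rs_right, qB_self_real v, Quaternion.coe_mul_eq_smul, mul_smul_comm, Quaternion.star_mul_self, Quaternion.normSq_eq_norm_mul_self]
  simp [← Quaternion.coe_mul_eq_smul, pow_two, Quaternion.coe_commutes]

set_option maxHeartbeats 800000 in
theorem bounded_false (hn : 1 ≤ n) {H : Set (QM n)} (hH : MClSub H) (hs : H ⊆ Sp n)
    (hirr : ActsHIrreducibly n H) (C : ℝ) (hC : ∀ h ∈ H, ‖h 0 0‖ ≤ C) : False := by
  set e0 : QV n := Pi.single 0 1 with he0
  have he0B : ∀ x : QV n, qB e0 x = - x 0 := by intro x; rw [qB_single]; simp [sg]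
  have he0B' : ∀ x : QV n, ‖qB x e0‖ = ‖x 0‖ := by
    intro x; rw [← qB_star, he0B]; simp
  set K : Set (QV n × ℝ) := {p | qB p.1 p.1 = -1 ∧ p.2 ≤ C ∧ ∀ h ∈ H, ‖qB p.1 (h *ᵥ e0)‖ ≤ p.2} with hK
  have hx0 : ∀ p ∈ K, ‖p.1 0‖ ≤ p.2 := by
    rintro ⟨v, c⟩ ⟨h1, h2, h3⟩
    have := h3 1 hH.one
    rwa [Matrix.one_mulVec, he0B'] at this
  have hcl : IsClosed K := by
    have h1 : Continuous (fun p : QV n × ℝ => qB p.1 p.1) :=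
      qB_continuous continuous_fst continuous_fst
    have h3 : ∀ h : QM n, Continuous (fun p : QV n × ℝ => ‖qB p.1 (h *ᵥ e0)‖) := fun h =>
      (qB_continuous continuous_fst continuous_const).norm
    have : K = {p | qB p.1 p.1 = -1} ∩ ({p | p.2 ≤ C} ∩ ⋂ h ∈ H, {p | ‖qB p.1 (h *ᵥ e0)‖ ≤ p.2}) := by
      ext p; simp [hK]
    rw [this]
    refine (isClosed_eq h1 continuous_const).inter ((isClosed_le continuous_snd continuous_const).inter ?_)
    exact isClosed_biInter fun h _ => isClosed_le (h3 h) continuous_snd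
  have hbd : K ⊆ Metric.closedBall 0 C := by
    rintro ⟨v, c⟩ hp
    have hv0 := hx0 _ hp
    obtain ⟨h1, h2, h3⟩ := hp
    simp only at h1 h2 h3 hv0
    have hc0 : 0 ≤ c := (norm_nonneg _).trans hv0
    rw [mem_closedBall_zero_iff, Prod.norm_def]
    refine max_le ?_ ?_
    · simp only
      rw [pi_norm_le_iff_of_nonneg (hc0.trans h2)]
      intro i
      have := coord_bound (v := v) (by rw [h1]; simp) i
      linarith
    · simp only [Real.norm_eq_abs]; rwa [abs_of_nonneg hc0]
  have hcomp : IsCompact K := Metric.isCompact_of_isClosed_isBounded hcl (Metric.isBounded_closedBall.subset hbd)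
  have hne : K.Nonempty := by
    refine ⟨(e0, C), ?_, le_rfl, ?_⟩
    · simp only [he0B]; simp [he0]
    · intro h hh
      simp only [he0B, norm_neg]
      have : (h *ᵥ e0) 0 = h 0 0 := by simp [he0]
      rw [this]; exact hC h hh
  obtain ⟨⟨v, c⟩, hvK, hmin⟩ := hcomp.exists_isMinOn hne continuous_snd.continuousOn
  have hv0 := hx0 _ hvK
  obtain ⟨hv1, hv2, hv3⟩ := hvK
  simp only at hv0 hv1 hv2 hv3
  have hvne : v ≠ 0 := by rintro rfl; simp at hv1
  have hcpos : 0 < c := by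
    refine lt_of_lt_of_le ?_ hv0
    by_contra h0
    apply hvne
    funext i
    have := coord_bound (v := v) (by rw [hv1]; simp) i
    have : ‖v i‖ ≤ 0 := by linarith
    simpa using this
  refine line_false hn hirr hvne fun g hg => ?_
  obtain ⟨g', hg', hgg', hg'g⟩ := hH.inv g hg
  set b := qB v (g *ᵥ v) with hb
  obtain ⟨p, hp1, hp2⟩ := phase b
  set w := rs (g *ᵥ v) p with hw
  have hpne : p ≠ 0 := by rintro rfl; simp at hp1
  have hvw : qB v w = -((‖b‖ : ℝ) : Quat) := by rw [hw, qB_rs_right, ← hb, hp2]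
  have hwv : qB w v = -((‖b‖ : ℝ) : Quat) := by rw [← qB_star, hvw]; simp
  have hww : qB w w = -1 := by
    rw [hw, qB_rs_self, hp1, mem_Sp_iff.1 (hs hg), hv1]; simp
  have hwH : ∀ h ∈ H, ‖qB w (h *ᵥ e0)‖ ≤ c := by
    intro h hh
    have := hv3 _ (hH.mul _ hg' _ hh)
    rw [hw, qB_rs_left, norm_mul, norm_star, hp1, one_mul, Sp_inv_adj (hs hg) hgg', Matrix.mulVec_mulVec]
    exact this
  have hb1 : ‖b‖ ≤ 1 := by
    by_contra hb1
    push Not at hb1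
    set s := Real.sqrt (2 + 2 * ‖b‖) with hs'
    have hs2 : s * s = 2 + 2 * ‖b‖ := Real.mul_self_sqrt (by positivity)
    have hspos : 0 < s := Real.sqrt_pos.2 (by positivity)
    have hs2' : 2 < s := by nlinarith
    have hlt : s⁻¹ * (2 * c) < c := by
      rw [inv_mul_lt_iff₀ hspos]; nlinarith
    have hmem : (s⁻¹ • (v + w), s⁻¹ * (2 * c)) ∈ K := by
      refine ⟨?_, by simp only; linarith, ?_⟩
      · simp only [qB_smul_left, qB_smul_right, qB_add_left, qB_add_right, hvw, hwv, hww, hv1]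
        have : (-1 + -((‖b‖ : ℝ) : Quat) + (-((‖b‖ : ℝ) : Quat) + -1)) = ((-(s * s) : ℝ) : Quat) := by
          rw [hs2]
          ext <;> simp
          ring
        rw [← smul_add, this, smul_smul, ← Quaternion.coe_smul]
        have : (s⁻¹ * s⁻¹) • (-(s * s)) = -1 := by
          rw [smul_eq_mul]; field_simp
        rw [this]; simp
      · intro h hh
        simp only [qB_smul_left, qB_add_left, norm_smul, norm_inv, Real.norm_eq_abs, abs_of_pos hspos]
        gcongr
        refine (norm_add_le _ _).trans ?_
        have := hv3 h hh
        have := hwH h hh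
        linarith
    have := hmin hmem
    simp only [Set.mem_setOf_eq] at this
    linarith
  obtain ⟨q, hq⟩ := sig_key (v := v) (w := w - ‖b‖ • v) hvne (by rw [hv1]; simp)
    (by rw [qB_sub_right, qB_smul_right, hvw, hv1]; ext <;> simp)
    (by
      simp only [qB_sub_left, qB_sub_right, qB_smul_left, qB_smul_right, hvw, hwv, hww, hv1]
      simp
      nlinarith [norm_nonneg b])
  refine ⟨((‖b‖ : ℝ) + q) * p⁻¹, ?_⟩
  have e1 : w = rs v ((‖b‖ : ℝ) + q) := by
    rw [rs_add, rs_coe, ← hq]; abel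
  have e2 : g *ᵥ v = rs w p⁻¹ := by rw [hw, rs_rs, mul_inv_cancel₀ hpne, rs_one]
  rw [e2, e1, rs_rs]

end Bounded
end

noncomputable section

section Lox
open Filter Topology
variable {n : ℕ}

theorem norm_subseq_aux {E : Type*} [NormedAddCommGroup E] [NormedSpace ℝ E] [FiniteDimensional ℝ E]
    (h : ℕ → E) (hu : ∀ k : ℕ, (k : ℝ) < ‖h k‖) :
    ∃ φ : ℕ → ℕ, ∃ c : ℕ → ℝ, (∀ k, 0 < c k) ∧ Tendsto c atTop (𝓝 0) ∧ ∃ T : E, T ≠ 0 ∧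
      Tendsto (fun k => c k • h (φ k)) atTop (𝓝 T) := by
  have : ProperSpace E := FiniteDimensional.proper_real E
  have hpos : ∀ k, 0 < ‖h k‖ := fun k => lt_of_le_of_lt (Nat.cast_nonneg k) (hu k)
  have hmem : ∀ k, ‖h k‖⁻¹ • h k ∈ Metric.sphere (0 : E) 1 := by
    intro k
    rw [mem_sphere_zero_iff_norm, norm_smul, norm_inv, norm_norm, inv_mul_cancel₀ (hpos k).ne']
  obtain ⟨T, hT, φ, hφ, hlim⟩ := (isCompact_sphere (0 : E) 1).tendsto_subseq hmem
  refine ⟨φ, fun k => ‖h (φ k)‖⁻¹, fun k => inv_pos.2 (hpos _), ?_, T, ?_, hlim⟩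
  · have h1 : Tendsto (fun k => ‖h k‖) atTop atTop :=
      tendsto_atTop_mono (fun k => (hu k).le) tendsto_natCast_atTop_atTop
    exact (tendsto_inv_atTop_zero.comp h1).comp hφ.tendsto_atTop
  · rintro rfl; simp at hT

theorem norm_subseq (h : ℕ → QM n) (hu : ∀ k : ℕ, (k : ℝ) < ‖h k 0 0‖) :
    ∃ φ : ℕ → ℕ, ∃ c : ℕ → ℝ, (∀ k, 0 < c k) ∧ Tendsto c atTop (𝓝 0) ∧ ∃ T : QM n, T ≠ 0 ∧
      Tendsto (fun k => c k • h (φ k)) atTop (𝓝 T) := by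
  refine norm_subseq_aux (E := Fin (n + 1) → Fin (n + 1) → Quat) h fun k => ?_
  refine (hu k).trans_le ?_
  exact (norm_le_pi_norm (h k 0) 0).trans (norm_le_pi_norm (f := fun i => h k i) 0)

theorem re_mul_comm (a b : Quat) : (a * b).re = (b * a).re := by simp; ring

theorem qmat_entry (S : QM n) (i j) : S i j = (S *ᵥ Pi.single j 1) i := by simp

set_option maxHeartbeats 400000 in
theorem rank_one_trace {S : QM n} {ξ : QV n} (hξ : ξ ≠ 0) (hS : ∀ v, ∃ q, S *ᵥ v = rs ξ q)
    (hc : S *ᵥ ξ ≠ 0) : (S.trace).re ≠ 0 ∨ ((S * S).trace).re ≠ 0 := by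
  choose r hr using hS
  set ρ : Fin (n + 1) → Quat := fun j => r (Pi.single j 1) with hρ
  have hent : ∀ i j, S i j = ξ i * ρ j := by
    intro i j
    rw [qmat_entry S i j, hr]; rfl
  obtain ⟨i0, hi0⟩ : ∃ i, ξ i ≠ 0 := Function.ne_iff.1 hξ
  set c := ∑ j, ρ j * ξ j with hcdef
  have hSξ : S *ᵥ ξ = rs ξ c := by
    funext i
    simp only [Matrix.mulVec, dotProduct, hent, rs, hcdef, Finset.mul_sum, mul_assoc]
  have hc0 : c ≠ 0 := by
    intro h; apply hc; rw [hSξ, h, rs_zero]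
  have h1 : (S.trace).re = c.re := by
    rw [Matrix.trace, quat_re_sum, hcdef, quat_re_sum]
    refine Finset.sum_congr rfl fun i _ => ?_
    rw [Matrix.diag, hent, re_mul_comm]
  have h2 : ((S * S).trace).re = (c * c).re := by
    have : c * c = ∑ j, (c * ρ j) * ξ j := by
      conv_lhs => rw [hcdef]
      rw [← hcdef, Finset.mul_sum]
      exact Finset.sum_congr rfl fun j _ => by rw [mul_assoc]
    rw [Matrix.trace, quat_re_sum, this, quat_re_sum]
    refine Finset.sum_congr rfl fun i _ => ?_
    rw [re_mul_comm _ (ξ i)]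
    congr 1
    rw [Matrix.diag, Matrix.mul_apply]
    simp only [hent, hcdef, Finset.mul_sum, Finset.sum_mul, mul_assoc]
    rfl
  rw [h1, h2]
  by_contra hcon
  push Not at hcon
  obtain ⟨ha, hb⟩ := hcon
  apply hc0
  simp [ha] at hb
  have hI : c.imI = 0 := by nlinarith [sq_nonneg c.imI, sq_nonneg c.imJ, sq_nonneg c.imK]
  have hJ : c.imJ = 0 := by nlinarith [sq_nonneg c.imI, sq_nonneg c.imJ, sq_nonneg c.imK]
  have hK : c.imK = 0 := by nlinarith [sq_nonneg c.imI, sq_nonneg c.imJ, sq_nonneg c.imK]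
  exact QuaternionAlgebra.ext ha hI hJ hK

theorem Sp_inv_trace {A C : QM n} (hA : A ∈ Sp n) (h : A * C = 1) : (C.trace).re = (A.trace).re := by
  have h1 : C = eta n * Aᴴ * eta n := by
    have := Sp_inv_left hA
    calc C = (eta n * Aᴴ * eta n) * A * C := by rw [this, one_mul]
      _ = _ := by rw [mul_assoc, h, mul_one]
  rw [h1, eta_eq, Matrix.trace, Matrix.trace, quat_re_sum, quat_re_sum]
  refine Finset.sum_congr rfl fun i _ => ?_
  simp [Matrix.diag, Matrix.diagonal_mul, Matrix.mul_diagonal]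
  have := sg_sq i
  calc sg i * (A i i).re * sg i = (sg i * sg i) * (A i i).re := by ring
    _ = _ := by rw [this, one_mul]

theorem conj_smul (c : ℝ) (A : QM n) : (c • A)ᴴ = c • Aᴴ := by
  ext i j <;> simp [Matrix.conjTranspose_apply]

theorem lim_isotropic {c : ℕ → ℝ} {h : ℕ → QM n} {T : QM n} (hs : ∀ k, h k ∈ Sp n)
    (hc0 : Tendsto c atTop (𝓝 0)) (hlim : Tendsto (fun k => c k • h k) atTop (𝓝 T)) :
    Tᴴ * eta n * T = 0 := by
  have h1 : Tendsto (fun k => (c k • h k)ᴴ * eta n * (c k • h k)) atTop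
      (𝓝 (Tᴴ * eta n * T)) := by
    have hcont : Continuous (fun A : QM n => Aᴴ * eta n * A) := by fun_prop
    exact (hcont.tendsto T).comp hlim
  have h2 : ∀ k, (c k • h k)ᴴ * eta n * (c k • h k) = (c k * c k) • eta n := by
    intro k
    have e2 : (h k)ᴴ * eta n * h k = eta n := hs k
    rw [conj_smul, smul_mul_assoc, smul_mul_assoc, mul_smul_comm, e2, smul_smul]
  rw [funext h2] at h1
  have h3 : Tendsto (fun k => (c k * c k) • eta n) atTop (𝓝 ((0 * 0 : ℝ) • eta n)) :=
    (hc0.mul hc0).smul_const _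
  have := tendsto_nhds_unique h1 h3
  simpa using this

set_option maxHeartbeats 1000000 in
theorem big_trace (hn : 1 ≤ n) {H : Set (QM n)} (hH : MClSub H) (hs : H ⊆ Sp n)
    (hirr : ActsHIrreducibly n H) : ∃ h ∈ H, (n + 1 : ℝ) < |(h.trace).re| := by
  have hunb : ∀ k : ℕ, ∃ h ∈ H, (k : ℝ) < ‖h 0 0‖ := by
    intro k
    by_contra hcon
    push Not at hcon
    exact bounded_false hn hH hs hirr k hcon
  choose h hhH hh using hunb
  obtain ⟨φ, c, hcpos, hc0, T, hT, hlim⟩ := norm_subseq h hh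
  have hTη : Tᴴ * eta n * T = 0 := lim_isotropic (fun k => hs (hhH (φ k))) hc0 hlim
  have hTB : ∀ v w, qB (T *ᵥ v) (T *ᵥ w) = 0 := by
    intro v w; rw [← qB_mat, hTη]; simp
  obtain ⟨w0, hw0⟩ : ∃ w, T *ᵥ w ≠ 0 := by
    by_contra hcon
    push Not at hcon
    exact hT (QM_ext fun v => by rw [hcon]; simp)
  set ξ := T *ᵥ w0 with hξ
  have hTξ : ∀ v, ∃ q, T *ᵥ v = rs ξ q := fun v =>
    sig_key hw0 (by rw [hTB]; simp) (hTB _ _) (by rw [hTB]; simp)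
  obtain ⟨g, hg, hgξ⟩ : ∃ g ∈ H, T *ᵥ (g *ᵥ ξ) ≠ 0 := by
    by_contra hcon
    push Not at hcon
    let W : Submodule Quatᵐᵒᵖ (QV n) :=
      { carrier := {w | ∀ g ∈ H, T *ᵥ (g *ᵥ w) = 0}
        add_mem' := by
          intro a b ha hb g hg
          rw [Matrix.mulVec_add, Matrix.mulVec_add, ha g hg, hb g hg, add_zero]
        zero_mem' := by intro g hg; simp
        smul_mem' := by
          intro q w hw g hg
          have : q • w = rs w q.unop := rfl
          rw [this, mulVec_rs, mulVec_rs, hw g hg, zero_rs] }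
    rcases hirr W (by
      intro A hA v hv g hg
      rw [Matrix.mulVec_mulVec v g A]
      exact hv _ (hH.mul _ hg _ hA)) with h1 | h1
    · have : ξ ∈ W := hcon
      rw [h1] at this
      exact hw0 (by simpa using this)
    · have : w0 ∈ W := by rw [h1]; trivial
      have := this 1 hH.one
      rw [Matrix.one_mulVec] at this
      exact hw0 this
  have hlimS : Tendsto (fun k => c k • (h (φ k) * g)) atTop (𝓝 (T * g)) := by
    have hcont : Continuous (fun A : QM n => A * g) := by fun_prop
    have := (hcont.tendsto T).comp hlim
    simpa [Function.comp_def] using this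
  have htr : Continuous (fun A : QM n => (A.trace).re) := by
    exact Quaternion.continuous_re.comp (by fun_prop)
  rcases rank_one_trace (S := T * g) hw0
    (fun v => by rw [← Matrix.mulVec_mulVec]; exact hTξ _)
    (by rw [← Matrix.mulVec_mulVec]; exact hgξ) with h1 | h1
  · have h2 := (htr.tendsto _).comp hlimS
    simp only [Function.comp_def, Matrix.trace_smul, Quaternion.re_smul] at h2
    have h3 : Tendsto (fun k => |c k • (trace (h (φ k) * g)).re| - c k * (n + 1)) atTop
        (𝓝 (|(trace (T * g)).re| - 0 * (n + 1))) := h2.abs.sub (hc0.mul_const _)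
    have h4 := h3.eventually (lt_mem_nhds (show 0 < |(trace (T * g)).re| - 0 * (n + 1) by simpa using h1))
    obtain ⟨k, hk⟩ := h4.exists
    refine ⟨h (φ k) * g, hH.mul _ (hhH _) _ hg, ?_⟩
    rw [smul_eq_mul, abs_mul, abs_of_pos (hcpos k), ← mul_sub] at hk
    have := (mul_pos_iff_of_pos_left (hcpos k)).1 hk
    linarith
  · have hlimS2 := hlimS.mul hlimS
    have h2 := (htr.tendsto _).comp hlimS2
    simp only [Function.comp_def, smul_mul_assoc, mul_smul_comm, smul_smul, Matrix.trace_smul, Quaternion.re_smul] at h2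
    have h3 := h2.abs.sub ((hc0.mul hc0).mul_const (n + 1 : ℝ))
    have h4 := h3.eventually (lt_mem_nhds (show 0 < |(trace (T * g * (T * g))).re| - 0 * 0 * (n + 1 : ℝ) by
      simpa using h1))
    obtain ⟨k, hk⟩ := h4.exists
    refine ⟨h (φ k) * g * (h (φ k) * g), hH.mul _ (hH.mul _ (hhH _) _ hg) _ (hH.mul _ (hhH _) _ hg), ?_⟩
    have hcc : 0 < c k * c k := mul_pos (hcpos k) (hcpos k)
    rw [smul_eq_mul, abs_mul, abs_of_pos hcc, ← mul_sub] at hk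
    have := (mul_pos_iff_of_pos_left hcc).1 hk
    linarith

theorem exists_lox (hn : 1 ≤ n) {H : Set (QM n)} (hH : MClSub H) (hs : H ⊆ Sp n)
    (hirr : ActsHIrreducibly n H) : ∃ h ∈ H, ∃ h' ∈ H, h * h' = 1 ∧ h' * h = 1 ∧
      ∃ e f : QV n, ∃ μ ν : Quat, qB e e = 0 ∧ qB f f = 0 ∧ qB e f = 1 ∧ 1 < ‖μ‖ ∧
        h *ᵥ e = rs e μ ∧ h *ᵥ f = rs f ν := by
  obtain ⟨h, hh, htr⟩ := big_trace hn hH hs hirr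
  obtain ⟨h', hh', h1, h2⟩ := hH.inv h hh
  refine ⟨h, hh, h', hh', h1, h2, ?_⟩
  obtain ⟨v, hv, μ, hμ, hvμ⟩ := exists_big_eigen htr
  obtain ⟨w, hw, ν, hν, hwν⟩ := exists_big_eigen (A := h') (by rwa [Sp_inv_trace (hs hh) h1])
  have null : ∀ A ∈ H, ∀ v : QV n, ∀ μ : Quat, 1 < ‖μ‖ → A *ᵥ v = rs v μ → qB v v = 0 := by
    intro A hA v μ hμ hv
    have := mem_Sp_iff.1 (hs hA) v v
    rw [hv, qB_rs_self] at this
    have h3 := congrArg (fun q : Quat => q.re) this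
    simp only [Quaternion.re_coe] at h3
    have : (qB v v).re = 0 := by
      have : (‖μ‖^2 - 1) * (qB v v).re = 0 := by linarith
      rcases mul_eq_zero.1 this with h | h
      · nlinarith
      · exact h
    rw [qB_self_real, this]; simp
  have hvv := null h hh v μ hμ hvμ
  have hww := null h' hh' w ν hν hwν
  have hν0 : ν ≠ 0 := by rintro rfl; simp at hν; linarith
  have hhw : h *ᵥ w = rs w ν⁻¹ := by
    have : h *ᵥ (h' *ᵥ w) = w := by rw [Matrix.mulVec_mulVec, h1, Matrix.one_mulVec]
    rw [hwν, mulVec_rs] at this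
    rw [← rs_one (h *ᵥ w), ← mul_inv_cancel₀ hν0, ← rs_rs, this]
  have hβ : qB v w ≠ 0 := by
    intro h0
    obtain ⟨q, hq⟩ := sig_key hv (by rw [hvv]; simp) h0 (by rw [hww]; simp)
    have hq0 : q ≠ 0 := by rintro rfl; rw [rs_zero] at hq; exact hw hq
    rw [hq, mulVec_rs, hvμ, rs_rs, rs_rs] at hhw
    obtain ⟨i0, hi0⟩ : ∃ i, v i ≠ 0 := Function.ne_iff.1 hv
    have := congrFun hhw i0
    simp only [rs] at this
    have := mul_left_cancel₀ hi0 this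
    have := congrArg norm this
    rw [norm_mul, norm_mul, mul_comm, norm_inv] at this
    have := mul_left_cancel₀ (by simpa using hq0) this
    have h5 : ‖ν‖⁻¹ < 1 := inv_lt_one_of_one_lt₀ hν
    linarith
  refine ⟨v, rs w (qB v w)⁻¹, μ, qB v w * (ν⁻¹ * (qB v w)⁻¹), hvv, ?_, ?_, hμ, hvμ, ?_⟩
  · rw [qB_rs_self, hww]; simp
  · rw [qB_rs_right, mul_inv_cancel₀ hβ]
  · rw [mulVec_rs, hhw, rs_rs, rs_rs, ← mul_assoc, inv_mul_cancel₀ hβ, one_mul]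

end Lox
end

noncomputable section

section Grade
open Filter Topology
variable {n : ℕ}

/-- The matrix `a b* η`. -/
def qP (a b : QV n) : QM n := fun i j => sg j • (a i * star (b j))

theorem qP_mulVec (a b v : QV n) : qP a b *ᵥ v = rs a (qB b v) := by
  ext1 i
  simp only [qP, Matrix.mulVec, dotProduct, rs, qB, Finset.mul_sum]
  refine Finset.sum_congr rfl fun j _ => ?_
  simp only [smul_mul_assoc, mul_smul_comm, mul_assoc]

theorem qP_conj {A C : QM n} (hA : A ∈ Sp n) (h : A * C = 1) (a b : QV n) :
    A * qP a b * C = qP (A *ᵥ a) (A *ᵥ b) := by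
  refine QM_ext fun v => ?_
  simp only [← Matrix.mulVec_mulVec, qP_mulVec, mulVec_rs, Sp_inv_adj hA h]

theorem Sp_clsub : MClSub (Sp n) :=
  MClSub.mk' Sp_one (fun _ hA _ hB => Sp_mul hA hB)
    (fun _ hA => ⟨_, Sp_of_inv hA (Sp_inv_right hA), Sp_inv_right hA, Sp_inv_left hA⟩) Sp_closed

theorem Sp_pow {k : QM n} (hk : k ∈ Sp n) (m : ℕ) : k ^ m ∈ Sp n := by
  induction m with
  | zero => simpa using Sp_one
  | succ m ih => rw [pow_succ]; exact Sp_mul ih hk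

theorem compact_subseq_aux (u : ℕ → (Fin (n + 1) → Fin (n + 1) → Quat)) (C : ℝ)
    (hu : ∀ k i j, ‖u k i j‖ ≤ C) :
    ∃ g : Fin (n + 1) → Fin (n + 1) → Quat, ∃ φ : ℕ → ℕ, StrictMono φ ∧
      Tendsto (fun j => u (φ j)) atTop (𝓝 g) := by
  have hC : 0 ≤ C := (norm_nonneg _).trans (hu 0 0 0)
  have : ∀ k, u k ∈ Metric.closedBall (0 : Fin (n + 1) → Fin (n + 1) → Quat) C := by
    intro k
    rw [mem_closedBall_zero_iff, pi_norm_le_iff_of_nonneg hC]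
    intro i
    rw [pi_norm_le_iff_of_nonneg hC]
    intro j
    exact hu k i j
  obtain ⟨g, _, φ, hφ, hlim⟩ :=
    (isCompact_closedBall (0 : Fin (n + 1) → Fin (n + 1) → Quat) C).tendsto_subseq this
  exact ⟨g, φ, hφ, hlim⟩

theorem compact_subseq (u : ℕ → QM n) (C : ℝ) (hu : ∀ k i j, ‖u k i j‖ ≤ C) :
    ∃ g : QM n, ∃ φ : ℕ → ℕ, StrictMono φ ∧ Tendsto (fun j => u (φ j)) atTop (𝓝 g) :=
  compact_subseq_aux u C hu

theorem tendsto_double (φ : ℕ → QM n) (g : QM n) (h : Tendsto φ atTop (𝓝 g)) :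
    Tendsto (fun j => φ (2 * j)) atTop (𝓝 g) := by
  have h2 : Tendsto (fun j : ℕ => 2 * j) atTop atTop :=
    tendsto_atTop_mono (fun j => by simp only [id]; omega) tendsto_id
  exact h.comp h2

theorem tendsto_qadj (φ : ℕ → QM n) (g : QM n) (h : Tendsto φ atTop (𝓝 g)) :
    Tendsto (fun j => eta n * (φ j)ᴴ * eta n) atTop (𝓝 (eta n * gᴴ * eta n)) := by
  have hcont : Continuous (fun A : QM n => eta n * Aᴴ * eta n) :=
    (Continuous.matrix_mul continuous_const (Continuous.matrix_conjTranspose continuous_id)).matrix_mul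
      continuous_const
  exact (hcont.tendsto g).comp h

theorem recurrence {k : QM n} (hk : k ∈ Sp n) (C : ℝ) (hC : ∀ m i j, ‖(k ^ m) i j‖ ≤ C) :
    ∃ m : ℕ → ℕ, Tendsto m atTop atTop ∧ Tendsto (fun j => k ^ (m j)) atTop (𝓝 1) := by
  obtain ⟨g, φ, hφ, hlim⟩ := compact_subseq (fun m => k ^ m) C hC
  have hg : g ∈ Sp n := Sp_closed.mem_of_tendsto hlim (Eventually.of_forall fun j => Sp_pow hk _)
  have hle : ∀ j, φ j + j ≤ φ (2 * j) := by
    intro j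
    have := hφ.add_le_nat (m := j) (n := j)
    rw [two_mul]; omega
  refine ⟨fun j => φ (2 * j) - φ j, ?_, ?_⟩
  · refine tendsto_atTop_mono (fun j => ?_) tendsto_id
    have := hle j
    simp only [id]; omega
  · have h1 := tendsto_double (fun j => k ^ φ j) g hlim
    have h2 := tendsto_qadj (fun j => k ^ φ j) g hlim
    have h3 := h1.mul h2
    rw [Sp_inv_right hg] at h3
    refine h3.congr fun j => ?_
    have e : k ^ φ (2 * j) = k ^ (φ (2 * j) - φ j) * k ^ φ j := by
      rw [← pow_add]; congr 1; have := hle j; omega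
    rw [e, mul_assoc, Sp_inv_right (Sp_pow hk _), mul_one]

/-- orthogonal projection to the complement of the hyperbolic plane -/
def prW (e f v : QV n) : QV n := v - rs e (qB f v) - rs f (qB e v)

theorem prW_orth_left {e f : QV n} (hee : qB e e = 0) (hef : qB e f = 1) (v) :
    qB e (prW e f v) = 0 := by
  simp [prW, qB_sub_right, qB_rs_right, hee, hef]
theorem qB_swap_one {e f : QV n} (hef : qB e f = 1) : qB f e = 1 := by rw [← qB_star, hef]; simp
theorem prW_orth_right {e f : QV n} (hff : qB f f = 0) (hef : qB e f = 1) (v) :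
    qB f (prW e f v) = 0 := by
  simp [prW, qB_sub_right, qB_rs_right, hff, qB_swap_one hef]

theorem W_pos {e f w : QV n} (hee : qB e e = 0) (hef : qB e f = 1)
    (h1 : qB e w = 0) (h2 : qB f w = 0) (hw : w ≠ 0) : 0 < (qB w w).re := by
  by_contra hcon
  push Not at hcon
  have he : e ≠ 0 := by rintro rfl; simp at hef
  obtain ⟨q, rfl⟩ := sig_key he (by rw [hee]; simp) h1 hcon
  rw [qB_rs_right, qB_swap_one hef, one_mul] at h2
  apply hw; rw [h2, rs_zero]

/-- the positive form -/
def qQ (e f v : QV n) : ℝ := ‖qB e v‖ ^ 2 + ‖qB f v‖ ^ 2 + (qB (prW e f v) (prW e f v)).re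

theorem qQ_pos {e f v : QV n} (hee : qB e e = 0) (hff : qB f f = 0) (hef : qB e f = 1) (hv : v ≠ 0) :
    0 < qQ e f v := by
  have h1 := prW_orth_left hee hef v
  have h2 := prW_orth_right hff hef v
  by_cases h : prW e f v = 0
  · have h3 : ¬ (qB e v = 0 ∧ qB f v = 0) := by
      rintro ⟨ha, hb⟩
      apply hv
      simpa [prW, ha, hb] using h
    have h4 : 0 < ‖qB e v‖ ^ 2 + ‖qB f v‖ ^ 2 := by
      by_cases ha : qB e v = 0
      · have : 0 < ‖qB f v‖ := by
          simp only [ha, true_and] at h3; simpa using h3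
        positivity
      · have : 0 < ‖qB e v‖ := by simpa using ha
        positivity
    simp [qQ, h]; exact h4
  · have := W_pos hee hef h1 h2 h
    have h5 : 0 ≤ ‖qB e v‖ ^ 2 + ‖qB f v‖ ^ 2 := by positivity
    simp only [qQ]; linarith

theorem prW_smul (e f v : QV n) (t : ℝ) : prW e f (t • v) = t • prW e f v := by
  simp only [prW, qB_smul_right, rs_smul, smul_sub]

theorem qQ_smul (e f v : QV n) (t : ℝ) : qQ e f (t • v) = t ^ 2 * qQ e f v := by
  simp only [qQ, qB_smul_right, prW_smul, qB_smul_left, norm_smul, Quaternion.re_smul, mul_pow,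
    Real.norm_eq_abs, sq_abs, smul_eq_mul]
  ring

theorem qQ_lower {e f : QV n} (hee : qB e e = 0) (hff : qB f f = 0) (hef : qB e f = 1) :
    ∃ δ > 0, ∀ v, δ * ‖v‖ ^ 2 ≤ qQ e f v := by
  have hpr : Continuous (prW e f) := by
    unfold prW rs
    have h1 : Continuous (fun v => qB f v) := qB_continuous continuous_const continuous_id
    have h2 : Continuous (fun v => qB e v) := qB_continuous continuous_const continuous_id
    fun_prop
  have hQ : Continuous (qQ e f) := by
    unfold qQ
    have h1 : Continuous (fun v => qB f v) := qB_continuous continuous_const continuous_id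
    have h2 : Continuous (fun v => qB e v) := qB_continuous continuous_const continuous_id
    have h3 : Continuous (fun v => qB (prW e f v) (prW e f v)) := qB_continuous hpr hpr
    have h4 := Quaternion.continuous_re.comp h3
    exact ((h2.norm.pow 2).add (h1.norm.pow 2)).add h4
  have hcomp : IsCompact (Metric.sphere (0 : QV n) 1) := isCompact_sphere _ _
  have hne : (Metric.sphere (0 : QV n) 1).Nonempty := NormedSpace.sphere_nonempty.2 zero_le_one
  obtain ⟨v0, hv0, hmin⟩ := hcomp.exists_isMinOn hne hQ.continuousOn
  have hv0' : v0 ≠ 0 := by rintro rfl; simp at hv0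
  refine ⟨qQ e f v0, qQ_pos hee hff hef hv0', fun v => ?_⟩
  by_cases hv : v = 0
  · subst hv; simp [qQ, prW]
  · have hvn : ‖v‖ ≠ 0 := by simpa using hv
    have := hmin (a := ‖v‖⁻¹ • v) (by
      rw [mem_sphere_zero_iff_norm, norm_smul, norm_inv, norm_norm, inv_mul_cancel₀ hvn])
    simp only [Set.mem_setOf_eq, qQ_smul] at this
    calc qQ e f v0 * ‖v‖ ^ 2 ≤ (‖v‖⁻¹ ^ 2 * qQ e f v) * ‖v‖ ^ 2 := by gcongr
      _ = qQ e f v := by field_simp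

theorem powers_bounded {e f : QV n} (hee : qB e e = 0) (hff : qB f f = 0) (hef : qB e f = 1)
    {k : QM n} (hk : k ∈ Sp n) {u w : Quat} (hu : ‖u‖ = 1) (hw : ‖w‖ = 1)
    (hke : k *ᵥ e = rs e u) (hkf : k *ᵥ f = rs f w) :
    ∃ C : ℝ, ∀ m i j, ‖(k ^ m) i j‖ ≤ C := by
  obtain ⟨δ, hδ, hlow⟩ := qQ_lower hee hff hef
  have hB := mem_Sp_iff.1 hk
  have huw : star u * w = 1 := by
    have := hB e f
    rw [hke, hkf, qB_rs_left, qB_rs_right, hef, one_mul] at this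
    exact this
  have huw2 : u * star w = 1 := by
    have h1 : star w * u = 1 := by have := congrArg star huw; simpa using this
    have hw0 : star w ≠ 0 := by
      intro h; rw [h] at h1; simp at h1
    calc u * star w = (star w)⁻¹ * (star w * u) * star w := by
          rw [← mul_assoc, inv_mul_cancel₀ hw0, one_mul]
      _ = 1 := by rw [h1, mul_one, inv_mul_cancel₀ hw0]
  have huw3 : w * star u = 1 := by have := congrArg star huw2; simpa using this
  have he : ∀ v, qB e (k *ᵥ v) = u * qB e v := by
    intro v
    have h1 := hB f v
    have h2 := hB e v
    rw [hke, qB_rs_left] at h2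
    have : u * star u = 1 := by
      rw [Quaternion.self_mul_star, Quaternion.normSq_eq_norm_mul_self, hu]; simp
    rw [← h2, ← mul_assoc, this, one_mul]
  have hf : ∀ v, qB f (k *ᵥ v) = w * qB f v := by
    intro v
    have h2 := hB f v
    rw [hkf, qB_rs_left] at h2
    have : w * star w = 1 := by
      rw [Quaternion.self_mul_star, Quaternion.normSq_eq_norm_mul_self, hw]; simp
    rw [← h2, ← mul_assoc, this, one_mul]
  have huu : u = w := by
    have h1 : w * star w = 1 := by
      rw [Quaternion.self_mul_star, Quaternion.normSq_eq_norm_mul_self, hw]; simp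
    have h2 : star w * w = 1 := by
      rw [Quaternion.star_mul_self, Quaternion.normSq_eq_norm_mul_self, hw]; simp
    calc u = u * (star w * w) := by rw [h2, mul_one]
      _ = w := by rw [← mul_assoc, huw2, one_mul]
  have hpr : ∀ v, prW e f (k *ᵥ v) = k *ᵥ prW e f v := by
    intro v
    simp only [prW, he, hf, Matrix.mulVec_sub, mulVec_rs, hke, hkf, rs_rs, huu]
  have hQ : ∀ v, qQ e f (k *ᵥ v) = qQ e f v := by
    intro v
    simp only [qQ, he, hf, hpr, hB, norm_mul, hu, hw, one_mul]
  have hQm : ∀ m v, qQ e f ((k ^ m) *ᵥ v) = qQ e f v := by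
    intro m
    induction m with
    | zero => intro v; simp
    | succ m ih => intro v; rw [pow_succ', ← Matrix.mulVec_mulVec, hQ, ih]
  refine ⟨∑ j, Real.sqrt (qQ e f (Pi.single j 1) / δ), fun m i j => ?_⟩
  have h1 : ‖(k ^ m) i j‖ ≤ ‖(k ^ m) *ᵥ (Pi.single j 1 : QV n)‖ := by
    have := norm_le_pi_norm ((k ^ m) *ᵥ (Pi.single j 1 : QV n)) i
    rwa [← qmat_entry (k ^ m) i j] at this
  have h2 : ‖(k ^ m) *ᵥ (Pi.single j 1 : QV n)‖ ≤ Real.sqrt (qQ e f (Pi.single j 1) / δ) := by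
    apply Real.le_sqrt_of_sq_le
    rw [le_div_iff₀ hδ, mul_comm, ← hQm m]
    exact hlow _
  refine (h1.trans h2).trans ?_
  exact Finset.single_le_sum (f := fun j => Real.sqrt (qQ e f (Pi.single j 1) / δ))
    (fun _ _ => Real.sqrt_nonneg _) (Finset.mem_univ j)

end Grade
end

noncomputable section

section Grade2
open Filter Topology

theorem grade_abs {𝔸 : Type*} [Ring 𝔸] [Algebra ℝ 𝔸] [TopologicalSpace 𝔸] [IsTopologicalRing 𝔸]
    [ContinuousSMul ℝ 𝔸] (L : Submodule ℝ 𝔸) (hL : IsClosed (L : Set 𝔸)) (pp p0 pm X : 𝔸)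
    (T : ℕ → ℝ) (hT : Tendsto T atTop (𝓝 0)) (hT0 : ∀ j, T j ≠ 0) (Y : ℕ → 𝔸)
    (hY : Tendsto Y atTop (𝓝 X))
    (hm : ∀ j, ((T j)⁻¹ • pp + p0 + T j • pm) * Y j * (T j • pp + p0 + (T j)⁻¹ • pm) ∈ L) :
    pp * X * pm ∈ L ∧ ((∀ j, pp * Y j * pm = 0) → pp * X * p0 + p0 * X * pm ∈ L) := by
  have hc : Tendsto (fun j => p0 + T j • pm) atTop (𝓝 (p0 + (0 : ℝ) • pm)) :=
    tendsto_const_nhds.add (hT.smul_const pm)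
  have hc' : Tendsto (fun j => p0 + T j • pp) atTop (𝓝 (p0 + (0 : ℝ) • pp)) :=
    tendsto_const_nhds.add (hT.smul_const pp)
  have hA : Tendsto (fun j => pp + T j • (p0 + T j • pm)) atTop
      (𝓝 (pp + (0 : ℝ) • (p0 + (0 : ℝ) • pm))) := tendsto_const_nhds.add (hT.smul hc)
  have hB : Tendsto (fun j => pm + T j • (p0 + T j • pp)) atTop
      (𝓝 (pm + (0 : ℝ) • (p0 + (0 : ℝ) • pp))) := tendsto_const_nhds.add (hT.smul hc')
  have eA : ∀ j, pp + T j • (p0 + T j • pm) = T j • ((T j)⁻¹ • pp + p0 + T j • pm) := by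
    intro j
    rw [add_assoc, smul_add (T j) ((T j)⁻¹ • pp), smul_smul, mul_inv_cancel₀ (hT0 j), one_smul]
  have eB : ∀ j, pm + T j • (p0 + T j • pp) = T j • (T j • pp + p0 + (T j)⁻¹ • pm) := by
    intro j
    rw [smul_add (T j) (T j • pp + p0), smul_smul (T j) (T j)⁻¹, mul_inv_cancel₀ (hT0 j), one_smul,
      add_comm p0, add_comm pm]
  constructor
  · have h := (hA.mul hY).mul hB
    simp only [zero_smul, add_zero] at h
    refine hL.mem_of_tendsto h (Eventually.of_forall fun j => ?_)
    rw [eA, eB, smul_mul_assoc, smul_mul_assoc, mul_smul_comm]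
    exact L.smul_mem _ (L.smul_mem _ (hm j))
  · intro h0
    have h : Tendsto (fun j => (p0 + T j • pm) * Y j * pm + pp * Y j * (p0 + T j • pp)
        + T j • ((p0 + T j • pm) * Y j * (p0 + T j • pp))) atTop
        (𝓝 ((p0 + (0 : ℝ) • pm) * X * pm + pp * X * (p0 + (0 : ℝ) • pp)
        + (0 : ℝ) • ((p0 + (0 : ℝ) • pm) * X * (p0 + (0 : ℝ) • pp)))) :=
      (((hc.mul hY).mul_const pm).add ((hY.const_mul pp).mul hc')).add
        (hT.smul ((hc.mul hY).mul hc'))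
    simp only [zero_smul, add_zero] at h
    rw [add_comm] at h
    refine hL.mem_of_tendsto h (Eventually.of_forall fun j => ?_)
    have key : (p0 + T j • pm) * Y j * pm + pp * Y j * (p0 + T j • pp)
        + T j • ((p0 + T j • pm) * Y j * (p0 + T j • pp))
        = T j • (((T j)⁻¹ • pp + p0 + T j • pm) * Y j * (T j • pp + p0 + (T j)⁻¹ • pm)) := by
      have h1 : T j • ((p0 + T j • pm) * Y j * pm + pp * Y j * (p0 + T j • pp)
        + T j • ((p0 + T j • pm) * Y j * (p0 + T j • pp)))
        = (pp + T j • (p0 + T j • pm)) * Y j * (pm + T j • (p0 + T j • pp)) := by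
        generalize p0 + T j • pm = c
        generalize p0 + T j • pp = c'
        have := h0 j
        simp only [add_mul, mul_add, smul_mul_assoc, mul_smul_comm, smul_add, this]
        abel
      rw [eA, eB, smul_mul_assoc, smul_mul_assoc, mul_smul_comm] at h1
      exact smul_right_injective 𝔸 (hT0 j) h1
    rw [key]
    exact L.smul_mem _ (hm j)

variable {n : ℕ}

theorem qP_mul (a b c d : QV n) : qP a b * qP c d = qP (rs a (qB b c)) d := by
  refine QM_ext fun v => ?_
  simp only [← Matrix.mulVec_mulVec, qP_mulVec, qB_rs_right, rs_rs]

theorem qP_zero (b : QV n) : qP (0 : QV n) b = 0 := by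
  refine QM_ext fun v => ?_
  simp only [qP_mulVec, Matrix.zero_mulVec]; ext1 i; simp [rs]

theorem qgrade {H : Set (QM n)} (hH : MClSub H) (hs : H ⊆ Sp n) {h h' : QM n} (hh : h ∈ H)
    (hh' : h' ∈ H) (h1 : h * h' = 1) (h2 : h' * h = 1) {e f : QV n} {μ ν : Quat}
    (hee : qB e e = 0) (hff : qB f f = 0) (hef : qB e f = 1) (hμ : 1 < ‖μ‖)
    (hhe : h *ᵥ e = rs e μ) (hhf : h *ᵥ f = rs f ν) {X : QM n} (hX : X ∈ mlie hH) :
    qR (rs e (qB f (X *ᵥ f))) e ∈ mlie hH ∧ qR (prW e f (X *ᵥ f)) e ∈ mlie hH := by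
  have hfe := qB_swap_one hef
  have hB := mem_Sp_iff.1 (hs hh)
  have hμν : star μ * ν = 1 := by
    have := hB e f
    rw [hhe, hhf, qB_rs_left, qB_rs_right, hef, one_mul] at this
    exact this
  have hνμ : ν * star μ = 1 := mul_eq_one_comm.1 hμν
  have hμν' : μ * star ν = 1 := by have := congrArg star hνμ; simpa using this
  have hnn : ‖μ‖ * ‖ν‖ = 1 := by have := congrArg norm hμν; simpa [norm_mul] using this
  set s : ℝ := ‖μ‖ with hsdef
  have hs0 : s ≠ 0 := by linarith
  set pp := qP e f with hpp
  set pm := qP f e with hpm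
  obtain ⟨p0, hp0⟩ : ∃ p : QM n, p = 1 - pp - pm := ⟨_, rfl⟩
  have e1 : pp * pp = pp := by rw [hpp, qP_mul, hfe, rs_one]
  have e2 : pm * pm = pm := by rw [hpm, qP_mul, hef, rs_one]
  have e3 : pp * pm = 0 := by rw [hpp, hpm, qP_mul, hff, rs_zero, qP_zero]
  have e4 : pm * pp = 0 := by rw [hpp, hpm, qP_mul, hee, rs_zero, qP_zero]
  have e5 : pp * p0 = 0 := by rw [hp0, mul_sub, mul_sub, e1, e3]; simp
  have e6 : p0 * pp = 0 := by rw [hp0, sub_mul, sub_mul, e1, e4]; simp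
  have e7 : pm * p0 = 0 := by rw [hp0, mul_sub, mul_sub, e2, e4]; simp
  have e8 : p0 * pm = 0 := by rw [hp0, sub_mul, sub_mul, e2, e3]; simp
  have e9 : p0 * p0 = p0 := by
    have : p0 * p0 = (1 - pp - pm) * p0 := by rw [← hp0]
    rw [this, sub_mul, sub_mul, e5, e7]; simp
  let av : ℝ → QM n := fun t => t • pp + p0 + t⁻¹ • pm
  have av_mul : ∀ a b, av a * av b = av (a * b) := by
    intro a b
    simp only [av, add_mul, mul_add, smul_mul_assoc, mul_smul_comm, e1, e2, e3, e4, e5, e6, e7, e8, e9,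
      smul_smul, smul_zero, mul_inv, mul_comm b a, mul_comm b⁻¹ a⁻¹, zero_add, add_zero]
  have av_one : av 1 = 1 := by simp only [av, hp0, one_smul, inv_one]; abel
  have av_pow : ∀ (a : ℝ) (m : ℕ), av a ^ m = av (a ^ m) := by
    intro a m
    induction m with
    | zero => simp [av_one]
    | succ m ih => rw [pow_succ, ih, av_mul, pow_succ]
  have chp : h * pp * h' = pp := by
    rw [hpp, qP_conj (hs hh) h1, hhe, hhf]
    refine QM_ext fun v => ?_
    rw [qP_mulVec, qP_mulVec, qB_rs_left, rs_rs, ← mul_assoc, hμν', one_mul]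
  have chm : h * pm * h' = pm := by
    rw [hpm, qP_conj (hs hh) h1, hhe, hhf]
    refine QM_ext fun v => ?_
    rw [qP_mulVec, qP_mulVec, qB_rs_left, rs_rs, ← mul_assoc, hνμ, one_mul]
  have cp : Commute h pp := by
    have := congrArg (· * h) chp
    show _ = _
    simpa [mul_assoc, h2] using this
  have cm : Commute h pm := by
    have := congrArg (· * h) chm
    show _ = _
    simpa [mul_assoc, h2] using this
  have c0 : Commute h p0 := hp0 ▸ ((Commute.one_right h).sub_right cp).sub_right cm
  have cav : ∀ t, Commute h (av t) := fun t =>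
    ((cp.smul_right t).add_right c0).add_right (cm.smul_right _)
  have avp : ∀ t, Commute (av t) pp := by
    intro t; show av t * pp = pp * av t
    simp only [av, add_mul, mul_add, smul_mul_assoc, mul_smul_comm, e1, e3, e4, e5, e6]
  have avm : ∀ t, Commute (av t) pm := by
    intro t; show av t * pm = pm * av t
    simp only [av, add_mul, mul_add, smul_mul_assoc, mul_smul_comm, e2, e3, e4, e7, e8]
  have ave : ∀ t, av t *ᵥ e = t • e := by
    intro t
    simp only [av, hp0, Matrix.add_mulVec, Matrix.sub_mulVec, smul_mulVec', Matrix.one_mulVec, hpp, hpm,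
      qP_mulVec, hee, hfe, rs_one, rs_zero]
    simp
  have avf : ∀ t, av t *ᵥ f = t⁻¹ • f := by
    intro t
    simp only [av, hp0, Matrix.add_mulVec, Matrix.sub_mulVec, smul_mulVec', Matrix.one_mulVec, hpp, hpm,
      qP_mulVec, hff, hef, rs_one, rs_zero]
    simp
  have avv : ∀ t v, av t *ᵥ v = t • rs e (qB f v) + prW e f v + t⁻¹ • rs f (qB e v) := by
    intro t v
    simp only [av, hp0, Matrix.add_mulVec, Matrix.sub_mulVec, smul_mulVec', Matrix.one_mulVec, hpp, hpm,
      qP_mulVec, prW]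
  have avSp : ∀ t, t ≠ 0 → av t ∈ Sp n := by
    intro t ht
    rw [mem_Sp_iff]
    intro v w
    have dec : ∀ v, v = rs e (qB f v) + prW e f v + rs f (qB e v) := by
      intro v; simp only [prW]; abel
    have x1 : ∀ v, qB (prW e f v) e = 0 := fun v => by
      rw [← qB_star, prW_orth_left hee hef]; simp
    have x2 : ∀ v, qB (prW e f v) f = 0 := fun v => by
      rw [← qB_star, prW_orth_right hff hef]; simp
    have gen : ∀ t : ℝ, t ≠ 0 → qB (t • rs e (qB f v) + prW e f v + t⁻¹ • rs f (qB e v))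
        (t • rs e (qB f w) + prW e f w + t⁻¹ • rs f (qB e w)) =
        star (qB f v) * qB e w + qB (prW e f v) (prW e f w) + star (qB e v) * qB f w := by
      intro t ht
      simp only [qB_add_left, qB_add_right, qB_smul_left, qB_smul_right, qB_rs_left, qB_rs_right,
        hee, hff, hef, hfe, prW_orth_left hee hef, prW_orth_right hff hef, x1, x2, smul_smul]
      simp [ht]
      abel
    rw [avv, avv, gen t ht]
    conv_rhs => rw [dec v, dec w]
    have := gen 1 one_ne_zero
    simp only [one_smul, inv_one] at this
    rw [this]
  set k : QM n := av s⁻¹ * h with hk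
  have hkSp : k ∈ Sp n := Sp_mul (avSp _ (inv_ne_zero hs0)) (hs hh)
  have hke : k *ᵥ e = rs e (s⁻¹ • μ) := by
    rw [hk, ← Matrix.mulVec_mulVec, hhe, mulVec_rs, ave, smul_rs, rs_smul]
  have hkf : k *ᵥ f = rs f (s • ν) := by
    rw [hk, ← Matrix.mulVec_mulVec, hhf, mulVec_rs, avf, inv_inv, smul_rs, rs_smul]
  have hu1 : ‖s⁻¹ • μ‖ = 1 := by
    rw [norm_smul, norm_inv, Real.norm_eq_abs, abs_of_pos (by linarith), ← hsdef, inv_mul_cancel₀ hs0]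
  have hw1 : ‖s • ν‖ = 1 := by
    rw [norm_smul, Real.norm_eq_abs, abs_of_pos (by linarith), hnn]
  obtain ⟨C, hC⟩ := powers_bounded hee hff hef hkSp hu1 hw1 hke hkf
  obtain ⟨m, hm, hkm⟩ := recurrence hkSp C hC
  have hkp : Commute k pp := (avp _).mul_left cp
  have hkq : Commute k pm := (avm _).mul_left cm
  have hhk : h = av s * k := by
    rw [hk, ← mul_assoc, av_mul, mul_inv_cancel₀ hs0, av_one, one_mul]
  have cak : Commute (av s) k := by
    refine Commute.mul_right ?_ (cav s).symm
    show _ = _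
    rw [av_mul, av_mul, mul_comm]
  have hpow : ∀ m, h ^ m = av (s ^ m) * k ^ m := by
    intro m
    rw [← av_pow, ← cak.mul_pow, ← hhk]
  have hadj : Tendsto (fun j => eta n * (k ^ m j)ᴴ * eta n) atTop (𝓝 1) := by
    have := tendsto_qadj _ _ hkm
    rwa [Matrix.conjTranspose_one, mul_one, eta_sq] at this
  set Cm : ℕ → QM n := fun j => eta n * (k ^ m j)ᴴ * eta n with hCm
  have hkC : ∀ j, k ^ m j * Cm j = 1 := fun j => Sp_inv_right (Sp_pow hkSp _)
  have hCk : ∀ j, Cm j * k ^ m j = 1 := fun j => Sp_inv_left (Sp_pow hkSp _)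
  have hh'pow : ∀ j, h' ^ m j = Cm j * av (s ^ m j)⁻¹ := by
    intro j
    have a1 : h' ^ m j * h ^ m j = 1 := by
      have hc : Commute h' h := h2.trans h1.symm
      rw [← hc.mul_pow, h2, one_pow]
    have a2 : h ^ m j * (Cm j * av (s ^ m j)⁻¹) = 1 := by
      rw [hpow, mul_assoc, ← mul_assoc (k ^ m j), hkC, one_mul, av_mul,
        mul_inv_cancel₀ (pow_ne_zero _ hs0), av_one]
    exact left_inv_eq_right_inv a1 a2
  let T : ℕ → ℝ := fun j => (s ^ m j)⁻¹
  have hT0 : ∀ j, T j ≠ 0 := fun j => inv_ne_zero (pow_ne_zero _ hs0)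
  have hT : Tendsto T atTop (𝓝 0) :=
    tendsto_inv_atTop_zero.comp ((tendsto_pow_atTop_atTop_of_one_lt hμ).comp hm)
  have hHpow : ∀ {g : QM n}, g ∈ H → ∀ j, g ^ j ∈ H := by
    intro g hg j
    induction j with
    | zero => simpa using hH.one
    | succ j ih => rw [pow_succ]; exact hH.mul _ ih _ hg
  have hcm : ∀ Z ∈ mlie hH, ∀ j, ((T j)⁻¹ • pp + p0 + T j • pm) * (k ^ m j * Z * Cm j) *
      (T j • pp + p0 + (T j)⁻¹ • pm) ∈ mlie hH := by
    intro Z hZ j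
    have hc : Commute h' h := h2.trans h1.symm
    have := mlie_conj hH hZ (hHpow hh (m j)) (hHpow hh' (m j))
      (by rw [← hc.symm.mul_pow, h1, one_pow]) (by rw [← hc.mul_pow, h2, one_pow])
    rw [hpow, hh'pow] at this
    have t1 : (T j)⁻¹ • pp + p0 + T j • pm = av (s ^ m j) := by simp [av, T]
    have t2 : T j • pp + p0 + (T j)⁻¹ • pm = av (s ^ m j)⁻¹ := by simp [av, T]
    rw [t1, t2]
    simpa only [mul_assoc] using this
  have hYt : ∀ Z : QM n, Tendsto (fun j => k ^ m j * Z * Cm j) atTop (𝓝 Z) := by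
    intro Z
    have := (hkm.mul (tendsto_const_nhds (x := Z))).mul hadj
    rwa [one_mul, mul_one] at this
  have g1 := (grade_abs (mlie hH) (mlie_closed hH) pp p0 pm X T hT hT0 _ (hYt X) (hcm X hX)).1
  have hX2 : X - pp * X * pm ∈ mlie hH := (mlie hH).sub_mem hX g1
  have g2 := (grade_abs (mlie hH) (mlie_closed hH) pp p0 pm _ T hT hT0 _ (hYt _) (hcm _ hX2)).2 (by
    intro j
    have b1 : pp * (k ^ m j) = k ^ m j * pp := (hkp.pow_left (m j)).symm
    have b2 : Cm j * pm = pm * Cm j := by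
      have b3 : k ^ m j * pm = pm * k ^ m j := hkq.pow_left (m j)
      calc Cm j * pm = Cm j * (pm * (k ^ m j * Cm j)) := by rw [hkC, mul_one]
        _ = Cm j * (k ^ m j * pm) * Cm j := by rw [b3]; simp only [mul_assoc]
        _ = pm * Cm j := by rw [← mul_assoc (Cm j), hCk, one_mul]
    have b4 : pp * (X - pp * X * pm) * pm = 0 := by
      rw [mul_sub, sub_mul, ← mul_assoc, ← mul_assoc, e1, mul_assoc (pp * X) pm pm, e2, sub_self]
    calc pp * (k ^ m j * (X - pp * X * pm) * Cm j) * pm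
        = (pp * k ^ m j) * (X - pp * X * pm) * (Cm j * pm) := by simp only [mul_assoc]
      _ = k ^ m j * (pp * (X - pp * X * pm) * pm) * Cm j := by rw [b1, b2]; simp only [mul_assoc]
      _ = 0 := by rw [b4]; simp)
  have hsk := mlie_sk hH hs hX
  have hz : star (qB f (X *ᵥ f)) = - qB f (X *ᵥ f) := by
    rw [qB_star, hsk]
  have r1 : qR (rs e (qB f (X *ᵥ f))) e = (2 : ℝ) • (pp * X * pm) := by
    refine QM_ext fun v => ?_
    rw [qR_mulVec, smul_mulVec', ← Matrix.mulVec_mulVec, ← Matrix.mulVec_mulVec, hpp, hpm, qP_mulVec,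
      qP_mulVec, mulVec_rs, qB_rs_left, qB_rs_right, hz, rs_rs, neg_mul, rs_neg, two_smul, sub_neg_eq_add]
  have r2 : qR (prW e f (X *ᵥ f)) e =
      pp * (X - pp * X * pm) * p0 + p0 * (X - pp * X * pm) * pm := by
    have r3 : pp * (X - pp * X * pm) * p0 = pp * X * p0 := by
      rw [mul_sub, sub_mul, mul_assoc pp (pp * X * pm), mul_assoc (pp * X), e7]; simp
    have r4 : p0 * (X - pp * X * pm) * pm = p0 * X * pm := by
      rw [mul_sub, sub_mul, ← mul_assoc p0 (pp * X) pm, ← mul_assoc p0, e6]; simp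
    rw [r3, r4]
    have p0v : ∀ v, p0 *ᵥ v = prW e f v := by
      intro v
      simp only [hp0, Matrix.sub_mulVec, Matrix.one_mulVec, hpp, hpm, qP_mulVec, prW]
    refine QM_ext fun v => ?_
    simp only [Matrix.add_mulVec, ← Matrix.mulVec_mulVec, p0v]
    rw [qR_mulVec, hpp, hpm, qP_mulVec, qP_mulVec, mulVec_rs]
    have t1 : qB f (X *ᵥ prW e f v) = - qB (X *ᵥ f) (prW e f v) := by rw [hsk]; simp
    have t2 : qB (X *ᵥ f) (prW e f v) = qB (prW e f (X *ᵥ f)) v := by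
      simp only [prW, qB_sub_right, qB_sub_left, qB_rs_right, qB_rs_left, qB_star]
      abel
    have t3 : ∀ w q, prW e f (rs w q) = rs (prW e f w) q := by
      intro w q
      simp only [prW, qB_rs_right, sub_rs, rs_rs]
    rw [t1, t2, t3, rs_neg]; abel
  constructor
  · rw [r1]; exact (mlie hH).smul_mem _ g1
  · rw [r2]; exact g2

end Grade2
end

noncomputable section

section Struct
variable {n : ℕ}

/-- A hyperbolic pair compatible with the Lie algebra `L`. -/
structure QFrame (L : Submodule ℝ (QM n)) (e f : QV n) : Prop where
  ee : qB e e = 0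
  ff : qB f f = 0
  ef : qB e f = 1
  sk : ∀ X ∈ L, IsSk X
  br : ∀ X ∈ L, ∀ Y ∈ L, X * Y - Y * X ∈ L
  gp1 : ∀ X ∈ L, qR (rs e (qB f (X *ᵥ f))) e ∈ L
  gp2 : ∀ X ∈ L, qR (prW e f (X *ᵥ f)) e ∈ L
  gm1 : ∀ X ∈ L, qR (rs f (qB e (X *ᵥ e))) f ∈ L
  gm2 : ∀ X ∈ L, qR (prW e f (X *ᵥ e)) f ∈ L

theorem prW_swap (e f v : QV n) : prW f e v = prW e f v := by simp only [prW]; abel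

theorem prW_rs (e f v : QV n) (q : Quat) : prW e f (rs v q) = rs (prW e f v) q := by
  simp only [prW, qB_rs_right, sub_rs, rs_rs]

theorem QFrame.symm {L : Submodule ℝ (QM n)} {e f : QV n} (F : QFrame L e f) : QFrame L f e where
  ee := F.ff
  ff := F.ee
  ef := qB_swap_one F.ef
  sk := F.sk
  br := F.br
  gp1 := F.gm1
  gp2 := by simpa only [prW_swap] using F.gm2
  gm1 := F.gp1
  gm2 := by simpa only [prW_swap] using F.gp2

/-- the degree one part -/
def VV (L : Submodule ℝ (QM n)) (e f : QV n) : Submodule ℝ (QV n) where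
  carrier := {x | qB e x = 0 ∧ qB f x = 0 ∧ qR x e ∈ L}
  zero_mem' := by simp
  add_mem' := by
    rintro a b ⟨h1, h2, h3⟩ ⟨h4, h5, h6⟩
    refine ⟨by rw [qB_add_right, h1, h4, add_zero], by rw [qB_add_right, h2, h5, add_zero], ?_⟩
    rw [qR_add_left]; exact L.add_mem h3 h6
  smul_mem' := by
    rintro t a ⟨h1, h2, h3⟩
    refine ⟨by rw [qB_smul_right, h1, smul_zero], by rw [qB_smul_right, h2, smul_zero], ?_⟩
    rw [qR_smul_left]; exact L.smul_mem _ h3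

/-- the degree two part -/
def FF (L : Submodule ℝ (QM n)) (e : QV n) : Submodule ℝ Quat where
  carrier := {q | qR (rs e q) e ∈ L}
  zero_mem' := by simp
  add_mem' := by
    intro a b h1 h2
    show qR (rs e (a + b)) e ∈ L
    rw [rs_add, qR_add_left]; exact L.add_mem h1 h2
  smul_mem' := by
    intro t a h
    show qR (rs e (t • a)) e ∈ L
    rw [rs_smul, qR_smul_left]; exact L.smul_mem _ h

variable {L : Submodule ℝ (QM n)} {e f : QV n}

theorem mem_VV {x : QV n} : x ∈ VV L e f ↔ qB e x = 0 ∧ qB f x = 0 ∧ qR x e ∈ L := Iff.rfl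
theorem mem_FF {q : Quat} : q ∈ FF L e ↔ qR (rs e q) e ∈ L := Iff.rfl

theorem FF_coe (t : ℝ) : (t : Quat) ∈ FF L e := by
  rw [mem_FF, rs_coe, qR_smul_left]; simp

theorem FF_re_sub {q : Quat} : q ∈ FF L e ↔ q.im ∈ FF L e := by
  have h : q = (q.re : Quat) + q.im := by simp
  constructor
  · intro hq
    have := (FF L e).sub_mem hq (FF_coe q.re)
    rwa [show q - (q.re : Quat) = q.im by simp] at this
  · intro hq; rw [h]; exact (FF L e).add_mem (FF_coe _) hq

theorem FF_star {q : Quat} (hq : q ∈ FF L e) : star q ∈ FF L e := by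
  have : star q = ((2 * q.re : ℝ) : Quat) - q := by ext <;> simp; ring
  rw [this]; exact (FF L e).sub_mem (FF_coe _) hq

namespace QFrame

theorem fe (F : QFrame L e f) : qB f e = 1 := qB_swap_one F.ef

theorem orthl (F : QFrame L e f) {x} (hx : x ∈ VV L e f) : qB x e = 0 := by rw [← qB_star, hx.1]; simp
theorem orthr (F : QFrame L e f) {x} (hx : x ∈ VV L e f) : qB x f = 0 := by rw [← qB_star, hx.2.1]; simp

theorem B_mem (F : QFrame L e f) {x y} (hx : x ∈ VV L e f) (hy : y ∈ VV L e f) : qB x y ∈ FF L e := by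
  have h := F.br _ hx.2.2 _ hy.2.2
  rw [qR_bracket (qR_sk _ _), qR_mulVec, qR_mulVec, hy.1, F.ee, F.orthl hx] at h
  simp only [rs_zero, sub_zero, zero_sub, sub_self, qR_zero_right, add_zero, qR_neg_left] at h
  exact (L.neg_mem_iff).1 h

theorem triple (F : QFrame L e f) {x x' y} (hx : x ∈ VV L e f) (hx' : x' ∈ VV L e f) (hy : y ∈ VV L f e) :
    rs y (qB x x') - rs x (qB y x') - rs x' (qB y x) ∈ VV L e f := by
  have hy' : qB e y = 0 := hy.2.1
  have hy'' : qB f y = 0 := hy.1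
  refine ⟨?_, ?_, ?_⟩
  · simp [qB_sub_right, qB_rs_right, hx.1, hx'.1, hy']
  · simp [qB_sub_right, qB_rs_right, hx.2.1, hx'.2.1, hy'']
  · have h1 := F.br _ hx.2.2 _ hy.2.2
    have h2 := F.br _ h1 _ hx'.2.2
    rw [qR_bracket (F.sk _ h1), qR_bracket (qR_sk _ _)] at h2
    have a1 : qB y e = 0 := by rw [← qB_star, hy']; simp
    simp only [qR_mulVec, Matrix.add_mulVec, hy', F.ee, F.ef, F.fe, F.orthl hx, F.orthr hx, hx'.1, hx'.2.1,
      rs_zero, rs_one, zero_sub, sub_zero, qB_neg_left, qB_rs_left, mul_zero, neg_zero, a1, neg_rs,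
      add_zero, zero_add, qR_neg_right] at h2
    rw [show rs e (qB x y) = rs e (star (qB y x)) by rw [qB_star], ← qR_rs_left] at h2
    rw [qR_sub_left]
    convert h2 using 1
    abel

theorem mul_im (F : QFrame L e f) {x w} (hx : x ∈ VV L e f) (hw : w ∈ FF L f) (hi : star w = - w) :
    rs x w ∈ VV L f e := by
  refine ⟨by rw [qB_rs_right, hx.2.1, zero_mul], by rw [qB_rs_right, hx.1, zero_mul], ?_⟩
  have h := F.br _ (mem_FF.1 hw) _ hx.2.2
  rw [qR_bracket (qR_sk _ _), qR_mulVec, qR_mulVec, hx.2.1, qB_rs_left, hx.2.1, F.fe, qB_rs_left, F.fe,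
    hi] at h
  simp only [rs_zero, mul_zero, sub_self, qR_zero_left, zero_add, rs_one, mul_one, rs_neg, sub_neg_eq_add,
    qR_add_right] at h
  have e1 : qR x (rs f w) = - qR (rs x w) f := by
    rw [qR_rs_left, hi, rs_neg, qR_neg_right, neg_neg]
  rw [e1, ← two_smul ℝ] at h
  have := L.smul_mem (-(1/2) : ℝ) h
  rw [smul_smul, smul_neg] at this
  norm_num at this
  exact this

theorem pos (F : QFrame L e f) {x} (hx : x ∈ VV L e f) (h0 : x ≠ 0) : 0 < (qB x x).re :=
  W_pos F.ee F.ef hx.1 hx.2.1 h0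

theorem half (F : QFrame L e f) {x y} (hx : x ∈ VV L e f) (hx0 : x ≠ 0) (hy : y ∈ VV L f e) :
    rs y (qB x x) - rs x (qB y x) - rs x (qB y x) ∈ VV L e f ∧ (qB x y).im ∈ FF L e := by
  have hw := F.triple hx hx hy
  refine ⟨hw, ?_⟩
  have hB := F.B_mem hx hw
  have hN := F.pos hx hx0
  set N := (qB x x).re
  have e1 : qB x (rs y (qB x x) - rs x (qB y x) - rs x (qB y x)) =
      N • (qB x y - (2 : ℝ) • star (qB x y)) := by
    simp only [qB_sub_right, qB_rs_right, qB_star]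
    rw [qB_self_real x]
    show qB x y * ((N : ℝ) : Quat) - (N : Quat) * _ - (N : Quat) * _ = _
    rw [Quaternion.mul_coe_eq_smul, Quaternion.coe_mul_eq_smul, smul_sub, two_smul, smul_add]
    abel
  rw [e1] at hB
  have h2 := (FF L e).smul_mem N⁻¹ hB
  rw [smul_smul, inv_mul_cancel₀ hN.ne', one_smul, FF_re_sub] at h2
  have h3 : (qB x y - (2 : ℝ) • star (qB x y)).im = (3 : ℝ) • (qB x y).im := by
    ext <;> simp <;> ring
  rw [h3] at h2
  have h4 := (FF L e).smul_mem (3⁻¹ : ℝ) h2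
  rwa [smul_smul, inv_mul_cancel₀ (by norm_num), one_smul] at h4

theorem VV_sub (F : QFrame L e f) {x y} (hx : x ∈ VV L e f) (hx0 : x ≠ 0) (hy : y ∈ VV L f e) : y ∈ VV L e f := by
  by_cases hy0 : y = 0
  · rw [hy0]; exact zero_mem _
  obtain ⟨hw, hωp⟩ := F.half hx hx0 hy
  have hωm := (F.symm.half hy hy0 hx).2
  have hyx : (qB y x).im = - (qB x y).im := by rw [← qB_star]; ext <;> simp
  rw [hyx, (FF L f).neg_mem_iff] at hωm
  have hxω := F.mul_im hx hωm (star_im _)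
  have hN := F.pos hx hx0
  have ht := F.triple hx hx hxω
  set ω := (qB x y).im with hω
  set N := (qB x x).re with hNdef
  have hxx : qB x x = (N : Quat) := qB_self_real x
  have e1 : rs (rs x ω) (qB x x) - rs x (qB (rs x ω) x) - rs x (qB (rs x ω) x) = (3 * N) • rs x ω := by
    rw [qB_rs_left, star_im, hxx, rs_coe, neg_mul, rs_neg, Quaternion.mul_coe_eq_smul, rs_smul, mul_smul,
      show (3 : ℝ) = 1 + 1 + 1 by norm_num, add_smul, add_smul, one_smul]
    abel
  rw [e1] at ht
  have ht' := (VV L e f).smul_mem (3 * N)⁻¹ ht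
  rw [smul_smul, inv_mul_cancel₀ (by positivity), one_smul] at ht'
  have e2 : y = N⁻¹ • ((rs y (qB x x) - rs x (qB y x) - rs x (qB y x)) + (2 * (qB x y).re) • x -
      (2 : ℝ) • rs x ω) := by
    have hb : qB y x = ((qB x y).re : Quat) - ω := by rw [← qB_star, hω]; ext <;> simp
    rw [hb, rs_sub, rs_coe, hxx, rs_coe, mul_smul, two_smul, two_smul]
    have : N • y - ((qB x y).re • x - rs x ω) - ((qB x y).re • x - rs x ω) +
      ((qB x y).re • x + (qB x y).re • x) - (rs x ω + rs x ω) = N • y := by abel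
    rw [this, smul_smul, inv_mul_cancel₀ hN.ne', one_smul]
  rw [e2]
  exact Submodule.smul_mem _ _ (Submodule.sub_mem _ (Submodule.add_mem _ hw (Submodule.smul_mem _ _ hx))
    (Submodule.smul_mem _ _ ht'))

/-- zero-dimensional complement: the cubic relation -/
theorem cubic (F : QFrame L e f) {z w} (hz : z ∈ FF L e) (hzi : star z = - z) (hw : w ∈ FF L f) (hwi : star w = - w) :
    z * w * z ∈ FF L e := by
  have h1 := F.br _ (mem_FF.1 hz) _ (mem_FF.1 hw)
  have h2 := F.br _ h1 _ (mem_FF.1 hz)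
  rw [qR_bracket (F.sk _ h1), qR_bracket (qR_sk _ _)] at h2
  have hzw : star (z * w) = w * z := by simp [hzi, hwi]
  have hwz : star (w * z) = z * w := by simp [hzi, hwi]
  have a1 : qR (rs e z) e *ᵥ rs f w = (2 : ℝ) • rs e (z * w) := by
    rw [qR_mulVec, qB_rs_right, qB_rs_right, qB_rs_left, F.ef, hzi, rs_rs, two_smul]
    simp [rs_neg]
  have a2 : qR (rs e z) e *ᵥ f = (2 : ℝ) • rs e z := by
    rw [qR_mulVec, qB_rs_left, F.ef, hzi, two_smul]
    simp [rs_neg]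
  rw [a1, a2] at h2
  have a3 : (qR ((2 : ℝ) • rs e (z * w)) f + qR (rs f w) ((2 : ℝ) • rs e z)) *ᵥ e =
      (4 : ℝ) • rs e (z * w) := by
    rw [Matrix.add_mulVec, qR_mulVec, qR_mulVec]
    simp only [qB_smul_left, qB_rs_left, F.ee, F.fe, hwi, rs_smul, smul_rs, rs_rs, mul_zero, smul_zero,
      rs_zero, sub_zero, zero_sub, mul_one, mul_neg, rs_neg, smul_neg, neg_neg, rs_one]
    rw [← add_smul]; norm_num
  rw [mulVec_rs, a3, smul_rs, rs_rs, qR_smul_left, qR_smul_right, ← hwz, ← qR_rs_left, rs_rs, hwz,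
    ← mul_assoc, ← smul_add, ← two_smul ℝ, smul_smul] at h2
  have h3 := L.smul_mem ((4 * 2 : ℝ)⁻¹) h2
  rw [smul_smul, inv_mul_cancel₀ (by norm_num), one_smul] at h3
  exact mem_FF.2 h3

end QFrame
end Struct
end

noncomputable section

section Struct2
variable {n : ℕ} {L : Submodule ℝ (QM n)} {e f : QV n}

theorem rs_ne_zero {v : QV n} {q : Quat} (hv : v ≠ 0) (hq : q ≠ 0) : rs v q ≠ 0 := by
  intro h
  apply hv
  have := congrArg (fun w => rs w q⁻¹) h
  simp only [rs_rs, mul_inv_cancel₀ hq, rs_one] at this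
  rw [this]; ext1 i; simp [rs]

namespace QFrame

theorem e_ne (F : QFrame L e f) : e ≠ 0 := by
  rintro rfl; have := F.ef; simp at this

theorem prW_mem (F : QFrame L e f) {X} (hX : X ∈ L) : prW e f (X *ᵥ f) ∈ VV L e f :=
  ⟨prW_orth_left F.ee F.ef _, prW_orth_right F.ff F.ef _, F.gp2 X hX⟩

theorem prW_mem' (F : QFrame L e f) {X} (hX : X ∈ L) : prW e f (X *ᵥ e) ∈ VV L f e :=
  ⟨prW_orth_right F.ff F.ef _, prW_orth_left F.ee F.ef _, F.gm2 X hX⟩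

theorem posF (F : QFrame L e f) (hn : 1 ≤ n) (hirr : ActsHIrreducibly n (L : Set (QM n))) :
    (∃ x ∈ VV L e f, x ≠ 0) ∨ ∃ z ∈ FF L e, z.im ≠ 0 := by
  by_contra hcon
  push Not at hcon
  obtain ⟨h1, h2⟩ := hcon
  refine line_false hn hirr F.symm.e_ne fun X hX => ⟨qB e (X *ᵥ f), ?_⟩
  have a1 := h1 _ (F.prW_mem hX)
  have a2 := h2 _ (F.gp1 X hX)
  have a3 : star (qB f (X *ᵥ f)) = - qB f (X *ᵥ f) := by rw [qB_star, F.sk X hX]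
  have a4 : qB f (X *ᵥ f) = 0 := by
    have : (qB f (X *ᵥ f)).re = 0 := by
      have := congrArg (fun q : Quat => q.re) a3; simp at this; linarith
    rw [← Quaternion.re_add_im (qB f (X *ᵥ f)), a2, this]; simp
  rw [prW, a4, rs_zero, sub_zero, sub_eq_zero] at a1
  exact a1

theorem VV_ne (F : QFrame L e f) (hn : 1 ≤ n) (hirr : ActsHIrreducibly n (L : Set (QM n)))
    {y} (hy : y ∈ VV L f e) (hy0 : y ≠ 0) : ∃ x ∈ VV L e f, x ≠ 0 := by
  rcases F.posF hn hirr with h | ⟨z, hz, hz0⟩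
  · exact h
  · exact ⟨_, F.symm.mul_im hy (FF_re_sub.1 hz) (star_im _), rs_ne_zero hy0 hz0⟩

theorem FF_le (F : QFrame L e f) (hV : VV L e f = VV L f e) {x} (hx : x ∈ VV L e f) (hx0 : x ≠ 0) :
    FF L e ≤ FF L f := by
  intro q hq
  rw [FF_re_sub] at hq ⊢
  have hy : x ∈ VV L f e := hV ▸ hx
  have h1 := F.symm.mul_im hy hq (star_im _)
  rw [hV] at h1
  have h2 := F.symm.B_mem hy h1
  rw [qB_rs_right, qB_self_real, Quaternion.coe_mul_eq_smul] at h2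
  have h3 := (FF L f).smul_mem ((qB x x).re)⁻¹ h2
  rwa [smul_smul, inv_mul_cancel₀ (F.pos hx hx0).ne', one_smul] at h3

theorem span_top (F : QFrame L e f) (hirr : ActsHIrreducibly n (L : Set (QM n)))
    (h1 : ∀ x ∈ VV L e f, x = 0) (h2 : ∀ x ∈ VV L f e, x = 0) (w : QV n)
    (he : qB e w = 0) (hf : qB f w = 0) : w = 0 := by
  have key : ∀ v : QV n, v ∈ Submodule.span Quatᵐᵒᵖ ({e, f} : Set (QV n)) ↔ ∃ a b, v = rs e a + rs f b := by
    intro v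
    rw [Submodule.mem_span_pair]
    constructor
    · rintro ⟨a, b, rfl⟩; exact ⟨a.unop, b.unop, rfl⟩
    · rintro ⟨a, b, rfl⟩; exact ⟨.op a, .op b, rfl⟩
  rcases hirr (Submodule.span Quatᵐᵒᵖ ({e, f} : Set (QV n))) (by
    intro X hX v hv
    obtain ⟨a, b, rfl⟩ := (key v).1 hv
    have e1 : X *ᵥ e = rs e (qB f (X *ᵥ e)) + rs f (qB e (X *ᵥ e)) := by
      have := h2 _ (F.prW_mem' hX)
      rw [prW, sub_sub, sub_eq_zero] at this; exact this
    have e2 : X *ᵥ f = rs e (qB f (X *ᵥ f)) + rs f (qB e (X *ᵥ f)) := by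
      have := h1 _ (F.prW_mem hX)
      rw [prW, sub_sub, sub_eq_zero] at this; exact this
    have m : ∀ a b, rs e a + rs f b ∈ Submodule.span Quatᵐᵒᵖ ({e, f} : Set (QV n)) :=
      fun a b => (key _).2 ⟨a, b, rfl⟩
    show X *ᵥ _ ∈ _
    rw [Matrix.mulVec_add, mulVec_rs, mulVec_rs, e1, e2, add_rs, add_rs, rs_rs, rs_rs, rs_rs, rs_rs]
    exact Submodule.add_mem _ (m _ _) (m _ _)) with h | h
  · exfalso
    have : e ∈ Submodule.span Quatᵐᵒᵖ ({e, f} : Set (QV n)) := Submodule.subset_span (by simp)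
    rw [h] at this
    exact F.e_ne (by simpa using this)
  · obtain ⟨a, b, rfl⟩ := (key w).1 (h ▸ Submodule.mem_top)
    simp only [qB_add_right, qB_rs_right, F.ee, F.ff, F.ef, F.fe, zero_mul, one_mul, zero_add, add_zero]
      at he hf
    rw [he, hf]; simp

theorem quat_cubic (z w : Quat) (hz : star z = - z) (hw : star w = - w) :
    z * w * z = (normSq z) • w - (2 * (z.imI * w.imI + z.imJ * w.imJ + z.imK * w.imK)) • z := by
  have h1 : z.re = 0 := by
    have := congrArg (fun q : Quat => q.re) hz; simp at this; linarith
  have h2 : w.re = 0 := by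
    have := congrArg (fun q : Quat => q.re) hw; simp at this; linarith
  ext <;> simp [Quaternion.normSq_def', h1, h2] <;> ring

theorem FF_le' (F : QFrame L e f) {z} (hz : z ∈ FF L e) (hz0 : z.im ≠ 0) : FF L f ≤ FF L e := by
  intro w hw
  rw [FF_re_sub] at hw hz ⊢
  have h := F.cubic hz (star_im _) hw (star_im _)
  rw [quat_cubic _ _ (star_im _) (star_im _)] at h
  have h2 := (FF L e).add_mem h ((FF L e).smul_mem
    (2 * (z.im.imI * w.im.imI + z.im.imJ * w.im.imJ + z.im.imK * w.im.imK)) hz)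
  rw [sub_add_cancel] at h2
  have h3 := (FF L e).smul_mem (normSq z.im)⁻¹ h2
  rwa [smul_smul, inv_mul_cancel₀ (by simpa using hz0), one_smul] at h3

theorem struct1 (F : QFrame L e f) (hn : 1 ≤ n) (hirr : ActsHIrreducibly n (L : Set (QM n))) :
    VV L e f = VV L f e ∧ FF L e = FF L f ∧ (∀ x ∈ VV L e f, ∀ q ∈ FF L e, rs x q ∈ VV L e f) ∧
    (((∃ x ∈ VV L e f, x ≠ 0) ∧ ∀ p ∈ FF L e, ∀ q ∈ FF L e, p * q ∈ FF L e) ∨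
     ((∀ w, qB e w = 0 → qB f w = 0 → w = 0) ∧ ∃ z ∈ FF L e, z.im ≠ 0)) := by
  by_cases hx : ∃ x ∈ VV L e f, x ≠ 0
  · obtain ⟨x, hx, hx0⟩ := hx
    obtain ⟨y, hy, hy0⟩ := F.symm.VV_ne hn hirr hx hx0
    have hV : VV L e f = VV L f e :=
      le_antisymm (fun v hv => F.symm.VV_sub hy hy0 hv) (fun v hv => F.VV_sub hx hx0 hv)
    have hFF : FF L e = FF L f :=
      le_antisymm (F.FF_le hV hx hx0) (F.symm.FF_le hV.symm hy hy0)
    have hm : ∀ x ∈ VV L e f, ∀ q ∈ FF L e, rs x q ∈ VV L e f := by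
      intro x hx q hq
      rw [← Quaternion.re_add_im q, rs_add, rs_coe]
      refine Submodule.add_mem _ (Submodule.smul_mem _ _ hx) ?_
      rw [hV]
      exact F.mul_im hx (hFF ▸ FF_re_sub.1 hq) (star_im _)
    refine ⟨hV, hFF, hm, Or.inl ⟨⟨x, hx, hx0⟩, fun p hp q hq => ?_⟩⟩
    have h2 := F.B_mem hx (hm _ (hm _ hx p hp) q hq)
    rw [qB_rs_right, qB_rs_right, qB_self_real, mul_assoc, Quaternion.coe_mul_eq_smul] at h2
    have h3 := (FF L e).smul_mem ((qB x x).re)⁻¹ h2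
    rwa [smul_smul, inv_mul_cancel₀ (F.pos hx hx0).ne', one_smul] at h3
  · push Not at hx
    have hy : ∀ y ∈ VV L f e, y = 0 := by
      intro y hy
      by_contra hy0
      obtain ⟨x, hx1, hx0⟩ := F.VV_ne hn hirr hy hy0
      exact hx0 (hx x hx1)
    have hV : VV L e f = VV L f e := by
      rw [(Submodule.eq_bot_iff _).2 hx, (Submodule.eq_bot_iff _).2 hy]
    have hz : ∃ z ∈ FF L e, z.im ≠ 0 := by
      rcases F.posF hn hirr with ⟨x, h1, h2⟩ | h
      · exact absurd (hx x h1) h2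
      · exact h
    have hw : ∃ z ∈ FF L f, z.im ≠ 0 := by
      rcases F.symm.posF hn hirr with ⟨x, h1, h2⟩ | h
      · exact absurd (hy x h1) h2
      · exact h
    obtain ⟨z, hz1, hz2⟩ := hz
    obtain ⟨w, hw1, hw2⟩ := hw
    refine ⟨hV, le_antisymm (F.symm.FF_le' hw1 hw2) (F.FF_le' hz1 hz2), ?_,
      Or.inr ⟨F.span_top hirr hx hy, z, hz1, hz2⟩⟩
    intro x hx1 q _
    rw [hx x hx1]
    have : rs (0 : QV n) q = 0 := by ext1; simp [rs]
    rw [this]; exact zero_mem _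

end QFrame
end Struct2
end

noncomputable section

section Struct3
variable {n : ℕ} {L : Submodule ℝ (QM n)} {e f : QV n}

/-- reconstruction from the partial frame -/
def recon {k : ℕ} (e f : QV n) (g : Fin k → QV n) (v : QV n) : QV n :=
  rs e (qB f v) + rs f (qB e v) + ∑ i, rs (g i) (qB (g i) v)

theorem recon_add {k : ℕ} (e f : QV n) (g : Fin k → QV n) (v w : QV n) :
    recon e f g (v + w) = recon e f g v + recon e f g w := by
  simp only [recon, qB_add_right, rs_add, Finset.sum_add_distrib]; abel

theorem recon_rs {k : ℕ} (e f : QV n) (g : Fin k → QV n) (v : QV n) (q : Quat) :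
    recon e f g (rs v q) = rs (recon e f g v) q := by
  simp only [recon, qB_rs_right, add_rs, sum_rs, rs_rs]

/-- the right submodule spanned by a partial frame -/
def frameSpan {k : ℕ} (e f : QV n) (g : Fin k → QV n) : Submodule Quatᵐᵒᵖ (QV n) where
  carrier := {v | recon e f g v = v}
  zero_mem' := by simp [recon]
  add_mem' := by
    intro a b ha hb
    show recon e f g (a + b) = a + b
    rw [recon_add, ha, hb]
  smul_mem' := by
    intro q v hv
    show recon e f g (rs v q.unop) = rs v q.unop
    rw [recon_rs, hv]

theorem frameSpan_card {k : ℕ} (e f : QV n) (g : Fin k → QV n) (h : frameSpan e f g = ⊤) :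
    n ≤ k + 1 := by
  let Φ : (Quat × Quat × (Fin k → Quat)) →ₗ[ℝ] QV n :=
    { toFun := fun p => rs e p.1 + rs f p.2.1 + ∑ i, rs (g i) (p.2.2 i)
      map_add' := by
        intro p q
        simp only [Prod.fst_add, Prod.snd_add, Pi.add_apply, rs_add, Finset.sum_add_distrib]; abel
      map_smul' := by
        intro t p
        simp only [Prod.smul_fst, Prod.smul_snd, Pi.smul_apply, rs_smul, RingHom.id_apply, smul_add,
          Finset.smul_sum] }
  have hs : Function.Surjective Φ := by
    intro v
    refine ⟨(qB f v, qB e v, fun i => qB (g i) v), ?_⟩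
    have : v ∈ frameSpan e f g := h ▸ Submodule.mem_top
    exact this
  have h1 := LinearMap.finrank_le_finrank_of_surjective hs
  have h4 : Module.finrank ℝ Quat = 4 := Quaternion.finrank_eq_four
  rw [Module.finrank_prod, Module.finrank_prod, Module.finrank_pi_fintype, Module.finrank_pi_fintype] at h1
  simp only [h4, Finset.sum_const, Finset.card_univ, Fintype.card_fin, smul_eq_mul] at h1
  omega

namespace QFrame

theorem extend (F : QFrame L e f) (hn : 1 ≤ n) (hirr : ActsHIrreducibly n (L : Set (QM n))) {k : ℕ}
    (hk : k + 1 < n) (g : Fin k → QV n) (hg : ∀ i, g i ∈ VV L e f)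
    (hgg : ∀ i j, qB (g i) (g j) = if i = j then 1 else 0) :
    ∃ x ∈ VV L e f, qB x x = 1 ∧ ∀ i, qB (g i) x = 0 := by
  obtain ⟨hV, hFF, hm, -⟩ := F.struct1 hn hirr
  have hnot : ¬ ∀ x ∈ VV L e f, x ∈ frameSpan e f g := by
    intro hall
    have he : e ∈ frameSpan e f g := by
      show recon e f g e = e
      simp [recon, F.ee, F.fe, F.orthl (hg _)]
    have hf : f ∈ frameSpan e f g := by
      show recon e f g f = f
      simp [recon, F.ff, F.ef, F.orthr (hg _)]
    have hr : ∀ v ∈ frameSpan e f g, ∀ q, rs v q ∈ frameSpan e f g := fun v hv q =>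
      Submodule.smul_mem _ (MulOpposite.op q) hv
    have hgS : ∀ i, g i ∈ frameSpan e f g := fun i => hall _ (hg i)
    have hXf : ∀ X ∈ L, X *ᵥ f ∈ frameSpan e f g := by
      intro X hX
      have h1 := hall _ (F.prW_mem hX)
      have : X *ᵥ f = prW e f (X *ᵥ f) + rs f (qB e (X *ᵥ f)) + rs e (qB f (X *ᵥ f)) := by
        simp only [prW]; abel
      rw [this]
      exact Submodule.add_mem _ (Submodule.add_mem _ h1 (hr _ hf _)) (hr _ he _)
    have hXe : ∀ X ∈ L, X *ᵥ e ∈ frameSpan e f g := by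
      intro X hX
      have h1 := hall _ (hV ▸ F.prW_mem' hX)
      have : X *ᵥ e = prW e f (X *ᵥ e) + rs f (qB e (X *ᵥ e)) + rs e (qB f (X *ᵥ e)) := by
        simp only [prW]; abel
      rw [this]
      exact Submodule.add_mem _ (Submodule.add_mem _ h1 (hr _ hf _)) (hr _ he _)
    have hXg : ∀ X ∈ L, ∀ i, X *ᵥ g i ∈ frameSpan e f g := by
      intro X hX i
      have h1 := F.br _ hX _ (hg i).2.2
      have h2 := hXf _ h1
      rw [qR_bracket (F.sk _ hX), Matrix.add_mulVec, qR_mulVec, qR_mulVec, F.ef, F.orthr (hg i), rs_one,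
        rs_zero, sub_zero] at h2
      have : X *ᵥ g i = (X *ᵥ g i - rs e (qB (X *ᵥ g i) f) + rs (g i) (qB (X *ᵥ e) f)) +
        rs e (qB (X *ᵥ g i) f) - rs (g i) (qB (X *ᵥ e) f) := by abel
      rw [this]
      exact Submodule.sub_mem _ (Submodule.add_mem _ h2 (hr _ he _)) (hr _ (hgS i) _)
    rcases hirr (frameSpan e f g) (by
      intro X hX v hv
      have hv' : recon e f g v = v := hv
      rw [← hv', recon, Matrix.mulVec_add, Matrix.mulVec_add, Matrix.mulVec_sum]
      simp only [mulVec_rs]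
      exact Submodule.add_mem _ (Submodule.add_mem _ (hr _ (hXe X hX) _) (hr _ (hXf X hX) _))
        (Submodule.sum_mem _ fun i _ => hr _ (hXg X hX i) _)) with h | h
    · rw [h] at he; exact F.e_ne (by simpa using he)
    · have := frameSpan_card e f g h; omega
  push Not at hnot
  obtain ⟨x, hx, hxS⟩ := hnot
  set y := x - ∑ i, rs (g i) (qB (g i) x) with hy
  have hyV : y ∈ VV L e f := Submodule.sub_mem _ hx (Submodule.sum_mem _ fun i _ =>
    hm _ (hg i) _ (F.B_mem (hg i) hx))
  have hy0 : y ≠ 0 := by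
    intro h0
    apply hxS
    show recon e f g x = x
    rw [recon, hx.1, hx.2.1]
    rw [hy, sub_eq_zero] at h0
    simpa using h0.symm
  have hyg : ∀ i, qB (g i) y = 0 := by
    intro i
    rw [hy, qB_sub_right, qB_sum_right]
    simp [qB_rs_right, hgg]
  have hN := F.pos hyV hy0
  refine ⟨(Real.sqrt (qB y y).re)⁻¹ • y, Submodule.smul_mem _ _ hyV, ?_, fun i => by
    rw [qB_smul_right, hyg, smul_zero]⟩
  rw [qB_smul_left, qB_smul_right, smul_smul]
  have : (Real.sqrt (qB y y).re)⁻¹ * (Real.sqrt (qB y y).re)⁻¹ = ((qB y y).re)⁻¹ := by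
    rw [← mul_inv, Real.mul_self_sqrt hN.le]
  rw [this]
  nth_rewrite 2 [qB_self_real]
  rw [← Quaternion.coe_smul, smul_eq_mul, inv_mul_cancel₀ hN.ne', Quaternion.coe_one]

theorem family (F : QFrame L e f) (hn : 1 ≤ n) (hirr : ActsHIrreducibly n (L : Set (QM n))) (k : ℕ)
    (hk : k < n) : ∃ g : Fin k → QV n, (∀ i, g i ∈ VV L e f) ∧
      ∀ i j, qB (g i) (g j) = if i = j then 1 else 0 := by
  induction k with
  | zero => exact ⟨fun i => i.elim0, fun i => i.elim0, fun i => i.elim0⟩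
  | succ k ih =>
    obtain ⟨g, hg, hgg⟩ := ih (by omega)
    obtain ⟨x, hx, hxx, hxg⟩ := F.extend hn hirr hk g hg hgg
    have hgx : ∀ i, qB x (g i) = 0 := fun i => by rw [← qB_star, hxg]; simp
    refine ⟨Fin.snoc g x, fun i => ?_, fun i j => ?_⟩
    · refine Fin.lastCases ?_ (fun i => ?_) i
      · simpa using hx
      · simpa using hg i
    · refine Fin.lastCases ?_ (fun i => ?_) i
      · refine Fin.lastCases ?_ (fun j => ?_) j
        · simpa using hxx
        · simpa [hgx j] using fun h => absurd h.symm (Fin.castSucc_lt_last j).ne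
      · refine Fin.lastCases ?_ (fun j => ?_) j
        · simpa [hxg i] using fun h => absurd h (Fin.castSucc_lt_last i).ne
        · simpa using hgg i j

end QFrame

/-- A full frame adapted to the Lie algebra `L` with coefficient space `K`. -/
structure QGood {m : ℕ} (L : Submodule ℝ (QM (m + 1))) (K : Submodule ℝ Quat) (e f : QV (m + 1))
    (g : Fin m → QV (m + 1)) : Prop where
  ee : qB e e = 0
  ff : qB f f = 0
  ef : qB e f = 1
  eg : ∀ k, qB e (g k) = 0
  fg : ∀ k, qB f (g k) = 0
  gg : ∀ i j, qB (g i) (g j) = if i = j then 1 else 0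
  sk : ∀ X ∈ L, IsSk X
  br : ∀ X ∈ L, ∀ Y ∈ L, X * Y - Y * X ∈ L
  coe : ∀ t : ℝ, (t : Quat) ∈ K
  a1 : ∀ q ∈ K, qR (rs e q) e ∈ L
  a2 : ∀ q ∈ K, qR (rs f q) f ∈ L
  a3 : ∀ q ∈ K, ∀ k, qR (rs (g k) q) e ∈ L
  a4 : ∀ q ∈ K, ∀ k, qR (rs (g k) q) f ∈ L
  b1 : ∀ X ∈ L, qB f (X *ᵥ f) ∈ K
  b2 : ∀ X ∈ L, qB e (X *ᵥ e) ∈ K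
  b3 : ∀ X ∈ L, ∀ k, qB (g k) (X *ᵥ e) ∈ K
  b4 : ∀ X ∈ L, ∀ k, qB (g k) (X *ᵥ f) ∈ K

theorem qB_prW {e f : QV n} {x v : QV n} (h1 : qB e x = 0) (h2 : qB f x = 0) :
    qB x (prW e f v) = qB x v := by
  have h1' : qB x e = 0 := by rw [← qB_star, h1]; simp
  have h2' : qB x f = 0 := by rw [← qB_star, h2]; simp
  simp [prW, qB_sub_right, qB_rs_right, h1', h2']

theorem QFrame.good {m : ℕ} {L : Submodule ℝ (QM (m + 1))} {e f : QV (m + 1)} (F : QFrame L e f)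
    (hirr : ActsHIrreducibly (m + 1) (L : Set (QM (m + 1)))) :
    ∃ K : Submodule ℝ Quat, ∃ g : Fin m → QV (m + 1), QGood L K e f g ∧
      ((1 ≤ m ∧ ∀ p ∈ K, ∀ q ∈ K, p * q ∈ K) ∨ (m = 0 ∧ ∃ z ∈ K, z.im ≠ 0)) := by
  have hn : 1 ≤ m + 1 := by omega
  obtain ⟨hV, hFF, hm, hcase⟩ := F.struct1 hn hirr
  obtain ⟨g, hg, hgg⟩ := F.family hn hirr m (by omega)
  refine ⟨FF L e, g, ?_, ?_⟩
  · refine ⟨F.ee, F.ff, F.ef, fun k => (hg k).1, fun k => (hg k).2.1, hgg, F.sk, F.br, FF_coe,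
      fun q hq => hq, fun q hq => ?_, fun q hq k => (hm _ (hg k) q hq).2.2, fun q hq k => ?_,
      fun X hX => F.gp1 X hX, fun X hX => ?_, fun X hX k => ?_, fun X hX k => ?_⟩
    · rw [hFF] at hq; exact hq
    · have := hm _ (hg k) q hq
      rw [hV] at this; exact this.2.2
    · rw [hFF]; exact F.gm1 X hX
    · rw [← qB_prW (hg k).1 (hg k).2.1]
      exact F.B_mem (hg k) (hV ▸ F.prW_mem' hX)
    · rw [← qB_prW (hg k).1 (hg k).2.1]
      exact F.B_mem (hg k) (F.prW_mem hX)
  · rcases hcase with ⟨⟨x, hx, hx0⟩, hmul⟩ | ⟨h0, hz⟩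
    · left
      refine ⟨?_, hmul⟩
      by_contra hm0
      have hm0 : m = 0 := by omega
      subst hm0
      have hN := F.pos hx hx0
      let Φ : (Quat × Quat × Quat) →ₗ[ℝ] QV (0 + 1) :=
        { toFun := fun p => rs e p.1 + rs f p.2.1 + rs x p.2.2
          map_add' := by
            intro p q
            simp only [Prod.fst_add, Prod.snd_add, rs_add]; abel
          map_smul' := by
            intro t p
            simp only [Prod.smul_fst, Prod.smul_snd, rs_smul, RingHom.id_apply, smul_add] }
      have hinj : Function.Injective Φ := by
        rw [← LinearMap.ker_eq_bot, LinearMap.ker_eq_bot']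
        rintro ⟨a, b, c⟩ h
        have h' : rs e a + rs f b + rs x c = 0 := h
        have h1 := congrArg (qB f) h'
        have h2 := congrArg (qB e) h'
        have h3 := congrArg (qB x) h'
        simp only [qB_add_right, qB_rs_right, F.ee, F.ff, F.ef, F.fe, hx.1, hx.2.1, F.orthl hx, F.orthr hx,
          zero_mul, one_mul, zero_add, add_zero, qB_zero_right] at h1 h2 h3
        have h4 : c = 0 := by
          rcases mul_eq_zero.1 h3 with h | h
          · rw [h] at hN; simp at hN
          · exact h
        simp [h1, h2, h4]
      have h1 := LinearMap.finrank_le_finrank_of_injective hinj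
      have h4 : Module.finrank ℝ Quat = 4 := Quaternion.finrank_eq_four
      rw [Module.finrank_prod, Module.finrank_prod, Module.finrank_pi_fintype] at h1
      simp only [h4, Finset.sum_const, Finset.card_univ, Fintype.card_fin, smul_eq_mul] at h1
      omega
    · right
      refine ⟨?_, hz⟩
      by_contra hm0
      have h1 := (hg ⟨0, by omega⟩)
      have h2 := h0 _ h1.1 h1.2.1
      have h3 := hgg ⟨0, by omega⟩ ⟨0, by omega⟩
      rw [h2] at h3; simp at h3

end Struct3
end

noncomputable section

section Rot

/-- rotated coefficient space -/
def Krot (K : Submodule ℝ Quat) (q : Quat) : Submodule ℝ Quat where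
  carrier := {p | q * p * star q ∈ K}
  zero_mem' := by simp
  add_mem' := by
    intro a b ha hb
    show q * (a + b) * star q ∈ K
    rw [mul_add, add_mul]; exact K.add_mem ha hb
  smul_mem' := by
    intro t a ha
    show q * (t • a) * star q ∈ K
    rw [mul_smul_comm, smul_mul_assoc]; exact K.smul_mem _ ha

theorem mem_Krot {K : Submodule ℝ Quat} {q p : Quat} : p ∈ Krot K q ↔ q * p * star q ∈ K := Iff.rfl

theorem Krot_Krot (K : Submodule ℝ Quat) (q r : Quat) : Krot (Krot K q) r = Krot K (q * r) := by
  ext p; simp only [mem_Krot, star_mul, mul_assoc]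

theorem unit_mul_star {q : Quat} (h : ‖q‖ = 1) : q * star q = 1 := by
  rw [Quaternion.self_mul_star, Quaternion.normSq_eq_norm_mul_self, h]; simp

theorem unit_star_mul {q : Quat} (h : ‖q‖ = 1) : star q * q = 1 := by
  rw [Quaternion.star_mul_self, Quaternion.normSq_eq_norm_mul_self, h]; simp

theorem Krot_coe {K : Submodule ℝ Quat} (hK : ∀ t : ℝ, (t : Quat) ∈ K) {q : Quat} (hq : ‖q‖ = 1) (t : ℝ) :
    (t : Quat) ∈ Krot K q := by
  rw [mem_Krot, Quaternion.mul_coe_eq_smul, smul_mul_assoc, unit_mul_star hq]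
  have := hK t
  rwa [← mul_one (t : Quat), Quaternion.coe_mul_eq_smul] at this

theorem rot_of {q : Quat} (hq : q ≠ 0) : ∃ u : Quat, ‖u‖ = 1 ∧ ∀ w z, q * w = z * q → u * w * star u = z := by
  have hn : ‖q‖ ≠ 0 := by simpa using hq
  have hu : ‖(‖q‖⁻¹ • q)‖ = 1 := by
    rw [norm_smul, norm_inv, norm_norm, inv_mul_cancel₀ hn]
  refine ⟨‖q‖⁻¹ • q, hu, fun w z h => ?_⟩
  have : (‖q‖⁻¹ • q) * w = z * (‖q‖⁻¹ • q) := by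
    rw [smul_mul_assoc, mul_smul_comm, h]
  rw [this, mul_assoc, unit_mul_star hu, mul_one]

def qj : Quat := ⟨0, 0, 1, 0⟩
def qk : Quat := ⟨0, 0, 0, 1⟩
def qmk (a b c d : ℝ) : Quat := ⟨a, b, c, d⟩
@[simp] theorem qmk_re (a b c d : ℝ) : (qmk a b c d).re = a := rfl
@[simp] theorem qmk_imI (a b c d : ℝ) : (qmk a b c d).imI = b := rfl
@[simp] theorem qmk_imJ (a b c d : ℝ) : (qmk a b c d).imJ = c := rfl
@[simp] theorem qmk_imK (a b c d : ℝ) : (qmk a b c d).imK = d := rfl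
@[simp] theorem qi_re : qi.re = 0 := rfl
@[simp] theorem qi_imI : qi.imI = 1 := rfl
@[simp] theorem qi_imJ : qi.imJ = 0 := rfl
@[simp] theorem qi_imK : qi.imK = 0 := rfl
@[simp] theorem qj_re : qj.re = 0 := rfl
@[simp] theorem qj_imI : qj.imI = 0 := rfl
@[simp] theorem qj_imJ : qj.imJ = 1 := rfl
@[simp] theorem qj_imK : qj.imK = 0 := rfl
@[simp] theorem qk_re : qk.re = 0 := rfl
@[simp] theorem qk_imI : qk.imI = 0 := rfl
@[simp] theorem qk_imJ : qk.imJ = 0 := rfl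
@[simp] theorem qk_imK : qk.imK = 1 := rfl

def KR : Submodule ℝ Quat where
  carrier := {q | q.imI = 0 ∧ q.imJ = 0 ∧ q.imK = 0}
  zero_mem' := by simp
  add_mem' := by rintro a b ⟨h1, h2, h3⟩ ⟨h4, h5, h6⟩; simp [*]
  smul_mem' := by rintro t a ⟨h1, h2, h3⟩; simp [*]
def KC : Submodule ℝ Quat where
  carrier := {q | q.imJ = 0 ∧ q.imK = 0}
  zero_mem' := by simp
  add_mem' := by rintro a b ⟨h1, h2⟩ ⟨h4, h5⟩; simp [*]
  smul_mem' := by rintro t a ⟨h1, h2⟩; simp [*]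
def KS : Submodule ℝ Quat where
  carrier := {q | q.imI = 0}
  zero_mem' := by simp
  add_mem' := by intro a b h1 h2; simp at h1 h2 ⊢; simp [*]
  smul_mem' := by intro t a h1; simp at h1 ⊢; simp [*]

theorem mem_KR {q : Quat} : q ∈ KR ↔ q.imI = 0 ∧ q.imJ = 0 ∧ q.imK = 0 := Iff.rfl
theorem mem_KC {q : Quat} : q ∈ KC ↔ q.imJ = 0 ∧ q.imK = 0 := Iff.rfl
theorem mem_KS {q : Quat} : q ∈ KS ↔ q.imI = 0 := Iff.rfl

theorem quat_decomp (q : Quat) : q = (q.re : Quat) + q.imI • qi + q.imJ • qj + q.imK • qk := by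
  ext <;> simp

/-- rotate an imaginary unit into `i` -/
theorem rot_to_i {z : Quat} (hr : z.re = 0) (hz : z.imI ^ 2 + z.imJ ^ 2 + z.imK ^ 2 = 1) :
    ∃ u : Quat, ‖u‖ = 1 ∧ u * qi * star u = z := by
  by_cases h : z + qi = 0
  · obtain ⟨u, hu, hw⟩ := rot_of (q := qj) (by intro h; have := congrArg (fun q : Quat => q.imJ) h; simp at this)
    refine ⟨u, hu, hw _ _ ?_⟩
    rw [eq_neg_of_add_eq_zero_left h]
    ext <;> simp
  · obtain ⟨u, hu, hw⟩ := rot_of h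
    refine ⟨u, hu, hw _ _ ?_⟩
    ext <;> simp [hr] <;> nlinarith

theorem Kclass (K : Submodule ℝ Quat) (hK : ∀ t : ℝ, (t : Quat) ∈ K) :
    ∃ q : Quat, ‖q‖ = 1 ∧ (Krot K q = KR ∨ Krot K q = KC ∨ Krot K q = ⊤ ∨ Krot K q = KS) := by
  by_cases h0 : ∀ z ∈ K, z.im = 0
  · refine ⟨1, by simp, Or.inl ?_⟩
    ext p
    rw [mem_Krot, mem_KR]
    simp only [one_mul, star_one, mul_one]
    constructor
    · intro hp
      have := h0 p hp
      have h1 := congrArg (fun q : Quat => q.imI) this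
      have h2 := congrArg (fun q : Quat => q.imJ) this
      have h3 := congrArg (fun q : Quat => q.imK) this
      simp at h1 h2 h3
      exact ⟨h1, h2, h3⟩
    · rintro ⟨h1, h2, h3⟩
      rw [quat_decomp p, h1, h2, h3]; simpa using hK p.re
  push Not at h0
  obtain ⟨z, hz, hz0⟩ := h0
  obtain ⟨u1, hu1, hi⟩ : ∃ u : Quat, ‖u‖ = 1 ∧ qi ∈ Krot K u := by
    have hzi : z.im ∈ K := by
      have := K.sub_mem hz (hK z.re)
      rwa [show z - (z.re : Quat) = z.im by simp] at this
    have hs : 0 < z.imI ^ 2 + z.imJ ^ 2 + z.imK ^ 2 := by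
      by_contra hcon
      apply hz0
      have a1 : z.imI = 0 := by nlinarith [sq_nonneg z.imI, sq_nonneg z.imJ, sq_nonneg z.imK]
      have a2 : z.imJ = 0 := by nlinarith [sq_nonneg z.imI, sq_nonneg z.imJ, sq_nonneg z.imK]
      have a3 : z.imK = 0 := by nlinarith [sq_nonneg z.imI, sq_nonneg z.imJ, sq_nonneg z.imK]
      ext <;> simp [*]
    set s := z.imI ^ 2 + z.imJ ^ 2 + z.imK ^ 2 with hsd
    have hr : Real.sqrt s ^ 2 = s := Real.sq_sqrt hs.le
    have hr0 : Real.sqrt s ≠ 0 := (Real.sqrt_pos.2 hs).ne'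
    obtain ⟨u, hu, hw⟩ := rot_to_i (z := (Real.sqrt s)⁻¹ • z.im) (by simp) (by
      simp only [Quaternion.imI_smul, Quaternion.imJ_smul, Quaternion.imK_smul, Quaternion.imI_im,
        Quaternion.imJ_im, Quaternion.imK_im, smul_eq_mul]
      have : ((Real.sqrt s)⁻¹ * z.imI) ^ 2 + ((Real.sqrt s)⁻¹ * z.imJ) ^ 2 + ((Real.sqrt s)⁻¹ * z.imK) ^ 2 =
        (Real.sqrt s ^ 2)⁻¹ * s := by rw [hsd]; ring
      rw [this, hr, inv_mul_cancel₀ hs.ne'])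
    refine ⟨u, hu, ?_⟩
    rw [mem_Krot, hw]
    exact K.smul_mem _ hzi
  have hK1 := Krot_coe hK hu1
  by_cases h1 : ∀ p ∈ Krot K u1, p.imJ = 0 ∧ p.imK = 0
  · refine ⟨u1, hu1, Or.inr (Or.inl ?_)⟩
    ext p
    refine ⟨fun hp => h1 p hp, fun hp => ?_⟩
    obtain ⟨a, b⟩ := mem_KC.1 hp
    rw [quat_decomp p, a, b]
    simpa using Submodule.add_mem _ (hK1 p.re) (Submodule.smul_mem _ _ hi)
  have h1' : ∃ p ∈ Krot K u1, 0 < p.imJ ^ 2 + p.imK ^ 2 := by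
    by_contra hcon
    push Not at hcon
    apply h1
    intro p hp
    have := hcon p hp
    constructor <;> nlinarith [sq_nonneg p.imJ, sq_nonneg p.imK]
  obtain ⟨p, hp, hs⟩ := h1'
  obtain ⟨u2, hu2, hi2, hj2⟩ : ∃ u : Quat, ‖u‖ = 1 ∧ qi ∈ Krot (Krot K u1) u ∧ qj ∈ Krot (Krot K u1) u := by
    have hw0 : p.imJ • qj + p.imK • qk ∈ Krot K u1 := by
      have := Submodule.sub_mem _ (Submodule.sub_mem _ hp (hK1 p.re)) (Submodule.smul_mem _ p.imI hi)
      rwa [show p - (p.re : Quat) - p.imI • qi = p.imJ • qj + p.imK • qk by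
        ext <;> simp] at this
    set s := p.imJ ^ 2 + p.imK ^ 2 with hsd
    have hr : Real.sqrt s ^ 2 = s := Real.sq_sqrt hs.le
    have hr0 : Real.sqrt s ≠ 0 := (Real.sqrt_pos.2 hs).ne'
    have hw1 := Submodule.smul_mem _ (Real.sqrt s)⁻¹ hw0
    obtain ⟨w, hwd⟩ : ∃ w : Quat, w = (Real.sqrt s)⁻¹ • (p.imJ • qj + p.imK • qk) := ⟨_, rfl⟩
    rw [← hwd] at hw1
    have w1 : w.re = 0 := by simp [hwd]
    have w2 : w.imI = 0 := by simp [hwd]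
    have w3 : w.imJ ^ 2 + w.imK ^ 2 = 1 := by
      have a : w.imJ = (Real.sqrt s)⁻¹ * p.imJ := by simp [hwd]
      have b : w.imK = (Real.sqrt s)⁻¹ * p.imK := by simp [hwd]
      have : w.imJ ^ 2 + w.imK ^ 2 = (Real.sqrt s ^ 2)⁻¹ * s := by rw [a, b, hsd]; ring
      rw [this, hr, inv_mul_cancel₀ hs.ne']
    by_cases h : w + qj = 0
    · refine ⟨1, by simp, by simpa [mem_Krot] using hi, ?_⟩
      have := Submodule.neg_mem _ hw1
      rw [eq_neg_of_add_eq_zero_left h, neg_neg] at this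
      rw [mem_Krot]; simpa using this
    · obtain ⟨u, hu, hw⟩ := rot_of h
      refine ⟨u, hu, ?_, ?_⟩
      · rw [mem_Krot, hw qi (-qi) (by ext <;> simp [w1, w2])]
        exact Submodule.neg_mem _ hi
      · rw [mem_Krot, hw qj w (by ext <;> simp [w1, w2] <;> nlinarith)]
        exact hw1
  rw [Krot_Krot] at hi2 hj2
  have hu : ‖u1 * u2‖ = 1 := by rw [norm_mul, hu1, hu2, one_mul]
  have hK2 := Krot_coe hK hu
  set u := u1 * u2
  by_cases h2 : ∀ p ∈ Krot K u, p.imK = 0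
  · have hc : ‖(qmk (1/2) (-1/2) (-1/2) (-1/2))‖ = 1 := by
      have : ‖(qmk (1/2) (-1/2) (-1/2) (-1/2))‖ * ‖(qmk (1/2) (-1/2) (-1/2) (-1/2))‖ = 1 := by
        rw [← Quaternion.normSq_eq_norm_mul_self, Quaternion.normSq_def']; norm_num
      nlinarith [norm_nonneg (qmk (1/2) (-1/2) (-1/2) (-1/2))]
    refine ⟨u * (qmk (1/2) (-1/2) (-1/2) (-1/2)), by rw [norm_mul, hu, hc, one_mul], Or.inr (Or.inr (Or.inr ?_))⟩
    rw [← Krot_Krot]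
    ext p
    have e1 : (qmk (1/2) (-1/2) (-1/2) (-1/2)) * p * star (qmk (1/2) (-1/2) (-1/2) (-1/2)) =
        qmk p.re p.imJ p.imK p.imI := by
      ext <;> simp <;> ring
    rw [mem_Krot, e1, mem_KS]
    constructor
    · intro h; exact h2 _ h
    · intro h
      rw [h, quat_decomp (qmk p.re p.imJ p.imK 0)]
      simpa using Submodule.add_mem _ (Submodule.add_mem _ (hK2 p.re) (Submodule.smul_mem _ p.imJ hi2))
        (Submodule.smul_mem _ p.imK hj2)
  · refine ⟨u, hu, Or.inr (Or.inr (Or.inl ?_))⟩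
    push Not at h2
    obtain ⟨p, hp, hp0⟩ := h2
    have hk : qk ∈ Krot K u := by
      have := Submodule.sub_mem _ (Submodule.sub_mem _ (Submodule.sub_mem _ hp (hK2 p.re))
        (Submodule.smul_mem _ p.imI hi2)) (Submodule.smul_mem _ p.imJ hj2)
      rw [show p - (p.re : Quat) - p.imI • qi - p.imJ • qj = p.imK • qk by
        ext <;> simp] at this
      have := Submodule.smul_mem _ p.imK⁻¹ this
      rwa [smul_smul, inv_mul_cancel₀ hp0, one_smul] at this
    rw [eq_top_iff]
    intro p _
    rw [quat_decomp p]
    exact Submodule.add_mem _ (Submodule.add_mem _ (Submodule.add_mem _ (hK2 _) (Submodule.smul_mem _ _ hi2))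
      (Submodule.smul_mem _ _ hj2)) (Submodule.smul_mem _ _ hk)

theorem qR_rs_rs {n : ℕ} (a b : QV n) (p q r : Quat) :
    qR (rs (rs a q) p) (rs b r) = qR (rs a (q * p * star r)) b := by
  rw [rs_rs, mul_assoc, ← mul_assoc, ← rs_rs _ _ (star r), qR_rs_left _ _ (star r), star_star]

theorem QGood.rot {m : ℕ} {L : Submodule ℝ (QM (m + 1))} {K : Submodule ℝ Quat} {e f : QV (m + 1)}
    {g : Fin m → QV (m + 1)} (G : QGood L K e f g) {q : Quat} (hq : ‖q‖ = 1) :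
    QGood L (Krot K q) (rs e q) (rs f q) (fun k => rs (g k) q) := by
  have key : ∀ p ∈ K, star q * p * q ∈ Krot K q := by
    intro p hp
    rw [mem_Krot]
    have : q * (star q * p * q) * star q = (q * star q) * p * (q * star q) := by simp only [mul_assoc]
    rw [this, unit_mul_star hq]; simpa using hp
  refine ⟨?_, ?_, ?_, ?_, ?_, ?_, G.sk, G.br, Krot_coe G.coe hq, ?_, ?_, ?_, ?_, ?_, ?_, ?_, ?_⟩
  · simp [qB_rs_left, qB_rs_right, G.ee]
  · simp [qB_rs_left, qB_rs_right, G.ff]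
  · simp [qB_rs_left, qB_rs_right, G.ef, unit_star_mul hq]
  · simp [qB_rs_left, qB_rs_right, G.eg]
  · simp [qB_rs_left, qB_rs_right, G.fg]
  · intro i j
    rw [qB_rs_left, qB_rs_right, G.gg]
    split_ifs <;> simp [unit_star_mul hq]
  · intro p hp; rw [qR_rs_rs]; exact G.a1 _ hp
  · intro p hp; rw [qR_rs_rs]; exact G.a2 _ hp
  · intro p hp k; rw [qR_rs_rs]; exact G.a3 _ hp k
  · intro p hp k; rw [qR_rs_rs]; exact G.a4 _ hp k
  · intro X hX; rw [mulVec_rs, qB_rs_left, qB_rs_right, ← mul_assoc]; exact key _ (G.b1 X hX)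
  · intro X hX; rw [mulVec_rs, qB_rs_left, qB_rs_right, ← mul_assoc]; exact key _ (G.b2 X hX)
  · intro X hX k; rw [mulVec_rs, qB_rs_left, qB_rs_right, ← mul_assoc]; exact key _ (G.b3 X hX k)
  · intro X hX k; rw [mulVec_rs, qB_rs_left, qB_rs_right, ← mul_assoc]; exact key _ (G.b4 X hX k)

end Rot
end

noncomputable section

section StdFrame
variable {m : ℕ}

structure QFr (e f : QV (m + 1)) (g : Fin m → QV (m + 1)) : Prop where
  ee : qB e e = 0
  ff : qB f f = 0
  ef : qB e f = 1
  eg : ∀ k, qB e (g k) = 0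
  fg : ∀ k, qB f (g k) = 0
  gg : ∀ i j, qB (g i) (g j) = if i = j then 1 else 0

theorem QGood.fr {L : Submodule ℝ (QM (m + 1))} {K : Submodule ℝ Quat} {e f : QV (m + 1)}
    {g : Fin m → QV (m + 1)} (G : QGood L K e f g) : QFr e f g :=
  ⟨G.ee, G.ff, G.ef, G.eg, G.fg, G.gg⟩

theorem QFr.fe {e f : QV (m + 1)} {g : Fin m → QV (m + 1)} (F : QFr e f g) : qB f e = 1 := by
  rw [← qB_star, F.ef, star_one]
theorem QFr.ge {e f : QV (m + 1)} {g : Fin m → QV (m + 1)} (F : QFr e f g) (k) : qB (g k) e = 0 := by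
  rw [← qB_star, F.eg, star_zero]
theorem QFr.gf {e f : QV (m + 1)} {g : Fin m → QV (m + 1)} (F : QFr e f g) (k) : qB (g k) f = 0 := by
  rw [← qB_star, F.fg, star_zero]

def e0 (m : ℕ) : QV (m + 1) := Pi.single 1 1 + Pi.single 0 1
def f0 (m : ℕ) : QV (m + 1) := (1 / 2 : ℝ) • (Pi.single 1 1 - Pi.single 0 1)
def g0 (m : ℕ) (k : Fin m) : QV (m + 1) := Pi.single k.succ.succ 1

theorem sg_zero' : sg (0 : Fin (m + 1)) = -1 := by simp [sg]
theorem sg_succ' (k : Fin m) : sg (k.succ : Fin (m + 1)) = 1 := by simp [sg]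
theorem sg_one' : sg (1 : Fin (m + 2)) = 1 := by simp [sg]

theorem qB_e0 (v : QV (m + 1)) : qB (e0 m) v = v 1 - v 0 := by
  rw [e0, qB_add_left, qB_single, qB_single, sg_zero', sg_one']; simp; abel
theorem qB_f0 (v : QV (m + 1)) : qB (f0 m) v = (1 / 2 : ℝ) • (v 1 + v 0) := by
  rw [f0, qB_smul_left, qB_sub_left, qB_single, qB_single, sg_zero', sg_one']; simp
theorem qB_g0 (v : QV (m + 1)) (k) : qB (g0 m k) v = v k.succ.succ := by
  rw [g0, qB_single, sg_succ']; simp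

theorem one_ne_ss (k : Fin m) : (1 : Fin (m + 2)) ≠ k.succ.succ := by
  intro h; have := congrArg Fin.val h; simp at this
theorem ss_ne_one (k : Fin m) : k.succ.succ ≠ (1 : Fin (m + 2)) := (one_ne_ss k).symm

theorem fr0 : QFr (e0 m) (f0 m) (g0 m) := by
  refine ⟨?_, ?_, ?_, ?_, ?_, ?_⟩
  · rw [qB_e0]; simp [e0]
  · rw [qB_f0]; simp [f0]
  · rw [qB_e0]; simp [f0]; module
  · intro k; rw [qB_e0]; simp [g0, one_ne_ss]
  · intro k; rw [qB_f0]; simp [g0, one_ne_ss]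
  · intro i j; rw [qB_g0]; simp [g0, Pi.single_apply]

theorem recon0 (v : QV (m + 1)) : recon (e0 m) (f0 m) (g0 m) v = v := by
  ext1 i
  simp only [recon, qB_e0, qB_f0, qB_g0, Pi.add_apply, Finset.sum_apply, rs_apply]
  refine Fin.cases ?_ (fun i => ?_) i
  · have : ∀ k, g0 m k 0 = 0 := fun k => by simp [g0]
    simp [this, e0, f0]; module
  · refine Fin.cases ?_ (fun i => ?_) i
    · have : ∀ k, g0 m k 1 = 0 := fun k => by simp [g0, one_ne_ss]
      show e0 m 1 * _ + f0 m 1 * _ + ∑ k, g0 m k 1 * _ = v 1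
      simp [this, e0, f0]; module
    · have h1 : e0 m i.succ.succ = 0 := by simp [e0, ss_ne_one]
      have h2 : f0 m i.succ.succ = 0 := by simp [f0, ss_ne_one]
      have h3 : ∀ k, g0 m k i.succ.succ = if i = k then 1 else 0 := by
        intro k; simp [g0, Pi.single_apply]
      simp [h1, h2, h3]

/-- the map taking one frame to the other -/
def frMap (e f : QV (m + 1)) (g : Fin m → QV (m + 1)) : QM (m + 1) :=
  qP e (f0 m) + qP f (e0 m) + ∑ k, qP (g k) (g0 m k)

theorem frMap_mulVec (e f : QV (m + 1)) (g : Fin m → QV (m + 1)) (v : QV (m + 1)) :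
    frMap e f g *ᵥ v = rs e (qB (f0 m) v) + rs f (qB (e0 m) v) + ∑ k, rs (g k) (qB (g0 m k) v) := by
  simp only [frMap, Matrix.add_mulVec, Matrix.sum_mulVec, qP_mulVec]

section
variable {e f : QV (m + 1)} {g : Fin m → QV (m + 1)} (F : QFr e f g)

theorem QFr.form (a b a' b' : Quat) (c c' : Fin m → Quat) (F : QFr e f g) :
    qB (rs e a + rs f b + ∑ k, rs (g k) (c k)) (rs e a' + rs f b' + ∑ k, rs (g k) (c' k)) =
      star a * b' + star b * a' + ∑ k, star (c k) * c' k := by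
  simp only [qB_add_left, qB_add_right, qB_sum_left, qB_sum_right, qB_rs_left, qB_rs_right, F.ee, F.ff,
    F.ef, F.eg, F.fg, F.fe, F.ge, F.gf, F.gg]
  simp [add_comm]

theorem frMap_sp (F : QFr e f g) : frMap e f g ∈ Sp (m + 1) := by
  rw [mem_Sp_iff]
  intro v w
  rw [frMap_mulVec, frMap_mulVec, F.form]
  conv_rhs => rw [← recon0 v, ← recon0 w, recon, recon, fr0.form]

theorem frMap_e (e f : QV (m + 1)) (g : Fin m → QV (m + 1)) : frMap e f g *ᵥ (e0 m) = e := by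
  rw [frMap_mulVec, fr0.fe, fr0.ee]; simp [fr0.ge]
theorem frMap_f (e f : QV (m + 1)) (g : Fin m → QV (m + 1)) : frMap e f g *ᵥ (f0 m) = f := by
  rw [frMap_mulVec, fr0.ef, fr0.ff]; simp [fr0.gf]
theorem frMap_g (e f : QV (m + 1)) (g : Fin m → QV (m + 1)) (k) : frMap e f g *ᵥ (g0 m k) = g k := by
  rw [frMap_mulVec, fr0.eg, fr0.fg]; simp only [fr0.gg]
  have : ∀ x : Fin m, rs (g x) (if x = k then (1 : Quat) else 0) = if x = k then g x else 0 := by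
    intro x; split_ifs <;> simp
  simp [this]

theorem QFr.recon (F : QFr e f g) (v : QV (m + 1)) : recon e f g v = v := by
  have h1 := Sp_inv_right (frMap_sp F)
  have h2 : v = frMap e f g *ᵥ ((eta (m + 1) * (frMap e f g)ᴴ * eta (m + 1)) *ᵥ v) := by
    rw [Matrix.mulVec_mulVec, h1, Matrix.one_mulVec]
  generalize (eta (m + 1) * (frMap e f g)ᴴ * eta (m + 1)) *ᵥ v = w at h2
  have hB := mem_Sp_iff.1 (frMap_sp F)
  have a1 : qB f v = qB (f0 m) w := by
    rw [h2, ← hB (f0 m) w, frMap_f]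
  have a2 : qB e v = qB (e0 m) w := by
    rw [h2, ← hB (e0 m) w, frMap_e]
  have a3 : ∀ k, qB (g k) v = qB (g0 m k) w := by
    intro k; rw [h2, ← hB (g0 m k) w, frMap_g]
  rw [_root_.recon, a1, a2]
  simp only [a3]
  rw [← frMap_mulVec, ← h2]

/-- Expansion of a skew matrix. -/
theorem QFr.expand (F : QFr e f g) {X : QM (m + 1)} (hX : IsSk X) :
    X = (1 / 2 : ℝ) • (qR (X *ᵥ e) f + qR (X *ᵥ f) e + ∑ k, qR (X *ᵥ g k) (g k)) := by
  apply QM_ext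
  intro v
  have h1 : X *ᵥ v = rs (X *ᵥ e) (qB f v) + rs (X *ᵥ f) (qB e v) + ∑ k, rs (X *ᵥ g k) (qB (g k) v) := by
    conv_lhs => rw [← F.recon v]
    simp only [_root_.recon, Matrix.mulVec_add, Matrix.mulVec_sum, mulVec_rs]
  have h2 : X *ᵥ v = - (rs f (qB (X *ᵥ e) v) + rs e (qB (X *ᵥ f) v) + ∑ k, rs (g k) (qB (X *ᵥ g k) v)) := by
    conv_lhs => rw [← F.recon (X *ᵥ v)]
    have : ∀ a, qB a (X *ᵥ v) = - qB (X *ᵥ a) v := by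
      intro a; rw [hX a v, neg_neg]
    simp only [_root_.recon, this, rs_neg, Finset.sum_neg_distrib]; abel
  rw [smul_mulVec', Matrix.add_mulVec, Matrix.add_mulVec, Matrix.sum_mulVec]
  simp only [qR_mulVec, Finset.sum_sub_distrib]
  have : X *ᵥ v = (1 / 2 : ℝ) • (X *ᵥ v + X *ᵥ v) := by module
  rw [this]
  nth_rewrite 1 [h1]
  rw [h2]
  congr 1
  abel

end
end StdFrame
end

noncomputable section

section Alg
variable {m : ℕ} {L : Submodule ℝ (QM (m + 1))} {K : Submodule ℝ Quat} {e f : QV (m + 1)}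
    {g : Fin m → QV (m + 1)}

theorem sk_right {n : ℕ} {X : QM n} (hX : IsSk X) (a b : QV n) : qB a (X *ᵥ b) = - star (qB b (X *ᵥ a)) := by
  have := hX a b
  rw [← qB_star] at this
  rw [this, neg_neg]

theorem sk_re {n : ℕ} {X : QM n} (hX : IsSk X) (a : QV n) : (qB a (X *ᵥ a)).re = 0 := by
  have := congrArg (fun q : Quat => q.re) (sk_right hX a a)
  simp at this
  linarith

theorem rs_sum {n : ℕ} {ι : Type*} (v : QV n) (s : Finset ι) (q : ι → Quat) :
    rs v (∑ i ∈ s, q i) = ∑ i ∈ s, rs v (q i) := by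
  ext1 i; simp [rs, Finset.mul_sum]

theorem qR_sum_left {n : ℕ} {ι : Type*} (v : QV n) (s : Finset ι) (a : ι → QV n) :
    qR (∑ i ∈ s, a i) v = ∑ i ∈ s, qR (a i) v := by
  classical
  induction s using Finset.induction_on with
  | empty => simp
  | insert i s hi ih => rw [Finset.sum_insert hi, Finset.sum_insert hi, qR_add_left, ih]

theorem QGood.gj (G : QGood L K e f g) {X : QM (m + 1)} (hX : X ∈ L) (j k : Fin m) :
    qB (g j) (X *ᵥ g k) + (if j = k then star (qB f (X *ᵥ e)) else 0) ∈ K := by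
  have F := G.fr
  have h1 := G.a3 1 (by simpa using G.coe 1) k
  have h2 := G.br X hX _ h1
  rw [qR_bracket (G.sk X hX)] at h2
  have h3 := G.b4 _ h2 j
  simp only [Matrix.add_mulVec, qR_mulVec, rs_one, qB_add_right, qB_sub_right, qB_rs_right, F.ef, F.ge,
    F.gg, F.gf] at h3
  rw [qB_star]
  split_ifs at h3 ⊢ with h <;> simpa using h3

theorem QGood.ez (G : QGood L K e f g) {X : QM (m + 1)} (hX : X ∈ L) {z : Quat} (hz : z ∈ K)
    (hz' : star z = -z) : qB f (X *ᵥ e) * z + z * star (qB f (X *ᵥ e)) ∈ K := by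
  have F := G.fr
  have h1 := G.a1 z hz
  have h2 := G.br X hX _ h1
  rw [qR_bracket (G.sk X hX)] at h2
  have h3 := G.b1 _ h2
  rw [mulVec_rs] at h3
  simp only [Matrix.add_mulVec, qR_mulVec, rs_one, qB_add_right, qB_sub_right, qB_rs_right, F.ef, F.fe,
    qB_rs_left, hz'] at h3
  rw [← qB_star f (X *ᵥ e)] at h3
  have := K.smul_mem (1 / 2) h3
  convert this using 1
  generalize qB f (X *ᵥ e) = c
  simp only [one_mul, mul_one]
  rw [show c * z - -z * star c + (z * star c - c * -z) = (2 : ℝ) • (c * z + z * star c) by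
    rw [two_smul]; noncomm_ring, smul_smul]
  norm_num

theorem QGood.rgg (G : QGood L K e f g) {p q : Quat} (hp : p ∈ K) (hq : star q ∈ K) (j k : Fin m) :
    qR (rs (g j) (p * q)) (g k) - (if j = k then qR (rs f (q * p)) e else 0) ∈ L := by
  have F := G.fr
  have h1 := G.a3 p hp j
  have h2 := G.a4 _ hq k
  rw [qR_rs_left, star_star] at h2
  have h3 := G.br _ h1 _ (L.neg_mem h2)
  rw [← qR_swap, qR_bracket (qR_sk _ _)] at h3
  convert h3 using 1
  rw [mulVec_rs]
  simp only [qR_mulVec, F.ef, F.gf, qB_rs_left, F.eg, F.gg]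
  simp only [rs_one, mul_zero, rs_zero, sub_zero, zero_sub, rs_rs]
  split_ifs with h
  · simp only [mul_one]
    rw [qR_neg_right, ← qR_rs_left, rs_rs]; abel
  · simp

theorem QGood.rgg' (G : QGood L K e f g) {p : Quat} (hp : p ∈ K) {j k : Fin m} (h : j ≠ k) :
    qR (rs (g j) p) (g k) ∈ L := by
  have := G.rgg hp (q := 1) (by simpa using G.coe 1) j k
  simpa [h] using this

theorem qR_fe (e f : QV (m + 1)) (q : Quat) : qR (rs f q) e = - qR (rs e (star q)) f := by
  rw [qR_rs_left, qR_swap]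

/-- coefficients of the hyperbolic part -/
def ZZ (L : Submodule ℝ (QM (m + 1))) (e f : QV (m + 1)) : Submodule ℝ Quat where
  carrier := {q | qR (rs e q) f ∈ L}
  zero_mem' := by simp
  add_mem' := by
    intro a b ha hb
    show qR (rs e (a + b)) f ∈ L
    rw [rs_add, qR_add_left]; exact L.add_mem ha hb
  smul_mem' := by
    intro t a ha
    show qR (rs e (t • a)) f ∈ L
    rw [rs_smul, qR_smul_left]; exact L.smul_mem _ ha

theorem mem_ZZ {q : Quat} : q ∈ ZZ L e f ↔ qR (rs e q) f ∈ L := Iff.rfl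

theorem QGood.zw (G : QGood L K e f g) {z w : Quat} (hz : z ∈ K) (hz' : star z = -z) (hw : w ∈ K)
    (hw' : star w = -w) : z * w ∈ ZZ L e f := by
  have F := G.fr
  have h3 := G.br _ (G.a1 z hz) _ (G.a2 w hw)
  rw [qR_bracket (qR_sk _ _), mulVec_rs] at h3
  have := L.smul_mem (1 / 4) h3
  rw [mem_ZZ]
  convert this using 1
  simp only [qR_mulVec, qB_rs_left, F.ef, rs_one, mul_one, hz', rs_neg, sub_neg_eq_add]
  have t1 : qR (rs (rs e z + rs e z) w) f = (2 : ℝ) • qR (rs e (z * w)) f := by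
    rw [← two_smul ℝ (rs e z), smul_rs, rs_rs, qR_smul_left]
  have t2 : qR (rs f w) (rs e z + rs e z) = (2 : ℝ) • qR (rs e (z * w)) f := by
    rw [← two_smul ℝ (rs e z), qR_smul_right, qR_swap]
    have := qR_rs_left (rs e z) f (star w)
    rw [star_star] at this
    rw [← this, rs_rs, hw', mul_neg, rs_neg, qR_neg_left, neg_neg]
  rw [t1, t2]
  module

theorem QGood.one_ZZ (G : QGood L K e f g) (hm : 1 ≤ m) : (1 : Quat) ∈ ZZ L e f := by
  have := G.rgg (p := 1) (q := 1) (by simpa using G.coe 1) (by simpa using G.coe 1) ⟨0, hm⟩ ⟨0, hm⟩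
  simp only [mul_one, rs_one, qR_self, if_true, zero_sub, ← qR_swap] at this
  rw [mem_ZZ, rs_one]; exact this

theorem QGood.resid (G : QGood L K e f g) {X : QM (m + 1)} (hX : IsSk X) (h1 : qB f (X *ᵥ f) ∈ K)
    (h2 : qB e (X *ᵥ e) ∈ K) (h3 : ∀ k, qB (g k) (X *ᵥ e) ∈ K) (h4 : ∀ k, qB (g k) (X *ᵥ f) ∈ K)
    (h5 : ∀ j k, qB (g j) (X *ᵥ g k) ∈ K) (h6 : qB f (X *ᵥ e) + (1 / 2 : ℝ) • ∑ k, qB (g k) (X *ᵥ g k) ∈ ZZ L e f) :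
    X ∈ L := by
  have F := G.fr
  have c1 : qR (X *ᵥ e) f - qR (rs e (qB f (X *ᵥ e))) f ∈ L := by
    nth_rewrite 1 [← F.recon (X *ᵥ e)]
    rw [recon, qR_add_left, qR_add_left, show ∀ a b c : QM (m + 1), a + b + c - a = b + c by intros; abel]
    refine L.add_mem (G.a2 _ h2) ?_
    rw [qR_sum_left]
    exact L.sum_mem fun k _ => G.a4 _ (h3 k) k
  have c2 : qR (X *ᵥ f) e - qR (rs e (qB f (X *ᵥ e))) f ∈ L := by
    nth_rewrite 1 [← F.recon (X *ᵥ f)]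
    rw [recon, qR_add_left, qR_add_left, qR_fe e f, sk_right hX e f, star_neg, star_star, rs_neg, qR_neg_left, neg_neg]
    rw [show ∀ a b c : QM (m + 1), a + b + c - b = a + c by intros; abel]
    refine L.add_mem (G.a1 _ h1) ?_
    rw [qR_sum_left]
    exact L.sum_mem fun k _ => G.a3 _ (h4 k) k
  have c3 : ∀ k, qR (X *ᵥ g k) (g k) - qR (rs e (qB (g k) (X *ᵥ g k))) f ∈ L := by
    intro k
    have hb : star (qB (g k) (X *ᵥ g k)) = - qB (g k) (X *ᵥ g k) := by
      have := sk_right hX (g k) (g k)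
      rw [← neg_eq_iff_eq_neg] at this; exact this.symm
    have hs : qR (X *ᵥ g k) (g k) = qR (rs (g k) (qB (g k) (X *ᵥ e))) f + qR (rs (g k) (qB (g k) (X *ᵥ f))) e +
        ∑ j, qR (rs (g j) (qB (g j) (X *ᵥ g k))) (g k) := by
      nth_rewrite 1 [← F.recon (X *ᵥ g k)]
      rw [recon, qR_add_left, qR_add_left, qR_sum_left, sk_right hX f, sk_right hX e, rs_neg, rs_neg,
        qR_neg_left, qR_neg_left, qR_rs_left e, qR_rs_left f, ← qR_swap, ← qR_swap, star_star, star_star]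
      abel
    rw [hs, ← Finset.add_sum_erase _ _ (Finset.mem_univ k)]
    rw [show ∀ a b c d x : QM (m + 1), a + b + (c + d) - x = a + b + (c - x) + d by intros; abel]
    refine L.add_mem (L.add_mem (L.add_mem (G.a4 _ (h3 k) k) (G.a3 _ (h4 k) k)) ?_)
      (L.sum_mem fun j hj => G.rgg' (h5 j k) (Finset.ne_of_mem_erase hj))
    have := G.rgg (h5 k k) (q := 1) (by simpa using G.coe 1) k k
    rw [if_pos rfl, mul_one, one_mul, qR_fe e f, hb, rs_neg, qR_neg_left, neg_neg] at this
    exact this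
  have c4 := L.add_mem (L.smul_mem (1 / 2) (L.add_mem (L.add_mem c1 c2) (L.sum_mem (t := Finset.univ) fun k _ => c3 k))) (mem_ZZ.1 h6)
  convert c4 using 1
  nth_rewrite 1 [F.expand hX]
  rw [rs_add, rs_smul, qR_add_left, qR_smul_left, rs_sum, qR_sum_left, Finset.sum_sub_distrib]
  module

end Alg
end

noncomputable section

section Std
variable {m : ℕ} {L : Submodule ℝ (QM (m + 1))} {K : Submodule ℝ Quat}

theorem std_span (S : Submodule ℝ (QV (m + 1))) (he : e0 m ∈ S) (hf : f0 m ∈ S) (hg : ∀ k, g0 m k ∈ S)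
    (i : Fin (m + 2)) : (Pi.single i 1 : QV (m + 1)) ∈ S := by
  refine Fin.cases ?_ (fun i => ?_) i
  · have := S.sub_mem (S.smul_mem (1 / 2) he) hf
    convert this using 1
    rw [e0, f0]; module
  · refine Fin.cases ?_ (fun i => hg i) i
    have := S.add_mem (S.smul_mem (1 / 2) he) hf
    convert this using 1
    rw [e0, f0]
    show (Pi.single 1 1 : QV (m + 1)) = _
    module

theorem qB_right_lin {n : ℕ} (X : QM n) (K' : Submodule ℝ Quat) (a : QV n) :
    ∃ S : Submodule ℝ (QV n), ∀ b, b ∈ S ↔ qB a (X *ᵥ b) ∈ K' :=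
  ⟨{ carrier := {b | qB a (X *ᵥ b) ∈ K'}
     zero_mem' := by
       have : qB a (X *ᵥ (0 : QV n)) = 0 := by
         rw [Matrix.mulVec_zero]; simpa using qB_smul_right a a 0
       show qB a (X *ᵥ 0) ∈ K'
       rw [this]; exact K'.zero_mem
     add_mem' := by
       intro b c hb hc
       show qB a (X *ᵥ (b + c)) ∈ K'
       rw [Matrix.mulVec_add, qB_add_right]; exact K'.add_mem hb hc
     smul_mem' := by
       intro t b hb
       show qB a (X *ᵥ (t • b)) ∈ K'
       rw [mulVec_smul', qB_smul_right]; exact K'.smul_mem _ hb }, fun _ => Iff.rfl⟩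

theorem qB_left_lin {n : ℕ} (K' : Submodule ℝ Quat) (b : QV n) :
    ∃ S : Submodule ℝ (QV n), ∀ a, a ∈ S ↔ qB a b ∈ K' :=
  ⟨{ carrier := {a | qB a b ∈ K'}
     zero_mem' := by
       have : qB (0 : QV n) b = 0 := by simpa using qB_smul_left b b 0
       show qB 0 b ∈ K'
       rw [this]; exact K'.zero_mem
     add_mem' := by
       intro a c hb hc
       show qB (a + c) b ∈ K'
       rw [qB_add_left]; exact K'.add_mem hb hc
     smul_mem' := by
       intro t a hb
       show qB (t • a) b ∈ K'
       rw [qB_smul_left]; exact K'.smul_mem _ hb }, fun _ => Iff.rfl⟩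

theorem entry_eq {n : ℕ} (X : QM n) (i j : Fin (n + 1)) :
    X i j = sg i • qB (Pi.single i 1) (X *ᵥ Pi.single j 1) := by
  rw [qB_single, smul_smul, sg_sq, one_smul]; simp

theorem entries_of {X : QM (m + 1)} (h : ∀ a b : QV (m + 1), (a = e0 m ∨ a = f0 m ∨ ∃ k, a = g0 m k) →
    (b = e0 m ∨ b = f0 m ∨ ∃ k, b = g0 m k) → qB a (X *ᵥ b) ∈ K) (i j) : X i j ∈ K := by
  rw [entry_eq X i j]
  apply K.smul_mem
  have h1 : ∀ a : QV (m + 1), (a = e0 m ∨ a = f0 m ∨ ∃ k, a = g0 m k) → qB a (X *ᵥ Pi.single j 1) ∈ K := by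
    intro a ha
    obtain ⟨S, hS⟩ := qB_right_lin X K a
    rw [← hS]
    exact std_span S ((hS _).2 (h _ _ ha (by simp))) ((hS _).2 (h _ _ ha (by simp)))
      (fun k => (hS _).2 (h _ _ ha (Or.inr (Or.inr ⟨k, rfl⟩)))) j
  obtain ⟨S, hS⟩ := qB_left_lin K (X *ᵥ Pi.single j 1)
  rw [← hS]
  exact std_span S ((hS _).2 (h1 _ (by simp))) ((hS _).2 (h1 _ (by simp)))
      (fun k => (hS _).2 (h1 _ (Or.inr (Or.inr ⟨k, rfl⟩)))) i

theorem of_entries {X : QM (m + 1)} (h : ∀ i j, X i j ∈ K) (a b : QV (m + 1))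
    (ha : a = e0 m ∨ a = f0 m ∨ ∃ k, a = g0 m k) (hb : b = e0 m ∨ b = f0 m ∨ ∃ k, b = g0 m k) :
    qB a (X *ᵥ b) ∈ K := by
  have h0 : ∀ i j, qB (Pi.single i 1) (X *ᵥ Pi.single j 1) ∈ K := by
    intro i j
    rw [qB_single]
    apply K.smul_mem
    simpa using h i j
  have key : ∀ S : Submodule ℝ (QV (m + 1)), (∀ i, (Pi.single i 1 : QV (m + 1)) ∈ S) →
      ∀ b : QV (m + 1), (b = e0 m ∨ b = f0 m ∨ ∃ k, b = g0 m k) → b ∈ S := by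
    rintro S hS b (rfl | rfl | ⟨k, rfl⟩)
    · exact S.add_mem (hS _) (hS _)
    · exact S.smul_mem _ (S.sub_mem (hS _) (hS _))
    · exact hS _
  have h1 : ∀ i, qB (Pi.single i 1) (X *ᵥ b) ∈ K := by
    intro i
    obtain ⟨S, hS⟩ := qB_right_lin X K (Pi.single i 1)
    rw [← hS]
    exact key S (fun j => (hS _).2 (h0 i j)) b hb
  obtain ⟨S, hS⟩ := qB_left_lin K (X *ᵥ b)
  rw [← hS]
  exact key S (fun j => (hS _).2 (h1 j)) a ha

theorem std_trace (X : QM (m + 1)) : ∑ i, X i i =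
    qB (e0 m) (X *ᵥ f0 m) + qB (f0 m) (X *ᵥ e0 m) + ∑ k, qB (g0 m k) (X *ᵥ g0 m k) := by
  rw [Fin.sum_univ_succ, Fin.sum_univ_succ]
  have h : ∀ k, qB (g0 m k) (X *ᵥ g0 m k) = X k.succ.succ k.succ.succ := by
    intro k; rw [qB_g0]; simp [g0]
  simp only [h]
  rw [← add_assoc]
  congr 1
  rw [qB_e0, qB_f0, f0, e0, mulVec_smul', Matrix.mulVec_sub, Matrix.mulVec_add]
  simp
  show X 0 0 + X 1 1 = _
  module

/-- scalar matrices -/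
theorem scal_mulVec {n : ℕ} (u : Quat) (v : QV n) : (u • (1 : QM n)) *ᵥ v = fun i => u * v i := by
  rw [Matrix.smul_mulVec, Matrix.one_mulVec]; rfl

theorem scal_mulVec_real {n : ℕ} (u : Quat) (v : QV n) (hv : ∀ i, ∃ t : ℝ, v i = (t : Quat)) :
    (u • (1 : QM n)) *ᵥ v = rs v u := by
  rw [scal_mulVec]; ext1 i
  obtain ⟨t, ht⟩ := hv i
  rw [rs_apply, ht, Quaternion.mul_coe_eq_smul, Quaternion.coe_mul_eq_smul]

theorem std_real (b : QV (m + 1)) (hb : b = e0 m ∨ b = f0 m ∨ ∃ k, b = g0 m k) (i) :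
    ∃ t : ℝ, b i = (t : Quat) := by
  have : ∀ j i, ∃ t : ℝ, (Pi.single j 1 : QV (m + 1)) i = (t : Quat) := by
    intro j i
    rw [Pi.single_apply]; split_ifs
    · exact ⟨1, by simp⟩
    · exact ⟨0, by simp⟩
  obtain ⟨s, hs⟩ := this 0 i
  obtain ⟨t, ht⟩ := this 1 i
  rcases hb with (rfl | rfl | ⟨k, rfl⟩)
  · exact ⟨t + s, by simp [e0, hs, ht]⟩
  · refine ⟨(1 / 2) * (t - s), ?_⟩
    rw [f0, Pi.smul_apply, Pi.sub_apply, hs, ht, ← Quaternion.coe_sub, ← Quaternion.coe_mul_eq_smul,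
      ← Quaternion.coe_mul]
  · exact this _ i

theorem QGood.KR_upper (G : QGood L KR (e0 m) (f0 m) (g0 m)) {X : QM (m + 1)} (hX : X ∈ L) :
    ∃ u : Quat, u.re = 0 ∧ ∀ i j, (X - u • (1 : QM (m + 1))) i j ∈ KR := by
  have F := G.fr
  have hs := G.sk X hX
  obtain ⟨c, hc⟩ : ∃ c, c = qB (f0 m) (X *ᵥ e0 m) := ⟨_, rfl⟩
  refine ⟨c.im, by simp, entries_of ?_⟩
  have st : ∀ q ∈ KR, star q ∈ KR := by
    intro q hq; rw [mem_KR] at *; simpa using hq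
  have k1 : ∀ a b : QV (m + 1), (b = e0 m ∨ b = f0 m ∨ ∃ k, b = g0 m k) →
      qB a ((X - c.im • (1 : QM (m + 1))) *ᵥ b) = qB a (X *ᵥ b) - qB a b * c.im := by
    intro a b hb
    rw [Matrix.sub_mulVec, scal_mulVec_real _ _ (std_real b hb), qB_sub_right, qB_rs_right]
  intro a b ha hb
  rw [k1 a b hb]
  rcases ha with (rfl | rfl | ⟨j, rfl⟩) <;> rcases hb with (rfl | rfl | ⟨k, rfl⟩)
  · simpa [F.ee] using G.b2 X hX
  · rw [sk_right hs, ← hc, F.ef]; simp [mem_KR]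
  · rw [sk_right hs, F.eg]; simpa using st _ (G.b3 X hX k)
  · rw [F.fe, ← hc]; simp [mem_KR]
  · simpa [F.ff] using G.b1 X hX
  · rw [sk_right hs, F.fg]; simpa using st _ (G.b4 X hX k)
  · simpa [F.ge] using G.b3 X hX j
  · simpa [F.gf] using G.b4 X hX j
  · have := G.gj hX j k
    rw [F.gg, ← hc] at *
    split_ifs at * with h
    · rw [mem_KR] at *
      simp at this ⊢
      obtain ⟨h1, h2, h3⟩ := this
      refine ⟨?_, ?_, ?_⟩ <;> linarith
    · simpa using this

theorem QGood.KR_lower (G : QGood L KR (e0 m) (f0 m) (g0 m)) (hm : 1 ≤ m) {X : QM (m + 1)} (hX : IsSk X)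
    (h : ∀ i j, X i j ∈ KR) : X ∈ L := by
  have h' := of_entries h
  refine G.resid hX (h' _ _ (by simp) (by simp)) (h' _ _ (by simp) (by simp)) (fun k => h' _ _ (by simp) (by simp))
    (fun k => h' _ _ (by simp) (by simp)) (fun j k => h' _ _ (by simp) (by simp)) ?_
  have h1 : qB (f0 m) (X *ᵥ e0 m) + (1 / 2 : ℝ) • ∑ k, qB (g0 m k) (X *ᵥ g0 m k) ∈ KR :=
    KR.add_mem (h' _ _ (by simp) (by simp)) (KR.smul_mem _ (KR.sum_mem fun k _ => h' _ _ (by simp) (by simp)))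
  generalize qB (f0 m) (X *ᵥ e0 m) + (1 / 2 : ℝ) • ∑ k, qB (g0 m k) (X *ᵥ g0 m k) = q at *
  obtain ⟨a1, a2, a3⟩ := mem_KR.1 h1
  have : q = q.re • (1 : Quat) := by ext <;> simp [*]
  rw [this]
  exact Submodule.smul_mem _ _ (G.one_ZZ hm)

theorem im_star {q : Quat} (h : q.re = 0) : star q = - q := by ext <;> simp [h]

theorem QGood.KC_c {e f : QV (m + 1)} {g : Fin m → QV (m + 1)} (G : QGood L KC e f g) {X : QM (m + 1)} (hX : X ∈ L) :
    qB f (X *ᵥ e) ∈ KC := by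
  have := G.ez hX (z := qi) (by simp [mem_KC]) (im_star rfl)
  rw [mem_KC] at *
  simp at this
  constructor <;> linarith [this.1, this.2]

theorem QGood.KC_upper (G : QGood L KC (e0 m) (f0 m) (g0 m)) {X : QM (m + 1)} (hX : X ∈ L) (i j) :
    X i j ∈ KC := by
  have F := G.fr
  have hs := G.sk X hX
  have hc := G.KC_c hX
  revert i j
  refine entries_of ?_
  have st : ∀ q ∈ KC, -star q ∈ KC := by
    intro q hq; rw [mem_KC] at *; simpa using hq
  intro a b ha hb
  rcases ha with (rfl | rfl | ⟨j, rfl⟩) <;> rcases hb with (rfl | rfl | ⟨k, rfl⟩)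
  · exact G.b2 X hX
  · rw [sk_right hs]; exact st _ hc
  · rw [sk_right hs]; exact st _ (G.b3 X hX k)
  · exact hc
  · exact G.b1 X hX
  · rw [sk_right hs]; exact st _ (G.b4 X hX k)
  · exact G.b3 X hX j
  · exact G.b4 X hX j
  · have := G.gj hX j k
    split_ifs at this with h
    · have := KC.add_mem this (st _ hc)
      simpa using this
    · simpa using this

theorem QGood.KC_lower (G : QGood L KC (e0 m) (f0 m) (g0 m)) {X : QM (m + 1)} (hX : IsSk X)
    (h : ∀ i j, X i j ∈ KC) (ht : (∑ i, X i i).imI = 0) : X ∈ L := by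
  have h' := of_entries h
  refine G.resid hX (h' _ _ (by simp) (by simp)) (h' _ _ (by simp) (by simp)) (fun k => h' _ _ (by simp) (by simp))
    (fun k => h' _ _ (by simp) (by simp)) (fun j k => h' _ _ (by simp) (by simp)) ?_
  have h1 : qB (f0 m) (X *ᵥ e0 m) + (1 / 2 : ℝ) • ∑ k, qB (g0 m k) (X *ᵥ g0 m k) ∈ KC :=
    KC.add_mem (h' _ _ (by simp) (by simp)) (KC.smul_mem _ (KC.sum_mem fun k _ => h' _ _ (by simp) (by simp)))
  rw [std_trace, sk_right hX] at ht
  generalize ∑ k, qB (g0 m k) (X *ᵥ g0 m k) = s at *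
  generalize qB (f0 m) (X *ᵥ e0 m) = c at *
  obtain ⟨a1, a2⟩ := mem_KC.1 h1
  simp at ht a1 a2
  have : c + (1 / 2 : ℝ) • s = (-(c + (1 / 2 : ℝ) • s).re) • (qi * qi) := by
    ext <;> simp [*] <;> linarith
  rw [this]
  exact Submodule.smul_mem _ _ (G.zw (by simp [mem_KC]) (im_star rfl) (by simp [mem_KC]) (im_star rfl))

theorem QGood.top_lower {e f : QV (m + 1)} {g : Fin m → QV (m + 1)} (G : QGood L ⊤ e f g) {X : QM (m + 1)} (hX : IsSk X) : X ∈ L := by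
  refine G.resid hX trivial trivial (fun _ => trivial) (fun _ => trivial) (fun _ _ => trivial) ?_
  generalize qB f (X *ᵥ e) + (1 / 2 : ℝ) • ∑ k, qB (g k) (X *ᵥ g k) = q
  have : q = (-q.re) • (qi * qi) + q.imI • (qj * qk) + q.imJ • (qk * qi) + q.imK • (qi * qj) := by
    ext <;> simp
  rw [this]
  have hi := im_star qi_re
  have hj := im_star qj_re
  have hk := im_star qk_re
  exact Submodule.add_mem _ (Submodule.add_mem _ (Submodule.add_mem _
    (Submodule.smul_mem _ _ (G.zw trivial hi trivial hi)) (Submodule.smul_mem _ _ (G.zw trivial hj trivial hk)))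
    (Submodule.smul_mem _ _ (G.zw trivial hk trivial hi))) (Submodule.smul_mem _ _ (G.zw trivial hi trivial hj))

theorem QGood.KS_upper {e f : QV (m + 1)} {g : Fin m → QV (m + 1)} (G : QGood L KS e f g) {X : QM (m + 1)} (hX : X ∈ L) :
    qB f (X *ᵥ e) ∈ KC := by
  have h1 := G.ez hX (z := qj) (by simp [mem_KS]) (im_star rfl)
  have h2 := G.ez hX (z := qk) (by simp [mem_KS]) (im_star rfl)
  rw [mem_KC]
  rw [mem_KS] at h1 h2
  simp at h1 h2
  constructor <;> linarith

theorem QGood.KS_lower {L : Submodule ℝ (QM (0 + 1))} {e f : QV (0 + 1)} {g : Fin 0 → QV (0 + 1)} (G : QGood L KS e f g) {X : QM (0 + 1)} (hX : IsSk X)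
    (h1 : qB f (X *ᵥ f) ∈ KS) (h2 : qB e (X *ᵥ e) ∈ KS) (h3 : qB f (X *ᵥ e) ∈ KC) : X ∈ L := by
  refine G.resid hX h1 h2 (fun k => k.elim0) (fun k => k.elim0) (fun k => k.elim0) ?_
  simp only [Finset.univ_eq_empty, Finset.sum_empty, smul_zero, add_zero]
  generalize qB f (X *ᵥ e) = q at *
  obtain ⟨a1, a2⟩ := mem_KC.1 h3
  have : q = (-q.re) • (qj * qj) + q.imI • (qj * qk) := by
    ext <;> simp [*]
  rw [this]
  have hj := im_star qj_re
  have hk := im_star qk_re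
  exact Submodule.add_mem _ (Submodule.smul_mem _ _ (G.zw (by simp [mem_KS]) hj (by simp [mem_KS]) hj))
    (Submodule.smul_mem _ _ (G.zw (by simp [mem_KS]) hj (by simp [mem_KS]) hk))

end Std
end

noncomputable section

section Conj
variable {n : ℕ}

/-- conjugated set -/
def cj (P P' : QM n) (H : Set (QM n)) : Set (QM n) := (fun A => P * A * P') '' H

/-- the conclusion -/
def Concl (n : ℕ) (H : Set (QM n)) : Prop :=
    ∃ P ∈ Sp n, ∃ Pinv : Matrix (Fin (n + 1)) (Fin (n + 1)) Quat,
      P * Pinv = 1 ∧ Pinv * P = 1 ∧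
      ((2 ≤ n ∧ ((fun A => P * A * Pinv) '' H = SOo n ∨
                 (fun A => P * A * Pinv) '' H = SOo n * U1One n ∨
                 (fun A => P * A * Pinv) '' H = SOo n * Sp1One n)) ∨
       (fun A => P * A * Pinv) '' H = SUgrp n ∨
       (fun A => P * A * Pinv) '' H = Ugrp n ∨
       (fun A => P * A * Pinv) '' H = Sp n ∨
       (n = 1 ∧ (fun A => P * A * Pinv) '' H = U0grp n))

theorem Concl_of_conj {P P' : QM n} {H : Set (QM n)} (hP : P ∈ Sp n) (h1 : P * P' = 1) (h2 : P' * P = 1)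
    (h : Concl n (cj P P' H)) : Concl n H := by
  obtain ⟨Q, hQ, Q', q1, q2, h⟩ := h
  have e : (fun A => Q * A * Q') '' (cj P P' H) = (fun A => (Q * P) * A * (P' * Q')) '' H := by
    rw [cj, Set.image_image]
    congr 1
    funext A
    simp only [Matrix.mul_assoc]
  rw [e] at h
  refine ⟨Q * P, Sp_mul hQ hP, P' * Q', ?_, ?_, h⟩
  · rw [Matrix.mul_assoc, ← Matrix.mul_assoc P, h1, Matrix.one_mul, q1]
  · rw [Matrix.mul_assoc, ← Matrix.mul_assoc Q', q2, Matrix.one_mul, h2]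

theorem Concl_of_eq {H : Set (QM n)} (h : (2 ≤ n ∧ (H = SOo n ∨ H = SOo n * U1One n ∨ H = SOo n * Sp1One n)) ∨
       H = SUgrp n ∨ H = Ugrp n ∨ H = Sp n ∨ (n = 1 ∧ H = U0grp n)) : Concl n H := by
  refine ⟨1, Sp_one, 1, by simp, by simp, ?_⟩
  have : (fun A : QM n => 1 * A * 1) '' H = H := by simp
  rw [this]
  exact h

variable {P P' : QM n} {H : Set (QM n)}

theorem mem_cj (h1 : P * P' = 1) (h2 : P' * P = 1) {A : QM n} : A ∈ cj P P' H ↔ P' * A * P ∈ H := by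
  constructor
  · rintro ⟨B, hB, rfl⟩
    have : P' * (P * B * P') * P = B := by
      rw [← Matrix.mul_assoc, ← Matrix.mul_assoc, h2, Matrix.one_mul, Matrix.mul_assoc, h2, Matrix.mul_one]
    rwa [this]
  · intro h
    refine ⟨_, h, ?_⟩
    show P * (P' * A * P) * P' = A
    rw [← Matrix.mul_assoc, ← Matrix.mul_assoc, h1, Matrix.one_mul, Matrix.mul_assoc, h1, Matrix.mul_one]

theorem cj_clsub (hH : MClSub H) (h1 : P * P' = 1) (h2 : P' * P = 1) : MClSub (cj P P' H) := by
  have key : ∀ A B : QM n, P' * (A * B) * P = (P' * A * P) * (P' * B * P) := by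
    intro A B
    simp only [Matrix.mul_assoc]
    rw [← Matrix.mul_assoc P P', h1, Matrix.one_mul]
  have k1 : P' * 1 * P = 1 := by rw [Matrix.mul_one, h2]
  refine MClSub.mk' ?_ ?_ ?_ ?_
  · rw [mem_cj h1 h2, k1]; exact hH.one
  · intro A hA B hB
    rw [mem_cj h1 h2] at *
    rw [key]; exact hH.mul _ hA _ hB
  · rintro _ ⟨A, hA, rfl⟩
    obtain ⟨B, hB, e1, e2⟩ := hH.inv A hA
    refine ⟨P * B * P', ⟨B, hB, rfl⟩, ?_, ?_⟩
    · show P * A * P' * (P * B * P') = 1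
      simp only [Matrix.mul_assoc]
      rw [← Matrix.mul_assoc P' P, h2, Matrix.one_mul, ← Matrix.mul_assoc A B, e1, Matrix.one_mul, h1]
    · show P * B * P' * (P * A * P') = 1
      simp only [Matrix.mul_assoc]
      rw [← Matrix.mul_assoc P' P, h2, Matrix.one_mul, ← Matrix.mul_assoc B A, e2, Matrix.one_mul, h1]
  · have : cj P P' H = (fun A => P' * A * P) ⁻¹' H := by
      ext A; exact mem_cj h1 h2
    rw [this]
    exact hH.closed.preimage ((continuous_const.matrix_mul continuous_id).matrix_mul continuous_const)

theorem mem_mlie_cj (hH : MClSub H) (h1 : P * P' = 1) (h2 : P' * P = 1) {X : QM n} :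
    X ∈ mlie (cj_clsub hH h1 h2) ↔ P' * X * P ∈ mlie hH := by
  rw [mem_mlie, mem_mlie]
  refine forall_congr' fun t => ?_
  rw [mem_cj h1 h2, ← mexp_conj h2 h1]
  simp

theorem cj_sub (hs : H ⊆ Sp n) (hP : P ∈ Sp n) (h1 : P * P' = 1) : cj P P' H ⊆ Sp n := by
  rintro _ ⟨A, hA, rfl⟩
  exact Sp_mul (Sp_mul hP (hs hA)) (Sp_of_inv hP h1)

theorem cj_conn (hC : IsPreconnected H) : IsPreconnected (cj P P' H) :=
  hC.image _ ((continuous_const.matrix_mul continuous_id).matrix_mul continuous_const).continuousOn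

theorem QGood.conj {m : ℕ} {L L' : Submodule ℝ (QM (m + 1))} {K : Submodule ℝ Quat} {e f : QV (m + 1)}
    {g : Fin m → QV (m + 1)} (G : QGood L K e f g) {P P' : QM (m + 1)} (hP : P ∈ Sp (m + 1))
    (h1 : P * P' = 1) (h2 : P' * P = 1) (hL : ∀ X, X ∈ L' ↔ P' * X * P ∈ L) :
    QGood L' K (P *ᵥ e) (P *ᵥ f) (fun k => P *ᵥ g k) := by
  have hB := mem_Sp_iff.1 hP
  have hP' := Sp_of_inv hP h1
  have kR : ∀ (a b : QV (m + 1)) (q : Quat), qR (rs a q) b ∈ L → qR (rs (P *ᵥ a) q) (P *ᵥ b) ∈ L' := by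
    intro a b q h
    rw [hL, qR_conj hP' h2, mulVec_rs, Matrix.mulVec_mulVec, Matrix.mulVec_mulVec, h2]
    simpa using h
  have kB : ∀ (a b : QV (m + 1)) (X : QM (m + 1)), qB (P *ᵥ a) (X *ᵥ (P *ᵥ b)) = qB a ((P' * X * P) *ᵥ b) := by
    intro a b X
    rw [Sp_inv_adj hP h1, Matrix.mulVec_mulVec, Matrix.mulVec_mulVec, Matrix.mul_assoc]
  have hX' : ∀ X : QM (m + 1), X = P * (P' * X * P) * P' := by
    intro A
    rw [← Matrix.mul_assoc, ← Matrix.mul_assoc, h1, Matrix.one_mul, Matrix.mul_assoc, h1, Matrix.mul_one]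
  refine ⟨?_, ?_, ?_, ?_, ?_, ?_, ?_, ?_, G.coe, ?_, ?_, ?_, ?_, ?_, ?_, ?_, ?_⟩
  · rw [hB, G.ee]
  · rw [hB, G.ff]
  · rw [hB, G.ef]
  · intro k; rw [hB, G.eg]
  · intro k; rw [hB, G.fg]
  · intro i j; rw [hB, G.gg]
  · intro X hX v w
    have hs := G.sk _ ((hL X).1 hX)
    have e1 : ∀ x : QV (m + 1), P' *ᵥ (X *ᵥ x) = (P' * X * P) *ᵥ (P' *ᵥ x) := by
      intro x
      rw [Matrix.mulVec_mulVec, Matrix.mulVec_mulVec, Matrix.mul_assoc _ P, h1, Matrix.mul_one]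
    rw [← (mem_Sp_iff.1 hP') (X *ᵥ v) w, ← (mem_Sp_iff.1 hP') v (X *ᵥ w), e1, e1, hs]
  · intro X hX Y hY
    have := G.br _ ((hL X).1 hX) _ ((hL Y).1 hY)
    rw [hL]
    convert this using 1
    simp only [Matrix.mul_sub, Matrix.sub_mul, Matrix.mul_assoc]
    rw [← Matrix.mul_assoc P P', h1, Matrix.one_mul, ← Matrix.mul_assoc P P', h1, Matrix.one_mul]
  · intro q hq; exact kR _ _ _ (G.a1 q hq)
  · intro q hq; exact kR _ _ _ (G.a2 q hq)
  · intro q hq k; exact kR _ _ _ (G.a3 q hq k)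
  · intro q hq k; exact kR _ _ _ (G.a4 q hq k)
  · intro X hX; rw [kB]; exact G.b1 _ ((hL X).1 hX)
  · intro X hX; rw [kB]; exact G.b2 _ ((hL X).1 hX)
  · intro X hX k; rw [kB]; exact G.b3 _ ((hL X).1 hX) k
  · intro X hX k; rw [kB]; exact G.b4 _ ((hL X).1 hX) k

/-- move a good frame into any other frame -/
theorem QGood.move {m : ℕ} {H : Set (QM (m + 1))} (hH : MClSub H) {K : Submodule ℝ Quat} {e f : QV (m + 1)}
    {g : Fin m → QV (m + 1)} (G : QGood (mlie hH) K e f g) {e' f' : QV (m + 1)}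
    {g' : Fin m → QV (m + 1)} (F' : QFr e' f' g') :
    ∃ P P' : QM (m + 1), P ∈ Sp (m + 1) ∧ ∃ (h1 : P * P' = 1) (h2 : P' * P = 1),
      QGood (mlie (cj_clsub hH h1 h2)) K e' f' g' := by
  obtain ⟨T, hT, T', t1, t2, te, tf, tg⟩ : ∃ T ∈ Sp (m + 1), ∃ T' : QM (m + 1), T * T' = 1 ∧ T' * T = 1 ∧
      T *ᵥ e0 m = e ∧ T *ᵥ f0 m = f ∧ ∀ k, T *ᵥ g0 m k = g k :=
    ⟨frMap e f g, frMap_sp G.fr, _, Sp_inv_right (frMap_sp G.fr), Sp_inv_left (frMap_sp G.fr), frMap_e _ _ _,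
      frMap_f _ _ _, frMap_g _ _ _⟩
  obtain ⟨S, hS, S', s1, s2, se, sf, sgk⟩ : ∃ T ∈ Sp (m + 1), ∃ T' : QM (m + 1), T * T' = 1 ∧ T' * T = 1 ∧
      T *ᵥ e0 m = e' ∧ T *ᵥ f0 m = f' ∧ ∀ k, T *ᵥ g0 m k = g' k :=
    ⟨frMap e' f' g', frMap_sp F', _, Sp_inv_right (frMap_sp F'), Sp_inv_left (frMap_sp F'), frMap_e _ _ _,
      frMap_f _ _ _, frMap_g _ _ _⟩
  have hP : S * T' ∈ Sp (m + 1) := Sp_mul hS (Sp_of_inv hT t1)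
  have h1 : (S * T') * (T * S') = 1 := by
    rw [Matrix.mul_assoc, ← Matrix.mul_assoc T', t2, Matrix.one_mul, s1]
  have h2 : (T * S') * (S * T') = 1 := by
    rw [Matrix.mul_assoc, ← Matrix.mul_assoc S', s2, Matrix.one_mul, t1]
  refine ⟨S * T', T * S', hP, h1, h2, ?_⟩
  have := G.conj hP h1 h2 (fun X => mem_mlie_cj hH h1 h2)
  have k : ∀ a : QV (m + 1), (S * T') *ᵥ (T *ᵥ a) = S *ᵥ a := by
    intro a; rw [Matrix.mulVec_mulVec, Matrix.mul_assoc, t2, Matrix.mul_one]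
  have e1 : (S * T') *ᵥ e = e' := by rw [← te, k, se]
  have e2 : (S * T') *ᵥ f = f' := by rw [← tf, k, sf]
  have e3 : (fun k => (S * T') *ᵥ g k) = g' := by
    funext j; rw [← tg, k, sgk]
  rwa [e1, e2, e3] at this

end Conj
end

noncomputable section

section Gen
variable {n : ℕ}

theorem mexp_Sp {X : QM n} (hX : IsSk X) : mexp X ∈ Sp n := by
  rw [isSk_iff] at hX
  have e1 : Xᴴ = eta n * (-X) * eta n := by
    have : Xᴴ * eta n = - (eta n * X) := eq_neg_of_add_eq_zero_left hX
    calc Xᴴ = Xᴴ * eta n * eta n := by rw [Matrix.mul_assoc, eta_sq, Matrix.mul_one]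
      _ = _ := by rw [this]; simp
  show (mexp X)ᴴ * eta n * mexp X = eta n
  rw [← mexp_conjTranspose, e1, mexp_conj eta_sq eta_sq, Matrix.mul_assoc (eta n * mexp (-X)) (eta n) (eta n), eta_sq,
    Matrix.mul_one, Matrix.mul_assoc, mexp_neg_mul, Matrix.mul_one]

theorem qP_add_left (a b c : QV n) : qP (a + b) c = qP a c + qP b c := by
  refine QM_ext fun v => ?_
  simp only [Matrix.add_mulVec, qP_mulVec, add_rs]
theorem qP_smul_left (t : ℝ) (a c : QV n) : qP (t • a) c = t • qP a c := by
  refine QM_ext fun v => ?_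
  rw [smul_mulVec', qP_mulVec, qP_mulVec, smul_rs]

theorem qP_sk (u : QV n) {s : Quat} (hs : s.re = 0) : IsSk (qP (rs u s) u) := by
  intro v w
  rw [qP_mulVec, qP_mulVec, qB_rs_left, qB_rs_left, qB_rs_right, qB_rs_right, im_star hs, qB_star]
  noncomm_ring

theorem qlog (K : Submodule ℝ Quat) (h1 : (1 : Quat) ∈ K) (hi : qi ∈ K) {l : Quat} (hl : l ∈ K) (hn : ‖l‖ = 1) :
    ∃ s ∈ K, s.re = 0 ∧ NormedSpace.exp s = l := by
  have hsq : l.re ^ 2 + (l.imI ^ 2 + l.imJ ^ 2 + l.imK ^ 2) = 1 := by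
    have := Quaternion.normSq_eq_norm_mul_self l
    rw [hn, Quaternion.normSq_def'] at this; linarith
  have him : l.im ∈ K := by
    have := K.sub_mem hl (K.smul_mem l.re h1)
    rwa [show l - l.re • (1 : Quat) = l.im by ext <;> simp] at this
  have hnim : ‖l.im‖ ^ 2 = l.imI ^ 2 + l.imJ ^ 2 + l.imK ^ 2 := by
    have := Quaternion.normSq_eq_norm_mul_self l.im
    rw [Quaternion.normSq_def'] at this; simp at this; linarith
  by_cases h0 : ‖l.im‖ = 0
  · have h0' : l.im = 0 := by simpa using h0
    have hl' : l = (l.re : Quat) := by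
      conv_lhs => rw [← Quaternion.re_add_im l]
      rw [h0', add_zero]
    have hre : l.re = 1 ∨ l.re = -1 := by
      rw [h0] at hnim
      have : (l.re - 1) * (l.re + 1) = 0 := by nlinarith
      rcases mul_eq_zero.1 this with h | h
      · left; linarith
      · right; linarith
    rcases hre with h | h
    · refine ⟨0, K.zero_mem, rfl, ?_⟩
      rw [hl', h]; simp
    · refine ⟨Real.pi • qi, K.smul_mem _ hi, by simp, ?_⟩
      have hq : ‖Real.pi • qi‖ = Real.pi := by
        have : ‖qi‖ = 1 := by
          have := Quaternion.normSq_eq_norm_mul_self qi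
          rw [Quaternion.normSq_def'] at this; simp at this
          nlinarith [norm_nonneg qi]
        rw [norm_smul, this, mul_one, Real.norm_of_nonneg Real.pi_pos.le]
      rw [Quaternion.exp_of_re_eq_zero _ (by simp), hq, hl', h]
      simp
  · have hp : 0 < ‖l.im‖ := lt_of_le_of_ne (norm_nonneg _) (Ne.symm h0)
    refine ⟨(Real.arccos l.re / ‖l.im‖) • l.im, K.smul_mem _ him, by simp, ?_⟩
    have ha := Real.arccos_nonneg l.re
    have hsin : Real.sin (Real.arccos l.re) = ‖l.im‖ := by
      rw [Real.sin_arccos, Real.sqrt_eq_iff_mul_self_eq_of_pos hp]; nlinarith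
    have ha0 : Real.arccos l.re ≠ 0 := by
      intro h; rw [h, Real.sin_zero] at hsin; exact h0 hsin.symm
    have hnorm : ‖(Real.arccos l.re / ‖l.im‖) • l.im‖ = Real.arccos l.re := by
      rw [norm_smul, norm_div, norm_norm, Real.norm_of_nonneg ha, div_mul_cancel₀ _ h0]
    rw [Quaternion.exp_of_re_eq_zero _ (by simp), hnorm, hsin, Real.cos_arccos (by nlinarith) (by nlinarith), smul_smul]
    have : ‖l.im‖ / Real.arccos l.re * (Real.arccos l.re / ‖l.im‖) = 1 := by field_simp
    rw [this, one_smul, Quaternion.re_add_im]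

/-- the algebra map attached to an anisotropic vector -/
def tauHom (u : QV n) (β : ℝ) (hβ : β ≠ 0) (hu : qB u u = (β : Quat)) : (Quat × ℝ) →ₐ[ℝ] QM n :=
  AlgHom.ofLinearMap
    { toFun := fun p => p.2 • (1 : QM n) + qP (rs u (β⁻¹ • (p.1 - (p.2 : Quat)))) u
      map_add' := by
        intro p q
        simp only [Prod.fst_add, Prod.snd_add, add_smul, Quaternion.coe_add]
        rw [show p.1 + q.1 - (p.2 + q.2 : Quat) = (p.1 - p.2) + (q.1 - q.2) by abel, smul_add, rs_add,
          qP_add_left]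
        abel
      map_smul' := by
        intro t p
        simp only [Prod.smul_fst, Prod.smul_snd, smul_eq_mul, RingHom.id_apply]
        rw [Quaternion.coe_mul, Quaternion.coe_mul_eq_smul, ← smul_sub, smul_comm, rs_smul, qP_smul_left, smul_add,
          smul_smul] }
    (by simp [qP_zero])
    (by
      rintro ⟨q, t⟩ ⟨q', t'⟩
      refine QM_ext fun v => ?_
      simp only [LinearMap.coe_mk, AddHom.coe_mk, Prod.mk_mul_mk, ← Matrix.mulVec_mulVec, Matrix.add_mulVec,
        smul_mulVec', Matrix.one_mulVec, qP_mulVec, qB_add_right, qB_smul_right, qB_rs_right, hu, rs_rs]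
      generalize qB u v = x
      simp only [smul_add, smul_smul, ← rs_smul, add_assoc, ← rs_add]
      congr 2
      simp only [Quaternion.coe_mul, Quaternion.coe_mul_eq_smul, smul_mul_assoc, mul_smul_comm, smul_smul]
      rw [inv_mul_cancel₀ hβ, one_smul]
      ext <;> simp <;> ring)

theorem tauHom_apply (u : QV n) (β : ℝ) (hβ : β ≠ 0) (hu : qB u u = (β : Quat)) (q : Quat) (t : ℝ) :
    tauHom u β hβ hu (q, t) = t • (1 : QM n) + qP (rs u (β⁻¹ • (q - (t : Quat)))) u := rfl

/-- closure conditions on a subspace of the quaternions -/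
structure KAlg (K : Submodule ℝ Quat) : Prop where
  one : (1 : Quat) ∈ K
  i : qi ∈ K
  mul : ∀ p ∈ K, ∀ q ∈ K, p * q ∈ K
  st : ∀ p ∈ K, star p ∈ K

theorem KAlg.inv {K : Submodule ℝ Quat} (h : KAlg K) {p : Quat} (hp : p ∈ K) : p⁻¹ ∈ K := by
  rw [Quaternion.instInv]
  exact K.smul_mem _ (h.st p hp)

theorem KAlg.qP {K : Submodule ℝ Quat} (h : KAlg K) {u : QV n} (hu : ∀ i, u i ∈ K) {s : Quat} (hs : s ∈ K)
    (i j) : qP (rs u s) u i j ∈ K :=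
  K.smul_mem _ (h.mul _ (h.mul _ (hu i) _ hs) _ (h.st _ (hu j)))

theorem KAlg.qB {K : Submodule ℝ Quat} (h : KAlg K) {u v : QV n} (hu : ∀ i, u i ∈ K) (hv : ∀ i, v i ∈ K) :
    qB u v ∈ K :=
  K.sum_mem fun i _ => K.smul_mem _ (h.mul _ (h.st _ (hu i)) _ (hv i))

theorem KAlg.mulM {K : Submodule ℝ Quat} (h : KAlg K) {A B : QM n} (hA : ∀ i j, A i j ∈ K)
    (hB : ∀ i j, B i j ∈ K) (i j) : (A * B) i j ∈ K := by
  rw [Matrix.mul_apply]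
  exact K.sum_mem fun k _ => h.mul _ (hA i k) _ (hB k j)

theorem KAlg.oneM {K : Submodule ℝ Quat} (h : KAlg K) (i j) : (1 : QM n) i j ∈ K := by
  rw [Matrix.one_apply]; split_ifs
  · exact h.one
  · exact K.zero_mem

theorem tau_exp {K : Submodule ℝ Quat} (h : KAlg K) {u : QV n} (hu : ∀ i, u i ∈ K) {c : Quat} (hc : c ∈ K)
    (hc0 : c ≠ 0) (hb : 2 * c.re = (qB u u).re) :
    ∃ X : QM n, IsSk X ∧ (∀ i j, X i j ∈ K) ∧ mexp X = 1 - qP (rs u c⁻¹) u := by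
  obtain ⟨β, hβ⟩ : ∃ β : ℝ, β = (qB u u).re := ⟨_, rfl⟩
  have huu : qB u u = (β : Quat) := by rw [hβ]; exact qB_self_real u
  by_cases h0 : β = 0
  · have hre : (-c⁻¹).re = 0 := by
      rw [Quaternion.instInv]
      have : c.re = 0 := by linarith
      simp [this]
    refine ⟨qP (rs u (-c⁻¹)) u, qP_sk u hre, h.qP hu (K.neg_mem (h.inv hc)), ?_⟩
    rw [mexp_sq_zero, rs_neg, sub_eq_add_neg]
    · congr 1
      refine QM_ext fun v => ?_
      rw [Matrix.neg_mulVec, qP_mulVec, qP_mulVec, neg_rs]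
    · rw [qP_mul, qB_rs_right, huu, h0]
      simp [qP_zero]
  · have hl : ‖1 - β • c⁻¹‖ = 1 := by
      have e : 1 - β • c⁻¹ = (c - (β : Quat)) * c⁻¹ := by
        rw [sub_mul, mul_inv_cancel₀ hc0, Quaternion.coe_mul_eq_smul]
      have e2 : ‖c - (β : Quat)‖ = ‖c‖ := by
        have a := Quaternion.normSq_eq_norm_mul_self c
        have b := Quaternion.normSq_eq_norm_mul_self (c - (β : Quat))
        rw [Quaternion.normSq_def'] at a b
        simp at a b
        have : ‖c - (β : Quat)‖ * ‖c - (β : Quat)‖ = ‖c‖ * ‖c‖ := by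
          rw [← a, ← b]
          have : c.re = β / 2 := by linarith
          rw [this]; ring
        exact (mul_self_inj (norm_nonneg _) (norm_nonneg _)).1 this
      rw [e, norm_mul, norm_inv, e2, mul_inv_cancel₀ (norm_ne_zero_iff.2 hc0)]
    obtain ⟨s, hsK, hs0, hs⟩ := qlog K h.one h.i (K.sub_mem h.one (K.smul_mem β (h.inv hc))) hl
    refine ⟨qP (rs u (β⁻¹ • s)) u, qP_sk u (by simp [hs0]), h.qP hu (K.smul_mem _ hsK), ?_⟩
    have e1 : qP (rs u (β⁻¹ • s)) u = tauHom u β h0 huu (s, 0) := by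
      rw [tauHom_apply]; simp
    letI i1 : NormedAlgebra ℚ Quat := NormedAlgebra.restrictScalars ℚ ℝ Quat
    letI i2 : NormedAlgebra ℚ ℝ := NormedAlgebra.restrictScalars ℚ ℝ ℝ
    have e2 : NormedSpace.exp ((s, 0) : Quat × ℝ) = (1 - β • c⁻¹, 1) := by
      refine Prod.ext ?_ ?_
      · rw [Prod.fst_exp]; exact hs
      · rw [Prod.snd_exp]; exact NormedSpace.exp_zero
    rw [e1, mexp_map, e2, tauHom_apply, one_smul]
    have e3 : β⁻¹ • (1 - β • c⁻¹ - ((1 : ℝ) : Quat)) = - c⁻¹ := by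
      rw [Quaternion.coe_one, sub_sub_cancel_left, smul_neg, smul_smul, inv_mul_cancel₀ h0, one_smul]
    rw [e3, sub_eq_add_neg]
    congr 1
    refine QM_ext fun v => ?_
    rw [Matrix.neg_mulVec, qP_mulVec, qP_mulVec, rs_neg, neg_rs]

/-- generation of the K-points of Sp by exponentials -/
theorem gen_K {K : Submodule ℝ Quat} (h : KAlg K) {M : Set (QM n)} (M1 : (1 : QM n) ∈ M)
    (Mm : ∀ A ∈ M, ∀ B ∈ M, A * B ∈ M) (Me : ∀ X : QM n, IsSk X → (∀ i j, X i j ∈ K) → mexp X ∈ M) :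
    ∀ A ∈ Sp n, (∀ i j, A i j ∈ K) → A ∈ M := by
  have main : ∀ d : ℕ, d ≤ n + 1 → ∀ A ∈ Sp n, (∀ i j, A i j ∈ K) →
      (∀ i : Fin (n + 1), i.val + d < n + 1 → A *ᵥ (Pi.single i 1) = Pi.single i 1) → A ∈ M := by
    intro d
    induction d with
    | zero =>
      intro _ A _ _ hfix
      have : A = 1 := by
        ext1 i j
        have := congrFun (hfix j (by simp [j.2])) i
        rw [Matrix.mulVec_single_one] at this
        simpa [Matrix.one_apply, Pi.single_apply] using this
      rw [this]; exact M1
    | succ d ih =>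
      intro hd A hA hAK hfix
      obtain ⟨k, hk⟩ : ∃ k : Fin (n + 1), k.val + d = n := ⟨⟨n - d, by omega⟩, by simp; omega⟩
      obtain ⟨w, hw⟩ : ∃ w : QV n, w = Pi.single k 1 := ⟨_, rfl⟩
      obtain ⟨v, hv⟩ : ∃ v : QV n, v = A *ᵥ w := ⟨_, rfl⟩
      by_cases hvw : v = w
      · refine ih (by omega) A hA hAK fun i hi => ?_
        rcases Nat.lt_or_ge i.val k.val with hlt | hge
        · exact hfix i (by omega)
        · have : i = k := Fin.ext (by omega)
          rw [this, ← hw, ← hv, hvw]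
      have hB := mem_Sp_iff.1 hA
      have hwK : ∀ i, w i ∈ K := by
        intro i; rw [hw, Pi.single_apply]; split_ifs
        · exact h.one
        · exact K.zero_mem
      have hvK : ∀ i, v i ∈ K := by
        intro i; rw [hv, hw, Matrix.mulVec_single_one]; exact hAK i k
      obtain ⟨u, hu⟩ : ∃ u : QV n, u = v - w := ⟨_, rfl⟩
      have huK : ∀ i, u i ∈ K := by intro i; rw [hu]; exact K.sub_mem (hvK i) (hwK i)
      have hvv : qB v v = qB w w := by rw [hv, hB]
      have hu0 : u ≠ 0 := by rw [hu]; exact sub_ne_zero.2 hvw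
      have hc : qB u v = qB w w - qB w v := by rw [hu, qB_sub_left, hvv]
      have hb : 2 * (qB u v).re = (qB u u).re := by
        have e : qB u u = qB w w + qB w w - qB w v - star (qB w v) := by
          rw [qB_star]
          nth_rewrite 1 [hu]; rw [hu]
          simp only [qB_sub_left, qB_sub_right, hvv]; abel
        rw [e, hc]; simp; ring
      have hww : qB w w = ((sg k : ℝ) : Quat) := by
        nth_rewrite 1 [hw]
        rw [qB_single, hw]; ext <;> simp
      have hwv : qB w v = sg k • v k := by
        rw [hw, qB_single]
      have hsmall : ∀ i : Fin (n + 1), i.val < k.val → qB u (Pi.single i 1) = 0 := by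
        intro i hi
        have e := hfix i (by omega)
        rw [hu, qB_sub_left]
        nth_rewrite 1 [← e]
        rw [hv, hB, sub_self]
      have hc0 : qB u v ≠ 0 := by
        intro hc0
        have hk1 : u k = 0 := by
          rw [hc, hww, hwv] at hc0
          have : v k = 1 := by
            have := congrArg (fun q => sg k • q) hc0
            simp only [smul_sub, smul_smul, sg_sq, one_smul, smul_zero] at this
            rw [show sg k • ((sg k : ℝ) : Quat) = 1 by
              rw [← Quaternion.coe_mul_eq_smul, ← Quaternion.coe_mul, sg_sq, Quaternion.coe_one]] at this
            exact (sub_eq_zero.1 this).symm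
          rw [hu, hw]; simp [this]
        have hu00 : u 0 = 0 := by
          by_cases hk0 : k = 0
          · rw [← hk0]; exact hk1
          · have h3 := hsmall 0 (by
              have : k.val ≠ 0 := fun h => hk0 (Fin.ext h)
              simpa using Nat.pos_of_ne_zero this)
            have h4 : qB (Pi.single 0 1) u = 0 := by rw [← qB_star, h3, star_zero]
            rw [qB_single, smul_eq_zero] at h4
            rcases h4 with h4 | h4
            · exfalso
              have := sg_sq (0 : Fin (n + 1)); rw [h4] at this; simp at this
            · exact h4
        have hsum : ∑ i, sg i * ‖u i‖ ^ 2 = 0 := by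
          rw [← qB_self_expand, ← hb, hc0]; simp
        have hsum' : ∑ i, ‖u i‖ ^ 2 = 0 := by
          rw [← hsum]
          refine Finset.sum_congr rfl fun i _ => ?_
          by_cases hi : i = 0
          · rw [hi, hu00]; simp
          · rw [show sg i = 1 by simp [sg, hi], one_mul]
        rw [Finset.sum_eq_zero_iff_of_nonneg (fun i _ => by positivity)] at hsum'
        refine hu0 (funext fun i => ?_)
        have := hsum' i (Finset.mem_univ _)
        simpa using this
      obtain ⟨X, hX, hXK, hXe⟩ := tau_exp h huK (h.qB huK hvK) hc0 hb
      have hTA : mexp X * A ∈ M := by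
        refine ih (by omega) _ (Sp_mul (mexp_Sp hX) hA) (h.mulM ?_ hAK) fun i hi => ?_
        · intro i j
          rw [hXe]
          exact K.sub_mem (h.oneM i j) (h.qP huK (h.inv (h.qB huK hvK)) i j)
        · rcases Nat.lt_or_ge i.val k.val with hlt | hge
          · rw [← Matrix.mulVec_mulVec, hfix i (by omega), hXe, Matrix.sub_mulVec, qP_mulVec, hsmall i hlt,
              rs_zero, sub_zero, Matrix.one_mulVec]
          · have : i = k := Fin.ext (by omega)
            rw [this, ← hw, ← Matrix.mulVec_mulVec, ← hv, hXe, Matrix.sub_mulVec, qP_mulVec, rs_rs,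
              inv_mul_cancel₀ hc0, rs_one, Matrix.one_mulVec, hu]
            abel
      have hX' : IsSk (-X) := by
        intro a b
        rw [Matrix.neg_mulVec, Matrix.neg_mulVec, qB_neg_left, qB_neg_right, hX a b]
      have e : A = mexp (-X) * (mexp X * A) := by
        rw [← Matrix.mul_assoc, mexp_neg_mul, Matrix.one_mul]
      rw [e]
      exact Mm _ (Me _ hX' fun i j => K.neg_mem (hXK i j)) _ hTA
  intro A hA hAK
  exact main (n + 1) le_rfl A hA hAK fun i hi => by omega

end Gen
end

noncomputable section

section DetExp

/-- derivative of the determinant at the identity along a path -/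
theorem det_path {N : Type*} [Fintype N] [DecidableEq N] (X : Matrix N N ℂ) {M : ℝ → Matrix N N ℂ} (h0 : M 0 = 1)
    (hM : ∀ i j, HasDerivAt (fun t => M t i j) (X i j) 0) : HasDerivAt (fun t => (M t).det) X.trace 0 := by
  have key : ∀ M : ℝ → Matrix N N ℂ, M 0 = 1 → (∀ i j, HasDerivAt (fun t => M t i j) (X i j) 0) →
      HasDerivAt (fun t => (M t).det) (∑ σ : Equiv.Perm N, ((Equiv.Perm.sign σ : ℤ) : ℂ) *
        ∑ i, (∏ j ∈ Finset.univ.erase i, (1 : Matrix N N ℂ) (σ j) j) • X (σ i) i) 0 := by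
    intro M h0 hM
    have : (fun t => (M t).det) = fun t => ∑ σ : Equiv.Perm N, ((Equiv.Perm.sign σ : ℤ) : ℂ) * ∏ i, M t (σ i) i := by
      funext t; rw [Matrix.det_apply']
    rw [this]
    refine HasDerivAt.fun_sum fun σ _ => ?_
    refine HasDerivAt.const_mul _ ?_
    have := HasDerivAt.fun_finsetProd (u := Finset.univ) (fun i _ => hM (σ i) i)
    rw [h0] at this
    exact this
  have h1 := key M h0 hM
  have h2 := key (fun t => 1 + (t : ℂ) • X) (by simp) (by
    intro i j
    have : HasDerivAt (fun t : ℝ => (1 : Matrix N N ℂ) i j + (t : ℂ) * X i j) (1 * X i j) 0 := by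
      have := ((HasDerivAt.ofReal_comp (hasDerivAt_id (0 : ℝ))).mul_const (X i j)).const_add
        ((1 : Matrix N N ℂ) i j)
      simpa using this
    simpa using this)
  have h3 : HasDerivAt (fun t : ℝ => (1 + (t : ℂ) • X).det) X.trace 0 := by
    obtain ⟨p, hp⟩ : ∃ p : Polynomial ℂ, ∀ r : ℂ, (1 + r • X).det = 1 + X.trace * r + p.eval r * r ^ 2 :=
      ⟨_, fun r => Matrix.det_one_add_smul r X⟩
    have e : (fun t : ℝ => (1 + (t : ℂ) • X).det) = fun t : ℝ => (fun r : ℂ => 1 + X.trace * r + p.eval r * r ^ 2) (t : ℂ) := by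
      funext t; exact hp t
    rw [e]
    have d : HasDerivAt (fun r : ℂ => 1 + X.trace * r + p.eval r * r ^ 2) X.trace ((0 : ℝ) : ℂ) := by
      have a1 := ((hasDerivAt_id ((0 : ℝ) : ℂ)).const_mul X.trace).const_add 1
      have a2 := (p.hasDerivAt ((0 : ℝ) : ℂ)).mul ((hasDerivAt_id ((0 : ℝ) : ℂ)).pow 2)
      have := a1.add a2
      refine HasDerivAt.congr_deriv (f' := _) this ?_
      simp
    exact d.comp_ofReal
  rw [h3.unique h2]
  exact h1

end DetExp

section CC
open scoped Matrix.Norms.Operator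
variable {n : ℕ}

theorem KC_alg : KAlg KC := by
  refine ⟨by simp [mem_KC], by simp [mem_KC], ?_, ?_⟩
  · intro p hp q hq; rw [mem_KC] at *; simp [hp.1, hp.2, hq.1, hq.2]
  · intro p hp; rw [mem_KC] at *; simp [hp.1, hp.2]
theorem top_alg : KAlg (⊤ : Submodule ℝ Quat) := ⟨trivial, trivial, fun _ _ _ _ => trivial, fun _ _ => trivial⟩

theorem KC_comm {p q : Quat} (hp : p ∈ KC) (hq : q ∈ KC) : p * q = q * p := by
  rw [mem_KC] at *
  ext <;> simp [hp.1, hp.2, hq.1, hq.2] <;> ring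

/-- matrices with entries in K -/
def Kmat {K : Submodule ℝ Quat} (h : KAlg K) (n : ℕ) : Subalgebra ℝ (QM n) where
  carrier := {A | ∀ i j, A i j ∈ K}
  mul_mem' := by intro A B hA hB; exact h.mulM hA hB
  add_mem' := by intro A B hA hB i j; exact K.add_mem (hA i j) (hB i j)
  algebraMap_mem' := by
    intro r i j
    rw [Algebra.algebraMap_eq_smul_one]
    exact K.smul_mem r (h.oneM i j)

theorem Kmat_exp {K : Submodule ℝ Quat} (h : KAlg K) {X : QM n} (hX : ∀ i j, X i j ∈ K) (i j) : mexp X i j ∈ K :=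
  mexp_mem (Kmat h n) hX i j

theorem qC_mul {p q : Quat} (hp : p ∈ KC) (hq : q ∈ KC) : quatToC (p * q) = quatToC p * quatToC q := by
  rw [mem_KC] at *
  apply Complex.ext <;> simp [quatToC, hp.1, hp.2, hq.1, hq.2]

/-- quatToC as a real linear map -/
def qCl : Quat →ₗ[ℝ] ℂ where
  toFun := quatToC
  map_add' := by intro a b; apply Complex.ext <;> simp [quatToC]
  map_smul' := by intro a b; apply Complex.ext <;> simp [quatToC]
theorem qCl_apply (q : Quat) : qCl q = quatToC q := rfl

theorem qC_inj {p q : Quat} (hp : p ∈ KC) (hq : q ∈ KC) (h : quatToC p = quatToC q) : p = q := by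
  rw [mem_KC] at *
  have h1 := congrArg Complex.re h
  have h2 := congrArg Complex.im h
  simp [quatToC] at h1 h2
  ext <;> simp [*]

theorem qC_mulM {A B : QM n} (hA : ∀ i j, A i j ∈ KC) (hB : ∀ i j, B i j ∈ KC) :
    (A * B).map quatToC = A.map quatToC * B.map quatToC := by
  ext1 i j
  simp only [Matrix.map_apply, Matrix.mul_apply]
  rw [← qCl_apply, map_sum]
  refine Finset.sum_congr rfl fun k _ => ?_
  rw [qCl_apply, qC_mul (hA i k) (hB k j)]

theorem qC_one : (1 : QM n).map quatToC = 1 := by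
  ext1 i j
  simp only [Matrix.map_apply, Matrix.one_apply]
  split_ifs <;> (apply Complex.ext <;> simp [quatToC])

theorem det_mexp {X : QM n} (hX : ∀ i j, X i j ∈ KC) (ht : (X.map quatToC).trace = 0) :
    ((mexp X).map quatToC).det = 1 := by
  obtain ⟨g, hg⟩ : ∃ g : ℝ → ℂ, g = fun t => ((mexp (t • X)).map quatToC).det := ⟨_, rfl⟩
  have hK : ∀ t : ℝ, ∀ i j, mexp (t • X) i j ∈ KC := fun t => Kmat_exp KC_alg fun i j => KC.smul_mem t (hX i j)
  have hadd : ∀ s t, g (s + t) = g s * g t := by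
    intro s t
    simp only [hg]
    rw [add_smul, mexp_add, qC_mulM (hK s) (hK t), Matrix.det_mul]
    show _ = _
    rw [smul_mul_smul_comm, smul_mul_smul_comm, mul_comm]
  have h00 : mexp ((0 : ℝ) • X) = 1 := by rw [zero_smul, mexp_zero]
  have hd0 : HasDerivAt g 0 0 := by
    rw [hg, ← ht]
    refine det_path _ (by rw [h00, qC_one]) ?_
    intro i j
    have h1 := mexp_hasDerivAt X
    obtain ⟨ℓ, hℓ⟩ : ∃ ℓ : QM n →ₗ[ℝ] ℂ, ∀ A, ℓ A = quatToC (A i j) :=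
      ⟨qCl.comp (Matrix.entryLinearMap ℝ Quat i j), fun A => rfl⟩
    have h2 := (LinearMap.toContinuousLinearMap ℓ).hasFDerivAt.comp_hasDerivAt (0 : ℝ) h1
    simp only [Matrix.map_apply, ← hℓ]
    exact h2
  have hd : ∀ t, HasDerivAt g 0 t := by
    intro t
    have e : g = fun s => g t * g (s - t) := by
      funext s; rw [← hadd]; congr 1; ring
    rw [e]
    have : HasDerivAt g 0 (t - t) := by rw [sub_self]; exact hd0
    simpa using (this.comp_sub_const t t).const_mul (g t)
  have hc := is_const_of_deriv_eq_zero (fun t => (hd t).differentiableAt) (fun t => (hd t).deriv) 1 0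
  simp only [hg, h00, one_smul, qC_one, Matrix.det_one] at hc
  exact hc

end CC
end

noncomputable section

section GG
variable {n : ℕ}

theorem mexp_of_mlie {H : Set (QM n)} (hH : MClSub H) {X : QM n} (hX : X ∈ mlie hH) : mexp X ∈ H := by
  simpa using (mem_mlie hH).1 hX 1

theorem H_sub_monoid {H : Set (QM n)} (hH : MClSub H) (hC : IsPreconnected H) (M : Submonoid (QM n))
    (hM : ∀ X ∈ mlie hH, mexp X ∈ M) : H ⊆ M := by
  refine (mgenerated hH hC).trans ?_
  refine (Submonoid.closure_le (S := M)).2 ?_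
  rintro _ ⟨X, hX, rfl⟩
  exact hM X hX

theorem IsSk.add' {X Y : QM n} (hX : IsSk X) (hY : IsSk Y) : IsSk (X + Y) := by
  intro v w
  rw [Matrix.add_mulVec, Matrix.add_mulVec, qB_add_left, qB_add_right, hX v w, hY v w]; abel
theorem IsSk.smul' {X : QM n} (hX : IsSk X) (t : ℝ) : IsSk (t • X) := by
  intro v w
  rw [smul_mulVec', smul_mulVec', qB_smul_left, qB_smul_right, hX v w, smul_neg]
theorem IsSk.sub' {X Y : QM n} (hX : IsSk X) (hY : IsSk Y) : IsSk (X - Y) := by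
  intro v w
  rw [Matrix.sub_mulVec, Matrix.sub_mulVec, qB_sub_left, qB_sub_right, hX v w, hY v w]; abel

theorem diag_sk {d : Fin (n + 1) → Quat} (hd : ∀ i, (d i).re = 0) : IsSk (Matrix.diagonal d) := by
  rw [isSk_iff, eta_eq, Matrix.diagonal_conjTranspose, Matrix.diagonal_mul_diagonal, Matrix.diagonal_mul_diagonal,
    Matrix.diagonal_add, ← Matrix.diagonal_zero]
  congr 1
  funext i
  rw [Pi.star_apply, im_star (hd i)]
  simp only [Quaternion.coe_mul_eq_smul, Quaternion.mul_coe_eq_smul]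
  simp

theorem scal_diag (q : Quat) : q • (1 : QM n) = Matrix.diagonal fun _ => q := by
  rw [Matrix.smul_one_eq_diagonal]

theorem scal_sk {q : Quat} (hq : q.re = 0) : IsSk (q • (1 : QM n)) := by
  rw [scal_diag]; exact diag_sk fun _ => hq

theorem IsSk.diag_re {X : QM n} (hX : IsSk X) (i) : (X i i).re = 0 := by
  have := congrArg (fun q : Quat => q.re) (sk_right hX (Pi.single i 1) (Pi.single i 1))
  simp only [Quaternion.re_neg, Quaternion.re_star] at this
  rw [entry_eq X i i]
  simp only [Quaternion.re_smul]
  rw [show (qB (Pi.single i 1) (X *ᵥ Pi.single i 1)).re = 0 by linarith]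
  simp

/-- the diagonal algebra map -/
theorem mexp_diag (d : Fin (n + 1) → Quat) :
    mexp (Matrix.diagonal d) = Matrix.diagonal fun i => NormedSpace.exp (d i) := by
  have h := mexp_map (Matrix.diagonalAlgHom ℝ (n := Fin (n + 1)) (α := Quat)) d
  rw [Matrix.diagonalAlgHom_apply, Matrix.diagonalAlgHom_apply] at h
  rw [h]
  congr 1
  funext i
  letI i1 : NormedAlgebra ℚ Quat := NormedAlgebra.restrictScalars ℚ ℝ Quat
  letI i2 : ∀ j : Fin (n + 1), NormedAlgebra ℚ ((fun _ => Quat) j) := fun _ => i1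
  exact Pi.coe_exp (𝔸 := fun _ => Quat) d i

theorem mexp_scal (q : Quat) : mexp (q • (1 : QM n)) = NormedSpace.exp q • (1 : QM n) := by
  rw [scal_diag, mexp_diag, scal_diag]

theorem exp_norm {s : Quat} (hs : s.re = 0) : ‖NormedSpace.exp s‖ = 1 := by
  rw [Quaternion.norm_exp, hs]; simp

theorem exp_KC {s : Quat} (hs : s ∈ KC) : NormedSpace.exp s ∈ KC := by
  have := Kmat_exp (n := 0) KC_alg (X := Matrix.diagonal fun _ => s) (by
    intro i j
    rw [Matrix.diagonal_apply]; split_ifs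
    · exact hs
    · exact KC.zero_mem) 0 0
  rw [mexp_diag] at this
  simpa using this

variable {m : ℕ} {H : Set (QM (m + 1))}

theorem case_top (hH : MClSub H) (hs : H ⊆ Sp (m + 1)) {e f : QV (m + 1)} {g : Fin m → QV (m + 1)}
    (G : QGood (mlie hH) ⊤ e f g) : H = Sp (m + 1) := by
  refine Set.Subset.antisymm hs fun A hA => ?_
  exact gen_K top_alg hH.one hH.mul (fun X hX _ => mexp_of_mlie hH (G.top_lower hX)) A hA fun _ _ => trivial

theorem tr_imI_scal (q : Quat) : (∑ i, (q • (1 : QM n)) i i).imI = (n + 1 : ℝ) * q.imI := by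
  rw [scal_diag]
  simp [Matrix.diagonal_apply]

theorem scal_KC {q : Quat} (hq : q ∈ KC) (i j) : (q • (1 : QM n)) i j ∈ KC := by
  rw [scal_diag, Matrix.diagonal_apply]; split_ifs
  · exact hq
  · exact KC.zero_mem

theorem tr_imI_sub (X Y : QM n) : (∑ i, (X - Y) i i).imI = (∑ i, X i i).imI - (∑ i, Y i i).imI := by
  simp

theorem split_scal {X : QM n} (hX : IsSk X) (h : ∀ i j, X i j ∈ KC) : ∃ t : ℝ, t = (∑ i, X i i).imI / (n + 1) ∧
    IsSk (X - (t • qi) • (1 : QM n)) ∧ (∀ i j, (X - (t • qi) • (1 : QM n)) i j ∈ KC) ∧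
    (∑ i, (X - (t • qi) • (1 : QM n)) i i).imI = 0 := by
  refine ⟨_, rfl, hX.sub' (scal_sk (by simp)), fun i j => KC.sub_mem (h i j) (scal_KC (KC.smul_mem _ KC_alg.i) i j), ?_⟩
  rw [tr_imI_sub, tr_imI_scal]
  have : (n + 1 : ℝ) ≠ 0 := by positivity
  simp
  field_simp
  simp

theorem case_KC_full (hH : MClSub H) (hC : IsPreconnected H) (hs : H ⊆ Sp (m + 1))
    (G : QGood (mlie hH) KC (e0 m) (f0 m) (g0 m)) (hX : ∃ X ∈ mlie hH, (∑ i, X i i).imI ≠ 0) : H = Ugrp (m + 1) := by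
  have hsc : qi • (1 : QM (m + 1)) ∈ mlie hH := by
    obtain ⟨X, hX, ht⟩ := hX
    obtain ⟨t, ht', h1, h2, h3⟩ := split_scal (G.sk X hX) (G.KC_upper hX)
    have h4 := (mlie hH).sub_mem hX (G.KC_lower h1 h2 h3)
    rw [sub_sub_cancel] at h4
    have ht0 : t ≠ 0 := by
      rw [ht']; push_cast; refine div_ne_zero ht (by positivity)
    have h5 := (mlie hH).smul_mem t⁻¹ h4
    rwa [← smul_assoc, smul_smul, inv_mul_cancel₀ ht0, one_smul] at h5
  have hlow : ∀ X : QM (m + 1), IsSk X → (∀ i j, X i j ∈ KC) → X ∈ mlie hH := by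
    intro X hX hXK
    obtain ⟨t, ht', h1, h2, h3⟩ := split_scal hX hXK
    have h4 := (mlie hH).add_mem (G.KC_lower h1 h2 h3) ((mlie hH).smul_mem t hsc)
    rwa [← smul_assoc, sub_add_cancel] at h4
  refine Set.Subset.antisymm (fun A hA => ⟨hs hA, fun i j => ?_⟩) fun A hA => ?_
  · exact H_sub_monoid hH hC (Kmat KC_alg (m + 1)).toSubmonoid
      (fun X hX => mexp_mem (Kmat KC_alg (m + 1)) (G.KC_upper hX)) hA i j
  · exact gen_K KC_alg hH.one hH.mul (fun X hX hXK => mexp_of_mlie hH (hlow X hX hXK)) A hA.1 hA.2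

theorem qC_smulM {l : Quat} (hl : l ∈ KC) {A : QM n} (hA : ∀ i j, A i j ∈ KC) :
    (l • A).map quatToC = quatToC l • A.map quatToC := by
  ext1 i j
  simp only [Matrix.map_apply, Matrix.smul_apply, smul_eq_mul]
  exact qC_mul hl (hA i j)

theorem case_KC_su (hH : MClSub H) (hC : IsPreconnected H) (hs : H ⊆ Sp (m + 1))
    (G : QGood (mlie hH) KC (e0 m) (f0 m) (g0 m)) (hX : ∀ X ∈ mlie hH, (∑ i, X i i).imI = 0) : H = SUgrp (m + 1) := by
  have hup : ∀ A ∈ H, (∀ i j, A i j ∈ KC) ∧ (A.map quatToC).det = 1 := by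
    obtain ⟨M, hM⟩ : ∃ M : Submonoid (QM (m + 1)), ∀ A, A ∈ M ↔ (∀ i j, A i j ∈ KC) ∧ (A.map quatToC).det = 1 :=
      ⟨{ carrier := {A | (∀ i j, A i j ∈ KC) ∧ (A.map quatToC).det = 1}
         one_mem' := ⟨KC_alg.oneM, by rw [qC_one, Matrix.det_one]⟩
         mul_mem' := by
           rintro A B ⟨a1, a2⟩ ⟨b1, b2⟩
           exact ⟨KC_alg.mulM a1 b1, by rw [qC_mulM a1 b1, Matrix.det_mul, a2, b2, one_mul]⟩ }, fun A => Iff.rfl⟩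
    intro A hA
    rw [← hM]
    refine H_sub_monoid hH hC M (fun X hXL => ?_) hA
    rw [hM]
    refine ⟨Kmat_exp KC_alg (G.KC_upper hXL), det_mexp (G.KC_upper hXL) ?_⟩
    rw [Matrix.trace]
    simp only [Matrix.diag_apply, Matrix.map_apply, ← qCl_apply]
    rw [← map_sum, qCl_apply]
    apply Complex.ext
    · simp only [quatToC, Complex.zero_re]
      rw [quat_re_sum]
      exact Finset.sum_eq_zero fun i _ => (G.sk X hXL).diag_re i
    · simpa [quatToC] using hX X hXL
  refine Set.Subset.antisymm (fun A hA => ⟨⟨hs hA, (hup A hA).1⟩, (hup A hA).2⟩) fun A hA => ?_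
  obtain ⟨M, hM⟩ : ∃ M : Set (QM (m + 1)), M = {A | ∃ h ∈ H, ∃ l ∈ KC, ‖l‖ = 1 ∧ A = l • h} := ⟨_, rfl⟩
  have hAM : A ∈ M := by
    refine gen_K KC_alg ?_ ?_ ?_ A hA.1.1 hA.1.2
    · rw [hM]; exact ⟨1, hH.one, 1, KC_alg.one, by simp, by simp⟩
    · rw [hM]
      rintro _ ⟨h, hh, l, hl, hn, rfl⟩ _ ⟨h', hh', l', hl', hn', rfl⟩
      refine ⟨h * h', hH.mul _ hh _ hh', l * l', KC_alg.mul _ hl _ hl', by rw [norm_mul, hn, hn', one_mul], ?_⟩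
      rw [Matrix.smul_mul, mul_smul]
      congr 1
      ext1 i j
      simp only [Matrix.mul_apply, Matrix.smul_apply, smul_eq_mul, Finset.mul_sum]
      refine Finset.sum_congr rfl fun k _ => ?_
      rw [← mul_assoc, KC_comm ((hup h hh).1 i k) hl', mul_assoc]
    · intro Y hY hYK
      rw [hM]
      obtain ⟨t, ht', h1, h2, h3⟩ := split_scal hY hYK
      refine ⟨_, mexp_of_mlie hH (G.KC_lower h1 h2 h3), NormedSpace.exp (t • qi), exp_KC (KC.smul_mem _ KC_alg.i),
        exp_norm (by simp), ?_⟩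
      have hcomm : Commute ((t • qi) • (1 : QM (m + 1))) (Y - (t • qi) • (1 : QM (m + 1))) := by
        show _ = _
        ext1 i j
        rw [Matrix.smul_mul, Matrix.one_mul, scal_diag, Matrix.mul_diagonal, ← scal_diag, Matrix.smul_apply,
          smul_eq_mul]
        exact KC_comm (KC.smul_mem _ KC_alg.i) (h2 i j)
      have := mexp_add hcomm
      rw [add_sub_cancel, mexp_scal, Matrix.smul_mul, Matrix.one_mul] at this
      exact this
  rw [hM] at hAM
  obtain ⟨h, hh, l, hl, hn, rfl⟩ := hAM
  obtain ⟨s, hsK, hs0, hsl⟩ := qlog KC KC_alg.one KC_alg.i hl hn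
  have hdet := hA.2
  rw [qC_smulM hl (hup h hh).1, Matrix.det_smul, (hup h hh).2, mul_one, Fintype.card_fin] at hdet
  have hpow : l ^ (m + 2) = 1 := by
    have hp : ∀ k : ℕ, l ^ k ∈ KC ∧ quatToC (l ^ k) = quatToC l ^ k := by
      intro k
      induction k with
      | zero => exact ⟨by simpa using KC_alg.one, by apply Complex.ext <;> simp [quatToC]⟩
      | succ k ih =>
        rw [pow_succ, pow_succ]
        exact ⟨KC_alg.mul _ ih.1 _ hl, by rw [qC_mul ih.1 hl, ih.2]⟩
    refine qC_inj (hp _).1 KC_alg.one ?_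
    rw [(hp _).2, hdet]
    apply Complex.ext <;> simp [quatToC]
  have hlH : l • (1 : QM (m + 1)) ∈ H := by
    obtain ⟨d, hd⟩ : ∃ d : Fin (m + 1 + 1) → Quat, d = fun i => if i = 0 then -((m + 1 : ℝ) • s) else s := ⟨_, rfl⟩
    have hdL : Matrix.diagonal d ∈ mlie hH := by
      refine G.KC_lower (diag_sk ?_) ?_ ?_
      · intro i; rw [hd]; simp only; split_ifs <;> simp [hs0]
      · intro i j
        rw [Matrix.diagonal_apply]; split_ifs
        · rw [hd]; simp only; split_ifs
          · exact KC.neg_mem (KC.smul_mem _ hsK)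
          · exact hsK
        · exact KC.zero_mem
      · simp only [Matrix.diagonal_apply_eq]
        rw [Fin.sum_univ_succ, hd]
        simp
    have := mexp_of_mlie hH hdL
    rw [mexp_diag] at this
    rw [scal_diag]
    convert this using 2
    funext i
    rw [hd]; simp only; split_ifs
    · letI i1 : NormedAlgebra ℚ Quat := NormedAlgebra.restrictScalars ℚ ℝ Quat
      have e1 : NormedSpace.exp (((m + 1 : ℕ) : ℕ) • s) = l ^ (m + 1) := by
        rw [NormedSpace.exp_nsmul, hsl]
      have e2 : ((m + 1 : ℝ) • s) = ((m + 1 : ℕ) : ℕ) • s := by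
        rw [← Nat.cast_smul_eq_nsmul ℝ]; push_cast; rfl
      have e3 := NormedSpace.exp_neg (((m + 1 : ℕ) : ℕ) • s)
      rw [e2, e3, e1]
      rw [pow_succ'] at hpow
      exact eq_inv_of_mul_eq_one_left hpow
    · exact hsl.symm
  have := hH.mul _ hlH _ hh
  rwa [Matrix.smul_mul, Matrix.one_mul] at this

end GG
end

noncomputable section

section RR
variable {n : ℕ}

/-- the real pseudo-orthogonal group -/
def OR (n : ℕ) : Set (Matrix (Fin (n + 1)) (Fin (n + 1)) ℝ) := {g | gᵀ * etaR n * g = etaR n}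

/-- real matrices inside quaternionic ones -/
def iotaR (n : ℕ) : Matrix (Fin (n + 1)) (Fin (n + 1)) ℝ →+* QM n := (algebraMap ℝ Quat).mapMatrix

theorem iotaR_apply (g : Matrix (Fin (n + 1)) (Fin (n + 1)) ℝ) (i j) : iotaR n g i j = ((g i j : ℝ) : Quat) := rfl

theorem SOo_eq : SOo n = iotaR n '' connectedComponentIn (OR n) 1 := rfl

theorem iotaR_inj : Function.Injective (iotaR n) := by
  intro g h e
  ext i j
  have := congrFun (congrFun e i) j
  rw [iotaR_apply, iotaR_apply] at this
  exact Quaternion.coe_injective this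

theorem iotaR_eta : iotaR n (etaR n) = eta n := by
  ext1 i j
  rw [iotaR_apply, etaR, eta, Matrix.diagonal_apply, Matrix.diagonal_apply]
  split_ifs <;> simp

theorem iotaR_ct (g : Matrix (Fin (n + 1)) (Fin (n + 1)) ℝ) : (iotaR n g)ᴴ = iotaR n gᵀ := by
  ext1 i j
  rw [Matrix.conjTranspose_apply, iotaR_apply, iotaR_apply, Matrix.transpose_apply]
  simp

theorem iotaR_Sp {g : Matrix (Fin (n + 1)) (Fin (n + 1)) ℝ} : iotaR n g ∈ Sp n ↔ g ∈ OR n := by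
  show (iotaR n g)ᴴ * eta n * iotaR n g = eta n ↔ gᵀ * etaR n * g = etaR n
  rw [iotaR_ct, ← iotaR_eta, ← map_mul, ← map_mul]
  exact iotaR_inj.eq_iff

theorem iotaR_KR (g : Matrix (Fin (n + 1)) (Fin (n + 1)) ℝ) (i j) : iotaR n g i j ∈ KR := by
  rw [iotaR_apply, mem_KR]; simp

/-- real parts of entries -/
def rhoR (A : QM n) : Matrix (Fin (n + 1)) (Fin (n + 1)) ℝ := fun i j => (A i j).re

theorem iota_rho {A : QM n} (h : ∀ i j, A i j ∈ KR) : iotaR n (rhoR A) = A := by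
  ext1 i j
  rw [iotaR_apply, rhoR]
  obtain ⟨h1, h2, h3⟩ := mem_KR.1 (h i j)
  ext <;> simp [*]

theorem rho_cont : Continuous (rhoR : QM n → _) := by
  refine continuous_matrix fun i j => ?_
  exact Quaternion.continuous_re.comp (continuous_id.matrix_elem i j)

theorem OR_mul {g h : Matrix (Fin (n + 1)) (Fin (n + 1)) ℝ} (hg : g ∈ OR n) (hh : h ∈ OR n) : g * h ∈ OR n := by
  rw [← iotaR_Sp] at *
  rw [map_mul]; exact Sp_mul hg hh

theorem OR_one : (1 : Matrix (Fin (n + 1)) (Fin (n + 1)) ℝ) ∈ OR n := by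
  rw [← iotaR_Sp, map_one]; exact Sp_one

theorem SOo_one : (1 : QM n) ∈ SOo n := by
  rw [SOo_eq]; exact ⟨1, mem_connectedComponentIn OR_one, map_one _⟩

theorem SOo_mul {A B : QM n} (hA : A ∈ SOo n) (hB : B ∈ SOo n) : A * B ∈ SOo n := by
  rw [SOo_eq] at *
  obtain ⟨g, hg, rfl⟩ := hA
  obtain ⟨h, hh, rfl⟩ := hB
  refine ⟨g * h, ?_, map_mul _ _ _⟩
  have hgO : g ∈ OR n := connectedComponentIn_subset _ _ hg
  rw [connectedComponentIn_eq hg]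
  have hpre : IsPreconnected ((fun x => g * x) '' connectedComponentIn (OR n) 1) :=
    isPreconnected_connectedComponentIn.image _ (continuous_const.matrix_mul continuous_id).continuousOn
  refine hpre.subset_connectedComponentIn ⟨1, mem_connectedComponentIn OR_one, by simp⟩ ?_ ⟨h, hh, rfl⟩
  rintro _ ⟨x, hx, rfl⟩
  exact OR_mul hgO (connectedComponentIn_subset _ _ hx)

theorem SOo_sub {A : QM n} (hA : A ∈ SOo n) : A ∈ Sp n ∧ ∀ i j, A i j ∈ KR := by
  rw [SOo_eq] at hA
  obtain ⟨g, hg, rfl⟩ := hA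
  exact ⟨iotaR_Sp.2 (connectedComponentIn_subset _ _ hg), iotaR_KR g⟩

theorem SOo_conn : IsPreconnected (SOo n) := by
  rw [SOo_eq]
  refine isPreconnected_connectedComponentIn.image _ (Continuous.continuousOn ?_)
  refine continuous_matrix fun i j => ?_
  exact Quaternion.continuous_coe.comp (continuous_id.matrix_elem i j)

theorem KR_mul {p q : Quat} (hp : p ∈ KR) (hq : q ∈ KR) : p * q ∈ KR := by
  rw [mem_KR] at *; simp [hp, hq]

/-- real-entry subalgebra -/
def Rmat (n : ℕ) : Subalgebra ℝ (QM n) where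
  carrier := {A | ∀ i j, A i j ∈ KR}
  mul_mem' := by
    intro A B hA hB i j
    rw [Matrix.mul_apply]
    exact KR.sum_mem fun k _ => KR_mul (hA i k) (hB k j)
  add_mem' := by intro A B hA hB i j; exact KR.add_mem (hA i j) (hB i j)
  algebraMap_mem' := by
    intro r i j
    rw [Algebra.algebraMap_eq_smul_one]
    refine KR.smul_mem r ?_
    rw [Matrix.one_apply]; split_ifs
    · simp [mem_KR]
    · exact KR.zero_mem

theorem SOo_exp {X : QM n} (hX : IsSk X) (h : ∀ i j, X i j ∈ KR) : mexp X ∈ SOo n := by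
  have hR : ∀ t : ℝ, ∀ i j, mexp (t • X) i j ∈ KR := fun t =>
    mexp_mem (Rmat n) (X := t • X) fun i j => KR.smul_mem t (h i j)
  have hpre : IsPreconnected ((fun t : ℝ => rhoR (mexp (t • X))) '' Set.univ) :=
    isPreconnected_univ.image _ (rho_cont.comp (mexp_path X)).continuousOn
  rw [SOo_eq]
  refine ⟨rhoR (mexp ((1 : ℝ) • X)), ?_, by rw [iota_rho (hR 1), one_smul]⟩
  refine hpre.subset_connectedComponentIn ⟨0, trivial, ?_⟩ ?_ ⟨1, trivial, rfl⟩
  · apply iotaR_inj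
    simp only
    rw [iota_rho (hR 0), zero_smul, mexp_zero, map_one]
  · rintro _ ⟨t, -, rfl⟩
    simp only
    rw [← iotaR_Sp, iota_rho (hR t)]
    exact mexp_Sp (hX.smul' t)

open scoped Matrix.Norms.Operator in
theorem mlie_func {X : QM n} (ℓ : Quat →ₗ[ℝ] ℝ) (i j) (h : ∀ t : ℝ, ℓ (mexp (t • X) i j) = 0) : ℓ (X i j) = 0 := by
  have h1 := mexp_hasDerivAt X
  have h2 := (LinearMap.toContinuousLinearMap (ℓ.comp (Matrix.entryLinearMap ℝ Quat i j))).hasFDerivAt.comp_hasDerivAt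
    (0 : ℝ) h1
  have h3 : (LinearMap.toContinuousLinearMap (ℓ.comp (Matrix.entryLinearMap ℝ Quat i j))) ∘
      (fun t : ℝ => mexp (t • X)) = fun _ => 0 := by
    funext t; exact h t
  rw [h3] at h2
  exact h2.unique (hasDerivAt_const _ _)

theorem mlie_KR {X : QM n} (h : ∀ t : ℝ, ∀ i j, mexp (t • X) i j ∈ KR) (i j) : X i j ∈ KR := by
  obtain ⟨l1, hl1⟩ : ∃ l : Quat →ₗ[ℝ] ℝ, ∀ q, l q = q.imI := ⟨⟨⟨fun q => q.imI, by simp⟩, by simp⟩, fun _ => rfl⟩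
  obtain ⟨l2, hl2⟩ : ∃ l : Quat →ₗ[ℝ] ℝ, ∀ q, l q = q.imJ := ⟨⟨⟨fun q => q.imJ, by simp⟩, by simp⟩, fun _ => rfl⟩
  obtain ⟨l3, hl3⟩ : ∃ l : Quat →ₗ[ℝ] ℝ, ∀ q, l q = q.imK := ⟨⟨⟨fun q => q.imK, by simp⟩, by simp⟩, fun _ => rfl⟩
  rw [mem_KR, ← hl1, ← hl2, ← hl3]
  refine ⟨mlie_func l1 i j fun t => ?_, mlie_func l2 i j fun t => ?_, mlie_func l3 i j fun t => ?_⟩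
  · rw [hl1]; exact (mem_KR.1 (h t i j)).1
  · rw [hl2]; exact (mem_KR.1 (h t i j)).2.1
  · rw [hl3]; exact (mem_KR.1 (h t i j)).2.2

/-- the closed group of real points -/
theorem SR_clsub : MClSub {A : QM n | A ∈ Sp n ∧ ∀ i j, A i j ∈ KR} := by
  refine MClSub.mk' ⟨Sp_one, (Rmat n).one_mem⟩ ?_ ?_ ?_
  · rintro A ⟨a1, a2⟩ B ⟨b1, b2⟩
    exact ⟨Sp_mul a1 b1, (Rmat n).mul_mem a2 b2⟩
  · rintro A ⟨a1, a2⟩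
    refine ⟨eta n * Aᴴ * eta n, ⟨Sp_of_inv a1 (Sp_inv_right a1), ?_⟩, Sp_inv_right a1, Sp_inv_left a1⟩
    have e1 : eta n ∈ Rmat n := by rw [← iotaR_eta]; exact iotaR_KR _
    have e2 : Aᴴ ∈ Rmat n := by
      rw [← iota_rho a2, iotaR_ct]; exact iotaR_KR _
    exact (Rmat n).mul_mem ((Rmat n).mul_mem e1 e2) e1
  · refine Sp_closed.inter ?_
    have : IsClosed ((Subalgebra.toSubmodule (Rmat n) : Submodule ℝ (QM n)) : Set (QM n)) :=
      Submodule.closed_of_finiteDimensional _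
    exact this

/-- facts in the real case -/
structure KRf {H : Set (QM n)} (hH : MClSub H) : Prop where
  low : ∀ X : QM n, IsSk X → (∀ i j, X i j ∈ KR) → X ∈ mlie hH
  up : ∀ X ∈ mlie hH, ∃ u : Quat, u.re = 0 ∧ ∀ i j, (X - u • (1 : QM n)) i j ∈ KR

variable {H : Set (QM n)} {hH : MClSub H}

theorem KRf.up' (F : KRf hH) (hs : H ⊆ Sp n) {X : QM n} (hX : X ∈ mlie hH) :
    ∃ u : Quat, u.re = 0 ∧ u • (1 : QM n) ∈ mlie hH ∧ IsSk (X - u • (1 : QM n)) ∧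
      ∀ i j, (X - u • (1 : QM n)) i j ∈ KR := by
  obtain ⟨u, hu, h⟩ := F.up X hX
  have h1 : IsSk (X - u • (1 : QM n)) := (mlie_sk hH hs hX).sub' (scal_sk hu)
  refine ⟨u, hu, ?_, h1, h⟩
  have := (mlie hH).sub_mem hX (F.low _ h1 h)
  rwa [sub_sub_cancel] at this

theorem KRf.SOo_le (F : KRf hH) : SOo n ⊆ H := by
  refine mconnected_subset hH SOo_conn SOo_one SR_clsub (fun A hA => SOo_sub hA) fun X hX => ?_
  refine F.low X (mlie_sk SR_clsub (fun A hA => hA.1) hX) (mlie_KR fun t => ((mem_mlie _).1 hX t).2)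

theorem scal_comm_real (q : Quat) {A : QM n} (hA : ∀ i j, A i j ∈ KR) :
    A * (q • (1 : QM n)) = (q • (1 : QM n)) * A := by
  ext1 i j
  rw [Matrix.smul_mul, Matrix.one_mul, scal_diag, Matrix.mul_diagonal, Matrix.smul_apply, smul_eq_mul]
  obtain ⟨h1, h2, h3⟩ := mem_KR.1 (hA i j)
  ext <;> simp [h1, h2, h3] <;> ring

theorem scal_mul (p q : Quat) : (p • (1 : QM n)) * (q • (1 : QM n)) = (p * q) • (1 : QM n) := by
  rw [Matrix.smul_mul, Matrix.one_mul, mul_smul]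

theorem KRf.eq (F : KRf hH) (hs : H ⊆ Sp n) (hC : IsPreconnected H) (T : Set Quat) (T1 : (1 : Quat) ∈ T)
    (Tm : ∀ p ∈ T, ∀ q ∈ T, p * q ∈ T) (Te : ∀ u : Quat, u.re = 0 → u • (1 : QM n) ∈ mlie hH → NormedSpace.exp u ∈ T)
    (TH : ∀ q ∈ T, q • (1 : QM n) ∈ H) : H = SOo n * {A | ∃ q ∈ T, A = q • (1 : QM n)} := by
  refine Set.Subset.antisymm ?_ ?_
  · obtain ⟨M, hM⟩ : ∃ M : Submonoid (QM n), (M : Set (QM n)) = SOo n * {A | ∃ q ∈ T, A = q • (1 : QM n)} :=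
      ⟨{ carrier := SOo n * {A | ∃ q ∈ T, A = q • (1 : QM n)}
         one_mem' := ⟨1, SOo_one, 1, ⟨1, T1, by simp⟩, by simp⟩
         mul_mem' := by
           rintro _ _ ⟨A, hA, _, ⟨p, hp, rfl⟩, rfl⟩ ⟨B, hB, _, ⟨q, hq, rfl⟩, rfl⟩
           refine ⟨A * B, SOo_mul hA hB, _, ⟨p * q, Tm p hp q hq, rfl⟩, ?_⟩
           show A * B * ((p * q) • (1 : QM n)) = A * p • (1 : QM n) * (B * q • (1 : QM n))
           rw [← scal_mul]
           simp only [Matrix.mul_assoc]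
           rw [← Matrix.mul_assoc B, scal_comm_real p (SOo_sub hB).2, Matrix.mul_assoc] }, rfl⟩
    rw [← hM]
    refine H_sub_monoid hH hC M fun X hX => ?_
    rw [← SetLike.mem_coe, hM]
    obtain ⟨u, hu, huL, h1, h2⟩ := F.up' hs hX
    refine ⟨_, SOo_exp h1 h2, _, ⟨_, Te u hu huL, rfl⟩, ?_⟩
    show mexp (X - u • 1) * NormedSpace.exp u • (1 : QM n) = mexp X
    rw [← mexp_scal, ← mexp_add, sub_add_cancel]
    exact scal_comm_real u h2
  · rintro _ ⟨A, hA, _, ⟨q, hq, rfl⟩, rfl⟩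
    exact hH.mul _ (F.SOo_le hA) _ (TH q hq)

theorem KRf.conj (F : KRf hH) {w : Quat} (h1 : (star w • (1 : QM n)) * (w • 1) = 1)
    (h2 : (w • (1 : QM n)) * (star w • 1) = 1) : KRf (cj_clsub hH h1 h2) := by
  constructor
  · intro X hX hXR
    rw [mem_mlie_cj hH h1 h2, ← scal_comm_real w hXR, Matrix.mul_assoc, h2, Matrix.mul_one]
    exact F.low X hX hXR
  · intro X hX
    rw [mem_mlie_cj hH h1 h2] at hX
    obtain ⟨u, hu, h⟩ := F.up _ hX
    refine ⟨star w * u * w, ?_, ?_⟩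
    · have : star u = -u := im_star hu
      have e : star (star w * u * w) = - (star w * u * w) := by
        simp [this, mul_assoc]
      have := congrArg (fun q : Quat => q.re) e
      simp only [Quaternion.re_star, Quaternion.re_neg] at this
      linarith
    · obtain ⟨R, hR⟩ : ∃ R, R = w • (1 : QM n) * X * star w • (1 : QM n) - u • (1 : QM n) := ⟨_, rfl⟩
      rw [← hR] at h
      have e : X - (star w * u * w) • (1 : QM n) = R := by
        have e1 : X = (star w • (1 : QM n)) * (w • (1 : QM n) * X * star w • (1 : QM n)) * (w • 1) := by
          rw [← Matrix.mul_assoc, ← Matrix.mul_assoc, h1, Matrix.one_mul, Matrix.mul_assoc, h1, Matrix.mul_one]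
        have e2 : w • (1 : QM n) * X * star w • (1 : QM n) = R + u • (1 : QM n) := by rw [hR]; abel
        rw [e2, Matrix.mul_add, Matrix.add_mul, scal_mul, scal_mul, ← scal_comm_real _ h, Matrix.mul_assoc, h1,
          Matrix.mul_one] at e1
        rw [e1]; abel
      rw [e]; exact h

theorem scal_Sp {q : Quat} (hq : ‖q‖ = 1) : q • (1 : QM n) ∈ Sp n := by
  have e : (q • (1 : QM n))ᴴ = star q • (1 : QM n) := by
    rw [scal_diag, Matrix.diagonal_conjTranspose, scal_diag]; rfl
  show _ * _ * _ = _
  have hR : ∀ i j, eta n i j ∈ KR := by rw [← iotaR_eta]; exact iotaR_KR _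
  rw [e, Matrix.mul_assoc, scal_comm_real q hR, ← Matrix.mul_assoc, scal_mul, unit_star_mul hq, one_smul,
    Matrix.one_mul]

theorem scal_smul (t : ℝ) (q : Quat) : (t • q) • (1 : QM n) = t • (q • (1 : QM n)) := smul_assoc _ _ _

theorem KRf.concl (F : KRf hH) (hs : H ⊆ Sp n) (hC : IsPreconnected H) (hn : 2 ≤ n) : Concl n H := by
  by_cases hU : ∀ u : Quat, u.re = 0 → u • (1 : QM n) ∈ mlie hH → u = 0
  · refine Concl_of_eq (Or.inl ⟨hn, Or.inl ?_⟩)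
    rw [F.eq hs hC {1} rfl (by simp) (fun u hu huL => by rw [hU u hu huL]; simp) (by simpa using hH.one)]
    simp
  push Not at hU
  obtain ⟨z, hz, hzL, hz0⟩ := hU
  have hpos : 0 < z.imI ^ 2 + z.imJ ^ 2 + z.imK ^ 2 := by
    by_contra hcon
    apply hz0
    have a1 : z.imI = 0 := by nlinarith [sq_nonneg z.imI, sq_nonneg z.imJ, sq_nonneg z.imK]
    have a2 : z.imJ = 0 := by nlinarith [sq_nonneg z.imI, sq_nonneg z.imJ, sq_nonneg z.imK]
    have a3 : z.imK = 0 := by nlinarith [sq_nonneg z.imI, sq_nonneg z.imJ, sq_nonneg z.imK]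
    ext <;> simp [*]
  obtain ⟨r, hr⟩ : ∃ r : ℝ, r = (Real.sqrt (z.imI ^ 2 + z.imJ ^ 2 + z.imK ^ 2))⁻¹ := ⟨_, rfl⟩
  have hr2 : r ^ 2 * (z.imI ^ 2 + z.imJ ^ 2 + z.imK ^ 2) = 1 := by
    rw [hr, inv_pow, Real.sq_sqrt hpos.le, inv_mul_cancel₀ hpos.ne']
  obtain ⟨w, hw, hwz⟩ := rot_to_i (z := r • z) (by simp [hz]) (by simp; nlinarith)
  have h1 : (star w • (1 : QM n)) * (w • 1) = 1 := by rw [scal_mul, unit_star_mul hw, one_smul]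
  have h2 : (w • (1 : QM n)) * (star w • 1) = 1 := by rw [scal_mul, unit_mul_star hw, one_smul]
  have hP : star w • (1 : QM n) ∈ Sp n := scal_Sp (by rw [norm_star, hw])
  refine Concl_of_conj hP h1 h2 ?_
  have F' := F.conj h1 h2
  have hs' := cj_sub hs hP h1
  have hC' : IsPreconnected (cj (star w • (1 : QM n)) (w • 1) H) := cj_conn hC
  have hi : qi • (1 : QM n) ∈ mlie (cj_clsub hH h1 h2) := by
    rw [mem_mlie_cj hH h1 h2, scal_mul, scal_mul, hwz, scal_smul]
    exact (mlie hH).smul_mem _ hzL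
  generalize cj_clsub hH h1 h2 = hH' at *
  generalize cj (star w • (1 : QM n)) (w • 1) H = H' at *
  have hexp : ∀ K : Submodule ℝ Quat, KAlg K → (∀ s ∈ K, s.re = 0 → s • (1 : QM n) ∈ mlie hH') →
      ∀ q ∈ K, ‖q‖ = 1 → q • (1 : QM n) ∈ H' := by
    intro K hK hKL q hq hn
    obtain ⟨s, hsK, hs0, rfl⟩ := qlog K hK.one hK.i hq hn
    rw [← mexp_scal]
    exact mexp_of_mlie hH' (hKL s hsK hs0)
  by_cases hU : ∀ u : Quat, u.re = 0 → u • (1 : QM n) ∈ mlie hH' → u ∈ KC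
  · refine Concl_of_eq (Or.inl ⟨hn, Or.inr (Or.inl ?_)⟩)
    rw [F'.eq hs' hC' {q | q ∈ KC ∧ ‖q‖ = 1} ⟨KC_alg.one, by simp⟩ ?_ ?_ ?_]
    · congr 1
      ext A
      constructor
      · rintro ⟨q, ⟨h1, h2⟩, rfl⟩
        exact ⟨q, h1.1, h1.2, h2, rfl⟩
      · rintro ⟨q, h1, h2, h3, rfl⟩
        exact ⟨q, ⟨⟨h1, h2⟩, h3⟩, rfl⟩
    · rintro p ⟨p1, p2⟩ q ⟨q1, q2⟩
      exact ⟨KC_alg.mul _ p1 _ q1, by rw [norm_mul, p2, q2, one_mul]⟩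
    · intro u hu huL
      exact ⟨exp_KC (hU u hu huL), exp_norm hu⟩
    · rintro q ⟨q1, q2⟩
      refine hexp KC KC_alg (fun s hs hs0 => ?_) q q1 q2
      have : s = s.imI • qi := by
        obtain ⟨a, b⟩ := mem_KC.1 hs
        ext <;> simp [*]
      rw [this, scal_smul]
      exact (mlie hH').smul_mem _ hi
  · refine Concl_of_eq (Or.inl ⟨hn, Or.inr (Or.inr ?_)⟩)
    push Not at hU
    obtain ⟨u, hu, huL, huC⟩ := hU
    have hne : 0 < u.imJ ^ 2 + u.imK ^ 2 := by
      by_contra hcon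
      apply huC
      rw [mem_KC]
      constructor <;> nlinarith [sq_nonneg u.imJ, sq_nonneg u.imK]
    obtain ⟨a, ha⟩ : ∃ a : Quat, a = u.imJ • qj + u.imK • qk := ⟨_, rfl⟩
    obtain ⟨b, hb⟩ : ∃ b : Quat, b = u.imJ • qk - u.imK • qj := ⟨_, rfl⟩
    have haL : a • (1 : QM n) ∈ mlie hH' := by
      have := (mlie hH').sub_mem huL ((mlie hH').smul_mem u.imI hi)
      rw [← scal_smul, ← sub_smul] at this
      convert this using 2
      rw [ha]; ext <;> simp [hu]
    have hbL : b • (1 : QM n) ∈ mlie hH' := by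
      have := (mlie hH').smul_mem (1 / 2 : ℝ) (mlie_bracket hH' hi haL)
      rw [scal_mul, scal_mul, ← sub_smul, ← scal_smul] at this
      convert this using 2
      rw [hb, ha]; ext <;> simp <;> ring
    have hall : ∀ s : Quat, s.re = 0 → s • (1 : QM n) ∈ mlie hH' := by
      intro s hs0
      obtain ⟨d, hd⟩ : ∃ d : ℝ, d = (u.imJ ^ 2 + u.imK ^ 2)⁻¹ := ⟨_, rfl⟩
      have hd1 : d * (u.imJ ^ 2 + u.imK ^ 2) = 1 := by rw [hd, inv_mul_cancel₀ hne.ne']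
      have : s = s.imI • qi + (d * (s.imJ * u.imJ + s.imK * u.imK)) • a
          + (d * (s.imK * u.imJ - s.imJ * u.imK)) • b := by
        rw [ha, hb]
        ext
        · simp [hs0]
        · simp
        · simp; linear_combination (-s.imJ) * hd1
        · simp; linear_combination (-s.imK) * hd1
      rw [this, add_smul, add_smul, scal_smul, scal_smul, scal_smul]
      exact (mlie hH').add_mem ((mlie hH').add_mem ((mlie hH').smul_mem _ hi) ((mlie hH').smul_mem _ haL))
        ((mlie hH').smul_mem _ hbL)
    rw [F'.eq hs' hC' {q | ‖q‖ = 1} (by simp) ?_ ?_ ?_]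
    · rfl
    · intro p hp q hq
      simp only [Set.mem_setOf_eq] at *
      rw [norm_mul, hp, hq, one_mul]
    · intro u hu huL
      exact exp_norm hu
    · intro q hq
      exact hexp ⊤ top_alg (fun s _ hs0 => hall s hs0) q trivial hq

end RR
end

noncomputable section

section KSCase

theorem QFr.two {e f : QV (0 + 1)} {g : Fin 0 → QV (0 + 1)} (F : QFr e f g) (v : QV (0 + 1)) :
    v = rs e (qB f v) + rs f (qB e v) := by
  have := F.recon v
  rw [_root_.recon] at this
  simpa using this.symm

theorem QFr.ext2 {e f : QV (0 + 1)} {g : Fin 0 → QV (0 + 1)} (F : QFr e f g) {A B : QM (0 + 1)}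
    (h1 : A *ᵥ e = B *ᵥ e) (h2 : A *ᵥ f = B *ᵥ f) : A = B := by
  refine QM_ext fun v => ?_
  rw [F.two v, Matrix.mulVec_add, Matrix.mulVec_add, mulVec_rs, mulVec_rs, mulVec_rs, mulVec_rs, h1, h2]

theorem QFr.vec2 {e f : QV (0 + 1)} {g : Fin 0 → QV (0 + 1)} (F : QFr e f g) {v w : QV (0 + 1)}
    (h1 : qB f v = qB f w) (h2 : qB e v = qB e w) : v = w := by
  rw [F.two v, F.two w, h1, h2]

/-- the algebra map attached to a hyperbolic pair -/
def dHom {e f : QV (0 + 1)} {g : Fin 0 → QV (0 + 1)} (F : QFr e f g) : (Quat × Quat) →ₐ[ℝ] QM (0 + 1) :=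
  AlgHom.ofLinearMap
    { toFun := fun p => qP (rs e p.1) f + qP (rs f p.2) e
      map_add' := by
        intro p q
        simp only [Prod.fst_add, Prod.snd_add, rs_add, qP_add_left]
        abel
      map_smul' := by
        intro t p
        simp only [Prod.smul_fst, Prod.smul_snd, RingHom.id_apply, rs_smul, qP_smul_left, smul_add] }
    (by
      refine QM_ext fun v => ?_
      simp only [LinearMap.coe_mk, AddHom.coe_mk, Prod.fst_one, Prod.snd_one, rs_one, Matrix.add_mulVec, qP_mulVec,
        Matrix.one_mulVec]
      exact (F.two v).symm)
    (by
      rintro ⟨q, t⟩ ⟨q', t'⟩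
      refine QM_ext fun v => ?_
      simp only [LinearMap.coe_mk, AddHom.coe_mk, Prod.mk_mul_mk, ← Matrix.mulVec_mulVec, Matrix.add_mulVec,
        qP_mulVec, qB_add_right, qB_rs_right, rs_rs, F.ee, F.ff, F.ef, F.fe]
      simp [mul_assoc])

theorem dHom_apply {e f : QV (0 + 1)} {g : Fin 0 → QV (0 + 1)} (F : QFr e f g) (a b : Quat) :
    dHom F (a, b) = qP (rs e a) f + qP (rs f b) e := rfl

theorem dHom_exp {e f : QV (0 + 1)} {g : Fin 0 → QV (0 + 1)} (F : QFr e f g) (a b : Quat) :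
    mexp (qP (rs e a) f + qP (rs f b) e) = qP (rs e (NormedSpace.exp a)) f + qP (rs f (NormedSpace.exp b)) e := by
  letI i1 : NormedAlgebra ℚ Quat := NormedAlgebra.restrictScalars ℚ ℝ Quat
  have e2 : NormedSpace.exp ((a, b) : Quat × Quat) = (NormedSpace.exp a, NormedSpace.exp b) := by
    refine Prod.ext ?_ ?_
    · rw [Prod.fst_exp]
    · rw [Prod.snd_exp]
  rw [← dHom_apply F, mexp_map, e2, dHom_apply]

theorem KC_log {p : Quat} (hp : p ∈ KC) (h0 : p ≠ 0) : ∃ c ∈ KC, NormedSpace.exp c = p := by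
  have hn : ‖p‖ ≠ 0 := by simpa using h0
  obtain ⟨s, hs, hs0, he⟩ := qlog KC KC_alg.one KC_alg.i (l := ‖p‖⁻¹ • p) (KC.smul_mem _ hp) (by
    rw [norm_smul, norm_inv, norm_norm, inv_mul_cancel₀ hn])
  refine ⟨(Real.log ‖p‖ : Quat) + s, KC.add_mem (by simp [mem_KC]) hs, ?_⟩
  letI i1 : NormedAlgebra ℚ Quat := NormedAlgebra.restrictScalars ℚ ℝ Quat
  rw [NormedSpace.exp_add_of_commute (Quaternion.coe_commute _ _), he, Quaternion.exp_coe, 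
    ← Real.exp_eq_exp_ℝ, Real.exp_log (by positivity), Quaternion.coe_mul_eq_smul, smul_smul, mul_inv_cancel₀ hn, one_smul]

theorem comm_qi {p : Quat} : p * qi = qi * p ↔ p ∈ KC := by
  rw [mem_KC]
  constructor
  · intro h
    have h1 := congrArg (fun q : Quat => q.imJ) h
    have h2 := congrArg (fun q : Quat => q.imK) h
    simp at h1 h2
    constructor <;> linarith
  · rintro ⟨h1, h2⟩
    ext <;> simp [*]

theorem anti_qi {p : Quat} : p * qi = -(qi * p) ↔ p.re = 0 ∧ p.imI = 0 := by
  constructor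
  · intro h
    have h1 := congrArg (fun q : Quat => q.re) h
    have h2 := congrArg (fun q : Quat => q.imI) h
    simp at h1 h2
    constructor <;> linarith
  · rintro ⟨h1, h2⟩
    ext <;> simp [*]

variable {H : Set (QM (0 + 1))} {e f : QV (0 + 1)} {g : Fin 0 → QV (0 + 1)}

theorem Phi_comm (F : QFr e f g) {Φ : QM (0 + 1)} (he : Φ *ᵥ e = rs e qi) (hf : Φ *ᵥ f = rs f (-qi)) (v : QV (0 + 1)) :
    qB f (Φ *ᵥ v) = qi * qB f v ∧ qB e (Φ *ᵥ v) = -(qi * qB e v) := by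
  have h : Φ *ᵥ v = rs e (qi * qB f v) + rs f (-(qi * qB e v)) := by
    conv_lhs => rw [F.two v]
    rw [Matrix.mulVec_add, mulVec_rs, mulVec_rs, he, hf, rs_rs, rs_rs, neg_mul]
  rw [h]
  simp [qB_add_right, qB_rs_right, F.ee, F.ff, F.ef, F.fe]

theorem KS_Lcomm (hH : MClSub H) (hs : H ⊆ Sp (0 + 1)) (G : QGood (mlie hH) KS e f g) {Φ : QM (0 + 1)}
    (he : Φ *ᵥ e = rs e qi) (hf : Φ *ᵥ f = rs f (-qi)) {X : QM (0 + 1)} (hX : X ∈ mlie hH) : X * Φ = Φ * X := by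
  have F := G.fr
  have hsk := mlie_sk hH hs hX
  have hc := comm_qi.2 (G.KS_upper hX)
  have re0 : ∀ u : QV (0 + 1), (qB u (X *ᵥ u)).re = 0 := by
    intro u
    have := sk_right hsk u u
    generalize qB u (X *ᵥ u) = x at *
    have := congrArg (fun q : Quat => q.re) this
    simp at this; linarith
  have ha := anti_qi.2 ⟨re0 f, G.b1 X hX⟩
  have hb := anti_qi.2 ⟨re0 e, G.b2 X hX⟩
  have hd := comm_qi.2 (KC.neg_mem (KC_alg.st _ (G.KS_upper hX)))
  rw [← sk_right hsk e f] at hd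
  refine F.ext2 ?_ ?_
  · rw [← Matrix.mulVec_mulVec, ← Matrix.mulVec_mulVec, he, mulVec_rs]
    refine F.vec2 ?_ ?_
    · rw [qB_rs_right, (Phi_comm F he hf _).1, hc]
    · rw [qB_rs_right, (Phi_comm F he hf _).2, hb]
  · rw [← Matrix.mulVec_mulVec, ← Matrix.mulVec_mulVec, hf, mulVec_rs]
    refine F.vec2 ?_ ?_
    · rw [qB_rs_right, (Phi_comm F he hf _).1, mul_neg, ha, neg_neg]
    · rw [qB_rs_right, (Phi_comm F he hf _).2, mul_neg, hd]

theorem KS_Hcomm (hH : MClSub H) (hC : IsPreconnected H) (hs : H ⊆ Sp (0 + 1)) (G : QGood (mlie hH) KS e f g)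
    {Φ : QM (0 + 1)} (he : Φ *ᵥ e = rs e qi) (hf : Φ *ᵥ f = rs f (-qi)) {A : QM (0 + 1)} (hA : A ∈ H) :
    A * Φ = Φ * A := by
  have := H_sub_monoid hH hC (Subalgebra.centralizer ℝ {Φ}).toSubmonoid (by
    intro X hX
    refine mexp_mem (Subalgebra.centralizer ℝ {Φ}) ?_
    rw [Subalgebra.mem_centralizer_iff]
    rintro _ rfl
    exact (KS_Lcomm hH hs G he hf hX).symm) hA
  have h2 := Subalgebra.mem_centralizer_iff ℝ |>.1 this Φ rfl
  exact h2.symm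

theorem cancel_left (hH : MClSub H) {h A : QM (0 + 1)} (hh : h ∈ H) (hA : h * A ∈ H) {h' : QM (0 + 1)} (hh' : h' ∈ H)
    (hi : h' * h = 1) : A ∈ H := by
  have := hH.mul _ hh' _ hA
  rwa [← Matrix.mul_assoc, hi, Matrix.one_mul] at this

/-- unipotent elements -/
theorem KS_Ne (hH : MClSub H) (G : QGood (mlie hH) KS e f g) {z : Quat} (h0 : z.re = 0) (h1 : z.imI = 0) :
    1 + qP (rs e z) e ∈ H := by
  have F := G.fr
  rw [← mexp_sq_zero]
  · refine mexp_of_mlie hH (G.KS_lower (qP_sk e h0) ?_ ?_ ?_) <;> rw [qP_mulVec] <;>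
      simp [qB_rs_right, F.ee, F.ef, F.fe, mem_KS, mem_KC, h1]
  · rw [qP_mul, qB_rs_right, F.ee]; simp [qP_zero]

theorem KS_Nf (hH : MClSub H) (G : QGood (mlie hH) KS e f g) {z : Quat} (h0 : z.re = 0) (h1 : z.imI = 0) :
    1 + qP (rs f z) f ∈ H := by
  have F := G.fr
  rw [← mexp_sq_zero]
  · refine mexp_of_mlie hH (G.KS_lower (qP_sk f h0) ?_ ?_ ?_) <;> rw [qP_mulVec] <;>
      simp [qB_rs_right, F.ff, F.ef, F.fe, mem_KS, mem_KC, h1]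
  · rw [qP_mul, qB_rs_right, F.ff]; simp [qP_zero]

theorem KS_D (hH : MClSub H) (G : QGood (mlie hH) KS e f g) {c : Quat} (hc : c ∈ KC) :
    qP (rs e (NormedSpace.exp c)) f + qP (rs f (NormedSpace.exp (-star c))) e ∈ H := by
  have F := G.fr
  rw [← dHom_exp F]
  refine mexp_of_mlie hH (G.KS_lower ?_ ?_ ?_ ?_)
  · intro v w
    simp only [Matrix.add_mulVec, qP_mulVec, qB_add_left, qB_add_right, qB_rs_left, qB_rs_right, star_mul, star_neg,
      star_star, qB_star]
    noncomm_ring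
  · simp [Matrix.add_mulVec, qP_mulVec, qB_add_right, qB_rs_right, F.ff, F.ef, F.fe, mem_KS]
  · simp [Matrix.add_mulVec, qP_mulVec, qB_add_right, qB_rs_right, F.ee, F.ef, F.fe, mem_KS]
  · simpa [Matrix.add_mulVec, qP_mulVec, qB_add_right, qB_rs_right, F.ee, F.ff, F.ef, F.fe] using hc

theorem KS_sub (hH : MClSub H) (hC : IsPreconnected H) (hs : H ⊆ Sp (0 + 1)) (G : QGood (mlie hH) KS e f g)
    {Φ : QM (0 + 1)} (he : Φ *ᵥ e = rs e qi) (hf : Φ *ᵥ f = rs f (-qi)) {A : QM (0 + 1)} (hA : A ∈ Sp (0 + 1))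
    (hc : A * Φ = Φ * A) : qB f (A *ᵥ e) ∈ KC ∧ ((qB e (A *ᵥ e)).re = 0 ∧ (qB e (A *ᵥ e)).imI = 0) ∧
      ((qB f (A *ᵥ f)).re = 0 ∧ (qB f (A *ᵥ f)).imI = 0) := by
  have F := G.fr
  have h1 : rs (A *ᵥ e) qi = Φ *ᵥ (A *ᵥ e) := by
    rw [← mulVec_rs, ← he, Matrix.mulVec_mulVec, Matrix.mulVec_mulVec, hc]
  have h2 : rs (A *ᵥ f) (-qi) = Φ *ᵥ (A *ᵥ f) := by
    rw [← mulVec_rs, ← hf, Matrix.mulVec_mulVec, Matrix.mulVec_mulVec, hc]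
  rw [← comm_qi, ← anti_qi, ← anti_qi]
  refine ⟨?_, ?_, ?_⟩
  · rw [← qB_rs_right, h1, (Phi_comm F he hf _).1]
  · rw [← qB_rs_right, h1, (Phi_comm F he hf _).2]
  · rw [← (Phi_comm F he hf _).1, ← h2, qB_rs_right, mul_neg, neg_neg]

/-- step 1: fixing e -/
theorem KS_step1 (hH : MClSub H) (hC : IsPreconnected H) (hs : H ⊆ Sp (0 + 1)) (G : QGood (mlie hH) KS e f g)
    {Φ : QM (0 + 1)} (he : Φ *ᵥ e = rs e qi) (hf : Φ *ᵥ f = rs f (-qi)) {A : QM (0 + 1)} (hA : A ∈ Sp (0 + 1))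
    (hc : A * Φ = Φ * A) (h : A *ᵥ e = e) : A ∈ H := by
  have F := G.fr
  obtain ⟨-, -, h1, h2⟩ := KS_sub hH hC hs G he hf hA hc
  have h3 : qB e (A *ᵥ f) = 1 := by
    conv_lhs => rw [← h]
    rw [mem_Sp_iff.1 hA, F.ef]
  have : A = 1 + qP (rs e (qB f (A *ᵥ f))) e := by
    refine F.ext2 ?_ ?_
    · rw [Matrix.add_mulVec, qP_mulVec, F.ee, Matrix.one_mulVec, h]; simp
    · rw [Matrix.add_mulVec, qP_mulVec, F.ef, Matrix.one_mulVec, rs_one]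
      conv_lhs => rw [F.two (A *ᵥ f), h3, rs_one, add_comm]
  rw [this]
  exact KS_Ne hH G h1 h2

theorem KS_step2 (hH : MClSub H) (hC : IsPreconnected H) (hs : H ⊆ Sp (0 + 1)) (G : QGood (mlie hH) KS e f g)
    {Φ : QM (0 + 1)} (he : Φ *ᵥ e = rs e qi) (hf : Φ *ᵥ f = rs f (-qi)) {A : QM (0 + 1)} (hA : A ∈ Sp (0 + 1))
    (hc : A * Φ = Φ * A) (h : qB f (A *ᵥ e) ≠ 0) : A ∈ H := by
  have F := G.fr
  obtain ⟨h1, ⟨h2, h3⟩, -⟩ := KS_sub hH hC hs G he hf hA hc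
  obtain ⟨p, hp⟩ : ∃ p, p = qB f (A *ᵥ e) := ⟨_, rfl⟩
  obtain ⟨r, hr⟩ : ∃ r, r = qB e (A *ᵥ e) := ⟨_, rfl⟩
  rw [← hp] at h h1
  rw [← hr] at h2 h3
  have hAe : A *ᵥ e = rs e p + rs f r := by rw [hp, hr]; exact F.two _
  have hpi : p⁻¹ ∈ KC := KC_alg.inv h1
  obtain ⟨c, hcK, hce⟩ := KC_log hpi (inv_ne_zero h)
  have hN := KS_Nf hH G (z := -(r * p⁻¹)) (by
    obtain ⟨a1, a2⟩ := mem_KC.1 hpi; simp [h2, h3, a1, a2]) (by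
    obtain ⟨a1, a2⟩ := mem_KC.1 hpi; simp [h2, h3, a1, a2])
  have hD := KS_D hH G hcK
  have hM := hH.mul _ hD _ hN
  obtain ⟨M, hMe⟩ : ∃ M, M = (qP (rs e (NormedSpace.exp c)) f + qP (rs f (NormedSpace.exp (-star c))) e) *
    (1 + qP (rs f (-(r * p⁻¹))) f) := ⟨_, rfl⟩
  rw [← hMe] at hM
  have hMA : M * A ∈ H := by
    refine KS_step1 hH hC hs G he hf (Sp_mul (hs hM) hA) ?_ ?_
    · rw [Matrix.mul_assoc, hc, ← Matrix.mul_assoc, KS_Hcomm hH hC hs G he hf hM, Matrix.mul_assoc]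
    · rw [← Matrix.mulVec_mulVec, hAe, hMe, hce]
      simp only [← Matrix.mulVec_mulVec, Matrix.add_mulVec, Matrix.one_mulVec, qP_mulVec, qB_add_right, qB_rs_right,
        F.ee, F.ff, F.ef, F.fe, rs_rs]
      simp [h, mul_assoc]
  obtain ⟨M', hM', -, hi⟩ := hH.inv _ hM
  exact cancel_left hH hM hMA hM' hi

theorem KS_all (hH : MClSub H) (hC : IsPreconnected H) (hs : H ⊆ Sp (0 + 1)) (G : QGood (mlie hH) KS e f g)
    {Φ : QM (0 + 1)} (he : Φ *ᵥ e = rs e qi) (hf : Φ *ᵥ f = rs f (-qi)) {A : QM (0 + 1)} (hA : A ∈ Sp (0 + 1))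
    (hc : A * Φ = Φ * A) : A ∈ H := by
  by_cases h : qB f (A *ᵥ e) = 0
  · have F := G.fr
    have hM := KS_Ne hH G (z := qj) (by simp) (by simp)
    have hMA : (1 + qP (rs e qj) e) * A ∈ H := by
      refine KS_step2 hH hC hs G he hf (Sp_mul (hs hM) hA) ?_ ?_
      · rw [Matrix.mul_assoc, hc, ← Matrix.mul_assoc, KS_Hcomm hH hC hs G he hf hM, Matrix.mul_assoc]
      · rw [← Matrix.mulVec_mulVec, Matrix.add_mulVec, Matrix.one_mulVec, qP_mulVec, qB_add_right, h, zero_add, rs_rs, qB_rs_right,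
          F.fe, one_mul]
        refine mul_ne_zero ?_ ?_
        · intro h; have := congrArg (fun q : Quat => q.imJ) h; simp at this
        · intro h4
          have h5 : A *ᵥ e = 0 := by rw [F.two (A *ᵥ e), h, h4]; simp
          have h6 := mem_Sp_iff.1 hA e f
          rw [h5, F.ef] at h6
          have h7 : qB (0 : QV (0 + 1)) (A *ᵥ f) = 0 := by
            have := qB_smul_left (0 : QV (0 + 1)) (A *ᵥ f) (0 : ℝ)
            simpa using this
          rw [h7] at h6; exact zero_ne_one h6
    obtain ⟨M', hM', -, hi⟩ := hH.inv _ hM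
    exact cancel_left hH hM hMA hM' hi
  · exact KS_step2 hH hC hs G he hf hA hc h

def e1 : QV (0 + 1) := ![1, -qi]
def f1 : QV (0 + 1) := ![(-1 / 2 : ℝ) • 1, (-1 / 2 : ℝ) • qi]

theorem qB_two (v w : QV (0 + 1)) : qB v w = star (v 1) * w 1 - star (v 0) * w 0 := by
  have : v = rs (Pi.single 0 1) (v 0) + rs (Pi.single 1 1) (v 1) := by
    ext1 i; fin_cases i <;> simp [rs]
  rw [this, qB_add_left, qB_rs_left, qB_rs_left, qB_single, qB_single, sg_zero', sg_one']
  simp [rs]; abel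

theorem fr1 (g : Fin 0 → QV (0 + 1)) : QFr e1 f1 g := by
  refine ⟨?_, ?_, ?_, fun k => k.elim0, fun k => k.elim0, fun k => k.elim0⟩ <;> rw [qB_two] <;>
    ext <;> simp [e1, f1] <;> norm_num

theorem Phi_e1 : Phi (0 + 1) *ᵥ e1 = rs e1 qi := by
  ext1 i; fin_cases i <;> ext <;> simp [e1, Phi, rs, Matrix.mulVec, dotProduct, Fin.sum_univ_two]

theorem Phi_f1 : Phi (0 + 1) *ᵥ f1 = rs f1 (-qi) := by
  ext1 i; fin_cases i <;> ext <;> simp [f1, Phi, rs, Matrix.mulVec, dotProduct, Fin.sum_univ_two] <;> norm_num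

theorem case_KS (hH : MClSub H) (hC : IsPreconnected H) (hs : H ⊆ Sp (0 + 1)) (G : QGood (mlie hH) KS e1 f1 g) :
    H = U0grp (0 + 1) := by
  ext A
  constructor
  · intro hA
    exact ⟨hs hA, KS_Hcomm hH hC hs G Phi_e1 Phi_f1 hA⟩
  · rintro ⟨h1, h2⟩
    exact KS_all hH hC hs G Phi_e1 Phi_f1 h1 h2

end KSCase
end

noncomputable section

section Final

theorem exists_frame {n : ℕ} (hn : 1 ≤ n) {H : Set (QM n)} (hH : MClSub H) (hs : H ⊆ Sp n)
    (hirr : ActsHIrreducibly n H) : ∃ e f : QV n, QFrame (mlie hH) e f := by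
  obtain ⟨h, hh, h', hh', h1, h2, e, f, μ, ν, hee, hff, hef, hμ, hhe, hhf⟩ := exists_lox hn hH hs hirr
  have hμν : star μ * ν = 1 := by
    have := mem_Sp_iff.1 (hs hh) e f
    rw [hhe, hhf, qB_rs_left, qB_rs_right, hef, one_mul] at this
    exact this
  have hμ0 : μ ≠ 0 := by rintro rfl; simp at hμν
  have hν0 : ν ≠ 0 := by rintro rfl; simp at hμν
  have hn1 : ‖μ‖ * ‖ν‖ = 1 := by
    have := congrArg norm hμν
    rwa [norm_mul, norm_star, norm_one] at this
  have hν : 1 < ‖ν⁻¹‖ := by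
    rw [norm_inv]
    rwa [← eq_inv_of_mul_eq_one_left hn1]
  have he' : h' *ᵥ e = rs e μ⁻¹ := by
    have : h' *ᵥ (h *ᵥ e) = e := by rw [Matrix.mulVec_mulVec, h2, Matrix.one_mulVec]
    rw [hhe, mulVec_rs] at this
    have := congrArg (fun v => rs v μ⁻¹) this
    simpa [hμ0] using this
  have hf' : h' *ᵥ f = rs f ν⁻¹ := by
    have : h' *ᵥ (h *ᵥ f) = f := by rw [Matrix.mulVec_mulVec, h2, Matrix.one_mulVec]
    rw [hhf, mulVec_rs] at this
    have := congrArg (fun v => rs v ν⁻¹) this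
    simpa [hν0] using this
  have g1 := fun X hX => qgrade hH hs hh hh' h1 h2 hee hff hef hμ hhe hhf (X := X) hX
  have g2 := fun X hX => qgrade hH hs hh' hh h2 h1 hff hee (qB_swap_one hef) hν hf' he' (X := X) hX
  exact ⟨e, f, hee, hff, hef, fun X hX => mlie_sk hH hs hX, fun X hX Y hY => mlie_bracket hH hX hY,
    fun X hX => (g1 X hX).1, fun X hX => (g1 X hX).2, fun X hX => (g2 X hX).1,
    fun X hX => by rw [← prW_swap]; exact (g2 X hX).2⟩

theorem KS_excl {K : Submodule ℝ Quat} (h : ∀ p ∈ K, ∀ q ∈ K, p * q ∈ K) {q : Quat} (hq : ‖q‖ = 1)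
    (hK : Krot K q = KS) : False := by
  have hj : qj ∈ Krot K q := by rw [hK, mem_KS]; simp
  have hk : qk ∈ Krot K q := by rw [hK, mem_KS]; simp
  rw [mem_Krot] at hj hk
  have := h _ hj _ hk
  have hi : qi ∈ Krot K q := by
    rw [mem_Krot]
    have e : q * qj * star q * (q * qk * star q) = q * qi * star q := by
      calc q * qj * star q * (q * qk * star q) = q * qj * (star q * q) * qk * star q := by simp only [mul_assoc]
        _ = q * (qj * qk) * star q := by rw [unit_star_mul hq]; simp only [mul_assoc, one_mul]
        _ = q * qi * star q := by
          rw [show qj * qk = qi by ext <;> simp]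
    rwa [e] at this
  rw [hK, mem_KS] at hi
  simp at hi

theorem KR_excl {K : Submodule ℝ Quat} {z : Quat} (hz : z ∈ K) (hz0 : z.im ≠ 0) {q : Quat} (hq : ‖q‖ = 1)
    (hK : Krot K q = KR) : False := by
  obtain ⟨w, hw⟩ : ∃ w, w = star q * z * q := ⟨_, rfl⟩
  have e : q * w * star q = z := by
    rw [hw]
    calc q * (star q * z * q) * star q = (q * star q) * z * (q * star q) := by simp only [mul_assoc]
      _ = z := by rw [unit_mul_star hq, one_mul, mul_one]
  have h1 : w ∈ Krot K q := by rw [mem_Krot, e]; exact hz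
  rw [hK, mem_KR] at h1
  obtain ⟨a1, a2, a3⟩ := h1
  clear hw
  have h2 : w = (w.re : Quat) := by ext <;> simp [*]
  apply hz0
  rw [← e, h2, Quaternion.mul_coe_eq_smul, smul_mul_assoc, unit_mul_star hq]
  ext <;> simp

theorem main_concl {m : ℕ} {H : Set (QM (m + 1))} (hH : MClSub H) (hC : IsPreconnected H) (hs : H ⊆ Sp (m + 1))
    (hirr : ActsHIrreducibly (m + 1) H) : Concl (m + 1) H := by
  obtain ⟨e, f, F⟩ := exists_frame (by omega) hH hs hirr
  obtain ⟨K, g, G, hm⟩ := F.good (mlie_irr hH hC hirr)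
  obtain ⟨q, hq, hK⟩ := Kclass K G.coe
  have G1 := G.rot hq
  rcases hK with hK | hK | hK | hK
  · have hm1 : 1 ≤ m := by
      rcases hm with hm | ⟨-, z, hz, hz0⟩
      · exact hm.1
      · exact (KR_excl hz hz0 hq hK).elim
    rw [hK] at G1
    obtain ⟨P, P', hP, h1, h2, G2⟩ := G1.move hH fr0
    refine Concl_of_conj hP h1 h2 ?_
    have F2 : KRf (cj_clsub hH h1 h2) := ⟨fun X hX h => G2.KR_lower hm1 hX h, fun X hX => G2.KR_upper hX⟩
    exact F2.concl (cj_sub hs hP h1) (cj_conn hC) (by omega)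
  · rw [hK] at G1
    obtain ⟨P, P', hP, h1, h2, G2⟩ := G1.move hH fr0
    refine Concl_of_conj hP h1 h2 (Concl_of_eq ?_)
    by_cases h : ∀ X ∈ mlie (cj_clsub hH h1 h2), (∑ i, X i i).imI = 0
    · exact Or.inr (Or.inl (case_KC_su (cj_clsub hH h1 h2) (cj_conn hC) (cj_sub hs hP h1) G2 h))
    · push Not at h
      exact Or.inr (Or.inr (Or.inl (case_KC_full (cj_clsub hH h1 h2) (cj_conn hC) (cj_sub hs hP h1) G2 h)))
  · rw [hK] at G1
    exact Concl_of_eq (Or.inr (Or.inr (Or.inr (Or.inl (case_top hH hs G1)))))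
  · rcases hm with hm | ⟨hm, -⟩
    · exact (KS_excl hm.2 hq hK).elim
    · subst hm
      rw [hK] at G1
      obtain ⟨P, P', hP, h1, h2, G2⟩ := G1.move hH (fr1 g)
      refine Concl_of_conj hP h1 h2 (Concl_of_eq ?_)
      exact Or.inr (Or.inr (Or.inr (Or.inr ⟨rfl, case_KS (cj_clsub hH h1 h2) (cj_conn hC) (cj_sub hs hP h1) G2⟩)))

theorem main_concl' {n : ℕ} (hn : 1 ≤ n) {H : Set (QM n)} (hs : H ⊆ Sp n) (hone : (1 : QM n) ∈ H)
    (hmul : ∀ A ∈ H, ∀ B ∈ H, A * B ∈ H) (hinv : ∀ A ∈ H, ∃ B ∈ H, A * B = 1 ∧ B * A = 1)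
    (hclosed : IsClosed (Subtype.val ⁻¹' H : Set (Sp n))) (hconn : IsConnected H)
    (hirr : ActsHIrreducibly n H) : Concl n H := by
  have hcl : IsClosed H := by
    have := (Sp_closed (n := n)).isClosedEmbedding_subtypeVal.isClosedMap _ hclosed
    rwa [Subtype.image_preimage_coe, Set.inter_eq_right.2 hs] at this
  have hH : MClSub H := MClSub.mk' hone hmul hinv hcl
  obtain ⟨m, rfl⟩ : ∃ m, n = m + 1 := ⟨n - 1, by omega⟩
  exact main_concl hH hconn.isPreconnected hs hirr

end Final

end

theorem classification_of_closed_connected_Hirreducible_subgroups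
    (n : ℕ) (hn : 1 ≤ n) (H : Set (Matrix (Fin (n + 1)) (Fin (n + 1)) Quat))
    (hsub : H ⊆ Sp n)
    (hone : (1 : Matrix (Fin (n + 1)) (Fin (n + 1)) Quat) ∈ H)
    (hmul : ∀ A ∈ H, ∀ B ∈ H, A * B ∈ H)
    (hinv : ∀ A ∈ H, ∃ B ∈ H, A * B = 1 ∧ B * A = 1)
    (hclosed : IsClosed (Subtype.val ⁻¹' H : Set (Sp n)))
    (hconn : IsConnected H)
    (hirr : ActsHIrreducibly n H) :
    ∃ P ∈ Sp n, ∃ Pinv : Matrix (Fin (n + 1)) (Fin (n + 1)) Quat,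
      P * Pinv = 1 ∧ Pinv * P = 1 ∧
      ((2 ≤ n ∧ ((fun A => P * A * Pinv) '' H = SOo n ∨
                 (fun A => P * A * Pinv) '' H = SOo n * U1One n ∨
                 (fun A => P * A * Pinv) '' H = SOo n * Sp1One n)) ∨
       (fun A => P * A * Pinv) '' H = SUgrp n ∨
       (fun A => P * A * Pinv) '' H = Ugrp n ∨
       (fun A => P * A * Pinv) '' H = Sp n ∨
       (n = 1 ∧ (fun A => P * A * Pinv) '' H = U0grp n)) := by
  exact main_concl' hn hsub hone hmul hinv hclosed hconn hirr
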